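/- Let $d\in\{2,3\}$, $k\ge 1$, $\nu>0$, $0<\epsilon<1/2$. Let $\Omega\subset\mathbb R^d$ be a bounded open polygonal/polyhedral set with a conforming simplicial triangulation $\mathcal T_h$ (finitely many nondegenerate closed simplices, any two meeting in the convex hull of their common vertices, with $\Omega$ the interior of their union; this includes every triangulated polyhedral Lipschitz domain). Let $\mathcal E_h$ be the set of faces, $h_T=\operatorname{diam}T$, $\eta|_{\partial T}=h_T^{-1}$, $n$ the outward unit normal on $\partial T$, and write $(\cdot,\cdot)_{\mathcal T_h}=\sum_T(\cdot,\cdot)_{L^2(T)}$, $\langle\cdot,\cdot\rangle_{\partial\mathcal T_h}=\sum_T\langle\cdot,\cdot\rangle_{L^2(\partial T)}$. Gradients are $(\nabla u)_{ij}=\partial_ju_i$ and divergences of tensors are taken row-wise. Put - $\Sigma_h=\{G:\ G|_T\in[P_{k-1}(T)]^{d\times d}\ \forall T\}$, - $V_h^0=\{v\in H(\mathrm{div};\Omega):\ v|_T\in[P_k(T)]^d\ \forall T,\ v\cdot n|_{\partial\Omega}=0\}$, - $\hat V_h^0=\{\hat v:\ \hat v|_E\in[P_{k-1}(E)]^d\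 \forall E\in\mathcal E_h,\ \hat v|_{\partial\Omega}=0\}$, - $Q_h=\{q\in L^2_0(\Omega):\ q|_T\in P_{k-1}(T)\ \forall T\}$. Let $\Pi^o_{k-1}$ and $\Pi^\partial_{k-1}$ be the componentwise $L^2$ projections onto polynomials of degree at most $k-1$ on elements and on faces, respectively (for $u\in[H^1(\Omega)]^d$, $\Pi^\partial_{k-1}u$ is the projection of the trace of $u$), and let $\Pi_k^{BDM}u|_T\in[P_k(T)]^d$ be the Brezzi–Douglas–Marini projection: $\langle\Pi_k^{BDM}u\cdot n,w\rangle_E=\langle u\cdot n,w\rangle_E$ for all $w\in P_k(E)$ and all faces $E$ of $T$; $(\Pi_k^{BDM}u,\nabla s)_T=(u,\nabla s)_T$ for all $s\in P_{k-1}(T)$; and moreover, if $d=2$ and $k\ge2$, $(\Pi_k^{BDM}u,\operatorname{curl}(b_Ts))_T=(u,\operatorname{curl}(b_Ts))_T$ for all $s\in P_{k-2}(T)$, with $b_T$ the product of the barycentric coordinates, and, if $d=3$, $(\Pi_k^{BDM}u,w)_T=(u,w)_T$ for all $w\in[P_k(T)]^3$ with $\nabla\cdot w=0$ and $w\cdot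 n|_{\partial T}=0$. Define $$\mathscr B(L_h,u_h,\hat u_h,p_h;G_h,v_h,\hat v_h,q_h)=\nu^{-1}(L_h,G_h)_{\mathcal T_h}+(u_h,\nabla\cdot G_h)_{\mathcal T_h}-\langle\hat u_h,G_hn\rangle_{\partial\mathcal T_h}-(\nabla\cdot L_h,v_h)_{\mathcal T_h}+\langle L_hn,\hat v_h\rangle_{\partial\mathcal T_h}-(p_h,\nabla\cdot v_h)_{\mathcal T_h}+\nu\langle\eta(\Pi^\partial_{k-1}u_h-\hat u_h),\Pi^\partial_{k-1}v_h-\hat v_h\rangle_{\partial\mathcal T_h}+(\nabla\cdot u_h,q_h)_{\mathcal T_h}.$$ Let $f\in[L^2(\Omega)]^d$ and suppose that $(L,u,p)\in[H^\epsilon(\Omega)]^{d\times d}\times[H^1(\Omega)]^d\times(H^\epsilon(\Omega)\cap L^2_0(\Omega))$ solves, in the sense of distributions, $\nu^{-1}L-\nabla u=0$, $-\nabla\cdot L+\nabla p=f$, $\nabla\cdot u=0$ in $\Omega$, with $u=g$ on $\partial\Omega$ in the sense of traces. Then for all $(G_h,v_h,\hat v_h,q_h)\in\Sigma_h\times V_h^0\times\hat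 V_h^0\times Q_h$ $$\mathscr B(\Pi^o_{k-1}L,\Pi_k^{BDM}u,\Pi^\partial_{k-1}u,\Pi^o_{k-1}p;G_h,v_h,\hat v_h,q_h)=(f,v_h)_{\mathcal T_h}+E(L,u;G_h,v_h,\hat v_h),$$ where $$E(L,u;G_h,v_h,\hat v_h)=\langle(\Pi^o_{k-1}L-L)n,\hat v_h-v_h\rangle_{\partial\mathcal T_h}+\nu\langle\eta(\Pi_k^{BDM}u-u),\Pi^\partial_{k-1}v_h-\hat v_h\rangle_{\partial\mathcal T_h}+(\Pi_k^{BDM}u-u,\nabla\cdot G_h)_{\mathcal T_h}.$$ Here $\langle Ln,w\rangle_{\partial\mathcal T_h}$, for $w=\hat v_h-v_h$, is the sum over all $T$ and all faces $E\subset\partial T$ of the duality pairings between $H^{\epsilon-1/2}(E)$ and $H^{1/2-\epsilon}(E)$ of $(L-\pi I)n$ with $w$, where $\pi\in H^\epsilon(\Omega)$ is any function with $\nabla\cdot(L-\pi I)\in[L^2(\Omega)]^d$ (for instance $\pi=p$, or $\pi=0$ if $\nabla\cdot L\in L^2$; the sum does not depend on $\pi$). For $\sigma\in[H^\epsilon(T)]^{d\times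 d}$ with $\nabla\cdot\sigma\in[L^2(T)]^d$, the pairing $\langle\sigma n,w\rangle_E$ is the continuous extension of $\int_E\sigma n\cdot w$ from tensor fields smooth up to the boundary, with respect to convergence of $\sigma$ in $H^\epsilon(T)$ and of $\nabla\cdot\sigma$ in $L^2(T)$. -/

import Mathlib

open MeasureTheory Filter Topology
open scoped ENNReal ContDiff

noncomputable section

namespace HDG

/-! ### Points, polynomials, weak derivatives, Sobolev spaces -/

/-- The Euclidean space `ℝ^d`. -/
abbrev Pt (d : ℕ) : Type := EuclideanSpace ℝ (Fin d)

/-- Polynomials in `d` real variables. -/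
abbrev Poly (d : ℕ) : Type := MvPolynomial (Fin d) ℝ

/-- `P_m`: polynomials of total degree at most `m`. -/
abbrev PolyLE (d m : ℕ) : Submodule ℝ (Poly d) :=
  MvPolynomial.restrictTotalDegree (Fin d) ℝ m

variable {d : ℕ}

/-- The value of a polynomial at a point. -/
def val (q : Poly d) (x : Pt d) : ℝ := MvPolynomial.eval (fun j => x j) q

/-- The divergence of a polynomial vector field. -/
def pdiv (v : Fin d → Poly d) : Poly d := ∑ j, MvPolynomial.pderiv j (v j)

/-- The classical partial derivative `∂_j φ`. -/
def pd (j : Fin d) (φ : Pt d → ℝ) (x : Pt d) : ℝ :=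
  fderiv ℝ φ x (EuclideanSpace.single j 1)

/-- Test functions `C_c^∞(Ω)`. -/
def IsTest (Ω : Set (Pt d)) (φ : Pt d → ℝ) : Prop :=
  ContDiff ℝ ∞ φ ∧ HasCompactSupport φ ∧ tsupport φ ⊆ Ω

/-- `f ∈ L²(Ω)`. -/
def MemL2 (Ω : Set (Pt d)) (f : Pt d → ℝ) : Prop := MemLp f 2 (volume.restrict Ω)

/-- `g = ∂_j f` in `Ω` in the weak sense. -/
def HasWeakPartial (Ω : Set (Pt d)) (j : Fin d) (f g : Pt d → ℝ) : Prop :=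
  ∀ φ, IsTest Ω φ → ∫ x in Ω, f x * pd j φ x = -∫ x in Ω, g x * φ x

/-- `D = ∇·V` in `Ω` in the weak sense. -/
def HasWeakDiv (Ω : Set (Pt d)) (V : Fin d → Pt d → ℝ) (D : Pt d → ℝ) : Prop :=
  ∀ φ, IsTest Ω φ → ∫ x in Ω, ∑ j, V j x * pd j φ x = -∫ x in Ω, D x * φ x

/-- `f ∈ H¹(Ω)`. -/
def MemH1 (Ω : Set (Pt d)) (f : Pt d → ℝ) : Prop :=
  MemL2 Ω f ∧ ∀ j, ∃ g, MemL2 Ω g ∧ HasWeakPartial Ω j f g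

/-- `V ∈ H(div; Ω)`. -/
def MemHdiv (Ω : Set (Pt d)) (V : Fin d → Pt d → ℝ) : Prop :=
  (∀ j, MemL2 Ω (V j)) ∧ ∃ D, MemL2 Ω D ∧ HasWeakDiv Ω V D

/-- The square of the Sobolev–Slobodeckij seminorm `|f|_{s,Ω}`, `0 < s < 1`:
`∫_Ω ∫_Ω |f x - f y|² / |x - y|^{d+2s}`. -/
def slobodeckijSq (s : ℝ) (Ω : Set (Pt d)) (f : Pt d → ℝ) : ℝ≥0∞ :=
  ∫⁻ x in Ω, ∫⁻ y in Ω,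
    ENNReal.ofReal ((f x - f y) ^ 2 / ‖x - y‖ ^ ((d : ℝ) + 2 * s))

/-- `f ∈ H^s(Ω)`, `0 < s < 1`. -/
def MemHs (s : ℝ) (Ω : Set (Pt d)) (f : Pt d → ℝ) : Prop :=
  MemL2 Ω f ∧ slobodeckijSq s Ω f < ⊤

/-- Convergence `f_n → f` in `L²(μ)`. -/
def TendstoL2 (μ : Measure (Pt d)) (f : ℕ → Pt d → ℝ) (g : Pt d → ℝ) : Prop :=
  Tendsto (fun n => eLpNorm (fun x => f n x - g x) 2 μ) atTop (𝓝 0)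

/-- The tensor field `L - π I`. -/
def subId (L : Fin d → Fin d → Pt d → ℝ) (π : Pt d → ℝ) : Fin d → Fin d → Pt d → ℝ :=
  fun i j x => L i j x - if i = j then π x else 0

/-! ### Simplices -/

/-- A nondegenerate `d`-simplex in `ℝ^d`. -/
abbrev Elt (d : ℕ) : Type := Affine.Simplex ℝ (Pt d) d

/-- The closed simplex. -/
def body (K : Elt d) : Set (Pt d) := K.closedInterior

variable [NeZero d]

/-- The closed face opposite to vertex `i`. -/
def face (K : Elt d) (i : Fin (d + 1)) : Set (Pt d) := (K.faceOpposite i).closedInterior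

/-- The surface measure on a face. -/
def surf (F : Set (Pt d)) : Measure (Pt d) :=
  (Measure.euclideanHausdorffMeasure (d - 1)).restrict F

/-- The outward unit normal of `K` on the face opposite to vertex `i`. -/
def nrm (K : Elt d) (i : Fin (d + 1)) : Pt d :=
  (K.height i)⁻¹ • (K.altitudeFoot i - K.points i)

/-- The barycentric coordinate `λ_i` of `K`, as a polynomial. -/
def bary (K : Elt d) (i : Fin (d + 1)) : Poly d :=
  ∑ j, MvPolynomial.C (-(nrm K i j) / K.height i) *
    (MvPolynomial.X j - MvPolynomial.C (K.altitudeFoot i j))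

/-- The bubble function `b_K = ∏ λ_i`. -/
def bubble (K : Elt d) : Poly d := ∏ i, bary K i

/-- The planar vector curl `(∂_2 φ, -∂_1 φ)`; it is used only for `d = 2`. -/
def curl2 (φ : Poly d) (j : Fin d) : Poly d :=
  ∑ l : Fin d,
    if j.val = 0 ∧ l.val = 1 then MvPolynomial.pderiv l φ
    else if j.val = 1 ∧ l.val = 0 then -MvPolynomial.pderiv l φ else 0

/-- The space `P_k^*(K)` of divergence-free fields in `[P_k]^d` with vanishing normal
component on `∂K`. -/
def MemPStar (k : ℕ) (K : Elt d) (w : Fin d → Poly d) : Prop :=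
  (∀ j, w j ∈ PolyLE d k) ∧ pdiv w = 0 ∧
    ∀ i, ∀ x ∈ face K i, ∑ j, val (w j) x * nrm K i j = 0

/-! ### Triangulations -/

/-- A conforming simplicial triangulation of the open set `Ω`: finitely many pairwise distinct
nondegenerate simplices, any two of which meet in the (possibly empty) convex hull of their common
vertices, and the interior of whose union is `Ω`. -/
structure Triangulation (Ω : Set (Pt d)) (ι : Type*) where
  elt : ι → Elt d
  distinct : ∀ s t, s ≠ t → Set.range (elt s).points ≠ Set.range (elt t).points
  conforming : ∀ s t, body (elt s) ∩ body (elt t) =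
    convexHull ℝ (Set.range (elt s).points ∩ Set.range (elt t).points)
  cover : Ω = interior (⋃ t, body (elt t))

variable {Ω : Set (Pt d)} {ι : Type*}

/-- The set `𝓔_h` of faces. -/
def Triangulation.faces (𝒯 : Triangulation Ω ι) : Set (Set (Pt d)) :=
  {F | ∃ t i, F = face (𝒯.elt t) i}

/-- The diameter `h_T`. -/
def Triangulation.diam (𝒯 : Triangulation Ω ι) (t : ι) : ℝ := Metric.diam (body (𝒯.elt t))

/-! ### Traces on faces -/

/-- `γ ∈ L²(F)` is the trace on the face `F` of `f ∈ H¹(K)`: it is the `L²(F)`-limit of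
`φ_n|_F` for functions `φ_n` smooth up to the boundary that converge to `f` in `H¹(K)`. -/
def IsTrace (K : Elt d) (F : Set (Pt d)) (f γ : Pt d → ℝ) : Prop :=
  MemLp γ 2 (surf F) ∧
  ∃ Df : Fin d → Pt d → ℝ,
    (∀ j, MemL2 (interior (body K)) (Df j) ∧ HasWeakPartial (interior (body K)) j f (Df j)) ∧
    ∃ φ : ℕ → Pt d → ℝ, (∀ n, ContDiff ℝ ∞ (φ n)) ∧
      TendstoL2 (volume.restrict (body K)) φ f ∧
      (∀ j, TendstoL2 (volume.restrict (body K)) (fun n => pd j (φ n)) (Df j)) ∧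
      TendstoL2 (surf F) φ γ

/-- The (single-valued) trace on the face `F` of a function `f ∈ H¹(Ω)`. -/
def Triangulation.trace (𝒯 : Triangulation Ω ι) (f : Pt d → ℝ) (F : Set (Pt d)) : Pt d → ℝ :=
  Classical.epsilon fun γ => ∀ t i, face (𝒯.elt t) i = F → IsTrace (𝒯.elt t) F f γ

/-- `ℓ` is the value of the pairing `⟨σ n, w⟩_F` between `H^{s-1/2}(F)` and `H^{1/2-s}(F)`, `F` the
face of `K` opposite to vertex `i`, for `σ ∈ H^s(K)` with (row-wise) divergence in `L²(K)`:
it is the limit of the integrals `∫_F τ_n n · w` for tensor fields `τ_n` smooth up to the boundary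
with `τ_n → σ` in `H^s(K)` and `∇·τ_n → ∇·σ` in `L²(K)`. -/
def IsNormalPairing (s : ℝ) (K : Elt d) (i : Fin (d + 1)) (σ : Fin d → Fin d → Pt d → ℝ)
    (w : Fin d → Pt d → ℝ) (ℓ : ℝ) : Prop :=
  ∃ D : Fin d → Pt d → ℝ,
    (∀ r, MemL2 (interior (body K)) (D r) ∧ HasWeakDiv (interior (body K)) (σ r) (D r)) ∧
    ∃ τ : ℕ → Fin d → Fin d → Pt d → ℝ, (∀ n r c, ContDiff ℝ ∞ (τ n r c)) ∧
      (∀ r c, TendstoL2 (volume.restrict (body K)) (fun n => τ n r c) (σ r c)) ∧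
      (∀ r c, Tendsto (fun n => slobodeckijSq s (body K) (fun x => τ n r c x - σ r c x))
        atTop (𝓝 0)) ∧
      (∀ r, TendstoL2 (volume.restrict (body K)) (fun n x => ∑ c, pd c (τ n r c) x) (D r)) ∧
      Tendsto (fun n => ∫ x, ∑ r, (∑ c, τ n r c x * nrm K i c) * w r x ∂(surf (face K i)))
        atTop (𝓝 ℓ)

/-- The pairing `⟨σ n, w⟩_F`. -/
def normalPairing (s : ℝ) (K : Elt d) (i : Fin (d + 1)) (σ : Fin d → Fin d → Pt d → ℝ)
    (w : Fin d → Pt d → ℝ) : ℝ :=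
  Classical.epsilon (IsNormalPairing s K i σ w)

/-- The pairing `⟨L n, w⟩_{∂T_h}` for `L ∈ H^s(Ω)` whose divergence is an `L²` field up to the
gradient of some `π ∈ H^s(Ω)`. Such an `L` has no normal trace of its own, but `L - π I` has one,
and the pairing is that of `L - π I` with `w`. It is used only for `w` whose normal component
is single-valued on interior faces and zero on `∂Ω`; for these `⟨π n, w⟩_{∂T_h} = 0`, and
the value does not depend on the choice of `π`. If `∇·L` itself is in `L²`, one may take `π = 0`. -/
def Triangulation.tensorPairing [Fintype ι] (𝒯 : Triangulation Ω ι) (s : ℝ)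
    (L : Fin d → Fin d → Pt d → ℝ) (w : ι → Fin (d + 1) → Fin d → Pt d → ℝ) : ℝ :=
  Classical.epsilon fun ℓ => ∃ π : Pt d → ℝ, MemHs s Ω π ∧ (∀ r, MemHdiv Ω (subId L π r)) ∧
    ℓ = ∑ t, ∑ i, normalPairing s (𝒯.elt t) i (subId L π) (w t i)

/-! ### Projections -/

/-- The `L²(K)`-projection of `f` onto `P_m(K)`. -/
def elemProj (m : ℕ) (K : Elt d) (f : Pt d → ℝ) : Poly d :=
  Classical.epsilon fun q => q ∈ PolyLE d m ∧
    ∀ w ∈ PolyLE d m, ∫ x in body K, val q x * val w x = ∫ x in body K, f x * val w x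

/-- The `L²(F)`-projection of `f` onto `P_m(F)`, the restrictions to `F` of polynomials of degree
at most `m`; only its values on `F` are meaningful. -/
def faceProj (m : ℕ) (F : Set (Pt d)) (f : Pt d → ℝ) : Pt d → ℝ :=
  val (Classical.epsilon fun q : Poly d => q ∈ PolyLE d m ∧
    ∀ w ∈ PolyLE d m, ∫ x, val q x * val w x ∂(surf F) = ∫ x, f x * val w x ∂(surf F))

/-- The defining equations of the Brezzi–Douglas–Marini projection `q ∈ [P_k(K)]^d` of the vector
field `u` with face traces `γ`. -/
def IsBDM (k : ℕ) (K : Elt d) (u : Fin d → Pt d → ℝ) (γ : Fin (d + 1) → Fin d → Pt d → ℝ)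
    (q : Fin d → Poly d) : Prop :=
  (∀ j, q j ∈ PolyLE d k) ∧
  (∀ i, ∀ w ∈ PolyLE d k,
    ∫ x, (∑ j, val (q j) x * nrm K i j) * val w x ∂(surf (face K i)) =
      ∫ x, (∑ j, γ i j x * nrm K i j) * val w x ∂(surf (face K i))) ∧
  (∀ s ∈ PolyLE d (k - 1),
    ∫ x in body K, ∑ j, val (q j) x * val (MvPolynomial.pderiv j s) x =
      ∫ x in body K, ∑ j, u j x * val (MvPolynomial.pderiv j s) x) ∧
  (d = 2 → 2 ≤ k → ∀ s ∈ PolyLE d (k - 2),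
    ∫ x in body K, ∑ j, val (q j) x * val (curl2 (bubble K * s) j) x =
      ∫ x in body K, ∑ j, u j x * val (curl2 (bubble K * s) j) x) ∧
  (d = 3 → ∀ w, MemPStar k K w →
    ∫ x in body K, ∑ j, val (q j) x * val (w j) x =
      ∫ x in body K, ∑ j, u j x * val (w j) x)

namespace Triangulation

/-- `Π_m^o` applied elementwise to a scalar field. -/
def projQ (𝒯 : Triangulation Ω ι) (m : ℕ) (p : Pt d → ℝ) : ι → Poly d :=
  fun t => elemProj m (𝒯.elt t) p

/-- `Π_m^o` applied elementwise and componentwise to a tensor field. -/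
def projS (𝒯 : Triangulation Ω ι) (m : ℕ) (L : Fin d → Fin d → Pt d → ℝ) :
    ι → Fin d → Fin d → Poly d :=
  fun t r c => elemProj m (𝒯.elt t) (L r c)

/-- `Π_m^∂ u` for `u ∈ [H¹(Ω)]^d`: on each face, the projection of the trace. -/
def projTrace (𝒯 : Triangulation Ω ι) (m : ℕ) (u : Fin d → Pt d → ℝ) :
    Set (Pt d) → Fin d → Pt d → ℝ :=
  fun F r => faceProj m F (𝒯.trace (u r) F)

/-- `Π_k^{BDM} u` for `u ∈ [H¹(Ω)]^d`. -/
def projBDM (𝒯 : Triangulation Ω ι) (k : ℕ) (u : Fin d → Pt d → ℝ) : ι → Fin d → Poly d :=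
  fun t => Classical.epsilon
    (IsBDM k (𝒯.elt t) u (fun i j => 𝒯.trace (u j) (face (𝒯.elt t) i)))

/-! ### Discrete spaces

Elementwise polynomial fields are families of polynomials indexed by the elements; fields on the
skeleton are families of functions indexed by the faces. -/

/-- The function on `Ω` that equals `q t` in the interior of the element `t`. -/
def glue [Fintype ι] (𝒯 : Triangulation Ω ι) (q : ι → Poly d) (x : Pt d) : ℝ :=
  ∑ t, (interior (body (𝒯.elt t))).indicator (val (q t)) x

/-- `Σ_h`. -/
def MemSigma (_𝒯 : Triangulation Ω ι) (k : ℕ) (G : ι → Fin d → Fin d → Poly d) : Prop :=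
  ∀ t r c, G t r c ∈ PolyLE d (k - 1)

/-- `V_h^0`. -/
def MemV0 [Fintype ι] (𝒯 : Triangulation Ω ι) (k : ℕ) (v : ι → Fin d → Poly d) : Prop :=
  (∀ t r, v t r ∈ PolyLE d k) ∧
  MemHdiv Ω (fun r => 𝒯.glue (fun t => v t r)) ∧
  ∀ t i, face (𝒯.elt t) i ⊆ frontier Ω →
    ∀ x ∈ face (𝒯.elt t) i, ∑ r, val (v t r) x * nrm (𝒯.elt t) i r = 0

/-- `V̂_h^0`. -/
def MemVhat0 (𝒯 : Triangulation Ω ι) (k : ℕ) (vhat : Set (Pt d) → Fin d → Pt d → ℝ) : Prop :=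
  ∀ F ∈ 𝒯.faces,
    (∀ r, ∃ q ∈ PolyLE d (k - 1), ∀ x ∈ F, vhat F r x = val q x) ∧
    (F ⊆ frontier Ω → ∀ r, ∀ x ∈ F, vhat F r x = 0)

/-- `Q_h`. -/
def MemQ [Fintype ι] (𝒯 : Triangulation Ω ι) (k : ℕ) (q : ι → Poly d) : Prop :=
  (∀ t, q t ∈ PolyLE d (k - 1)) ∧ ∑ t, ∫ x in body (𝒯.elt t), val (q t) x = 0

/-! ### The bilinear form and the consistency error -/

/-- `Π_{k-1}^∂ v_h - v̂_h` on the face of the element `t` opposite to vertex `i`. -/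
def jump (𝒯 : Triangulation Ω ι) (k : ℕ) (v : ι → Fin d → Poly d)
    (vhat : Set (Pt d) → Fin d → Pt d → ℝ) (t : ι) (i : Fin (d + 1)) (r : Fin d) (x : Pt d) : ℝ :=
  faceProj (k - 1) (face (𝒯.elt t) i) (val (v t r)) x - vhat (face (𝒯.elt t) i) r x

/-- `∑_T ∫_T F_T`. -/
def sumT [Fintype ι] (𝒯 : Triangulation Ω ι) (F : ι → Pt d → ℝ) : ℝ :=
  ∑ t, ∫ x in body (𝒯.elt t), F t x

/-- `∑_T ∫_{∂T} F_T`, where `F t i` is the integrand on the `i`-th face of the element `t`. -/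
def sumB [Fintype ι] (𝒯 : Triangulation Ω ι) (F : ι → Fin (d + 1) → Pt d → ℝ) : ℝ :=
  ∑ t, ∑ i, ∫ x, F t i x ∂(surf (face (𝒯.elt t) i))

/-- The bilinear form
`ℬ(L, u, û, p; G, v, v̂, q) = ν⁻¹(L, G) + (u, ∇·G) - ⟨û, G n⟩ - (∇·L, v) + ⟨L n, v̂⟩ - (p, ∇·v)
+ ν⟨η(Π^∂ u - û), Π^∂ v - v̂⟩ + (∇·u, q)`, with `η = h_T⁻¹` on `∂T`. -/
def bform [Fintype ι] (𝒯 : Triangulation Ω ι) (k : ℕ) (ν : ℝ)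
    (L : ι → Fin d → Fin d → Poly d) (u : ι → Fin d → Poly d)
    (uhat : Set (Pt d) → Fin d → Pt d → ℝ) (p : ι → Poly d)
    (G : ι → Fin d → Fin d → Poly d) (v : ι → Fin d → Poly d)
    (vhat : Set (Pt d) → Fin d → Pt d → ℝ) (q : ι → Poly d) : ℝ :=
  ν⁻¹ * 𝒯.sumT (fun t x => ∑ r, ∑ c, val (L t r c) x * val (G t r c) x)
  + 𝒯.sumT (fun t x => ∑ r, val (u t r) x * val (pdiv (G t r)) x)
  - 𝒯.sumB (fun t i x => ∑ r, uhat (face (𝒯.elt t) i) r x *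
      ∑ c, val (G t r c) x * nrm (𝒯.elt t) i c)
  - 𝒯.sumT (fun t x => ∑ r, val (pdiv (L t r)) x * val (v t r) x)
  + 𝒯.sumB (fun t i x => ∑ r, (∑ c, val (L t r c) x * nrm (𝒯.elt t) i c) *
      vhat (face (𝒯.elt t) i) r x)
  - 𝒯.sumT (fun t x => val (p t) x * val (pdiv (v t)) x)
  + ν * 𝒯.sumB (fun t i x => (𝒯.diam t)⁻¹ *
      ∑ r, 𝒯.jump k u uhat t i r x * 𝒯.jump k v vhat t i r x)
  + 𝒯.sumT (fun t x => val (pdiv (u t)) x * val (q t) x)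

/-- The consistency error
`E(L, u; G, v, v̂) = ⟨(Π_{k-1}^o L - L) n, v̂ - v⟩ + ν⟨η(Π_k^{BDM} u - u), Π_{k-1}^∂ v - v̂⟩
+ (Π_k^{BDM} u - u, ∇·G)`. -/
def cerr [Fintype ι] (𝒯 : Triangulation Ω ι) (s : ℝ) (k : ℕ) (ν : ℝ)
    (L : Fin d → Fin d → Pt d → ℝ) (u : Fin d → Pt d → ℝ)
    (G : ι → Fin d → Fin d → Poly d) (v : ι → Fin d → Poly d)
    (vhat : Set (Pt d) → Fin d → Pt d → ℝ) : ℝ :=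
  (𝒯.sumB (fun t i x =>
      ∑ r, (∑ c, val (𝒯.projS (k - 1) L t r c) x * nrm (𝒯.elt t) i c) *
        (vhat (face (𝒯.elt t) i) r x - val (v t r) x))
    - 𝒯.tensorPairing s L
        (fun t i r x => vhat (face (𝒯.elt t) i) r x - val (v t r) x))
  + ν * 𝒯.sumB (fun t i x => (𝒯.diam t)⁻¹ *
      ∑ r, (val (𝒯.projBDM k u t r) x - 𝒯.trace (u r) (face (𝒯.elt t) i) x) *
        𝒯.jump k v vhat t i r x)
  + 𝒯.sumT (fun t x => ∑ r, (val (𝒯.projBDM k u t r) x - u r x) * val (pdiv (G t r)) x)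

/-- `(L, u, p)` solves `ν⁻¹ L - ∇u = 0`, `-∇·L + ∇p = f`, `∇·u = 0` in `Ω` (in the sense of
distributions), and `u = g` on `∂Ω` (in the sense of traces). -/
def IsStokesSolution (𝒯 : Triangulation Ω ι) (ν : ℝ) (L : Fin d → Fin d → Pt d → ℝ)
    (u : Fin d → Pt d → ℝ) (p : Pt d → ℝ) (f g : Fin d → Pt d → ℝ) : Prop :=
  (∀ r c, HasWeakPartial Ω c (u r) (fun x => ν⁻¹ * L r c x)) ∧
  (∀ r φ, IsTest Ω φ →
    (∫ x in Ω, ∑ c, L r c x * pd c φ x) - ∫ x in Ω, p x * pd r φ x = ∫ x in Ω, f r x * φ x) ∧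
  HasWeakDiv Ω u 0 ∧
  ∀ F ∈ 𝒯.faces, F ⊆ frontier Ω → ∀ r, 𝒯.trace (u r) F =ᵐ[surf F] g r

end Triangulation

end HDG

end

set_option linter.unusedSectionVars false
set_option linter.unusedSimpArgs false
set_option linter.deprecated false

open MeasureTheory Filter Topology
open scoped ENNReal ContDiff

noncomputable section

namespace HDG

variable {d : ℕ} [NeZero d]

/-! ### Barycentric coordinates of a simplex -/

/-- The barycentric coordinate `λ_i` of `K` as a function. -/
def lam (K : Elt d) (i : Fin (d + 1)) (x : Pt d) : ℝ := val (bary K i) x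

theorem lam_eq_sum (K : Elt d) (i : Fin (d + 1)) (x : Pt d) :
    lam K i x = ∑ j, (-(nrm K i j) / K.height i) * (x j - K.altitudeFoot i j) := by
  simp [lam, val, bary]

theorem lam_eq_inner (K : Elt d) (i : Fin (d + 1)) (x : Pt d) :
    lam K i x = -(inner ℝ (x - K.altitudeFoot i) (nrm K i)) / K.height i := by
  rw [lam_eq_sum, PiLp.inner_apply, ← Finset.sum_neg_distrib, Finset.sum_div]
  refine Finset.sum_congr rfl fun j _ => ?_
  simp
  ring

theorem lam_sub (K : Elt d) (i : Fin (d + 1)) (x y : Pt d) :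
    lam K i x - lam K i y = -(inner ℝ (x - y) (nrm K i)) / K.height i := by
  rw [lam_eq_inner, lam_eq_inner, ← sub_div]
  congr 1
  rw [← sub_sub_sub_cancel_right x y (K.altitudeFoot i), inner_sub_left (x - _)]
  ring

theorem lam_point_self (K : Elt d) (i : Fin (d + 1)) : lam K i (K.points i) = 1 := by
  have h := K.height_pos i
  rw [lam_eq_inner, nrm, inner_smul_right, ← neg_sub (K.points i) (K.altitudeFoot i),
    inner_neg_right, real_inner_self_eq_norm_sq, ← dist_eq_norm]
  change -((K.height i)⁻¹ * -(K.height i ^ 2)) / _ = 1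
  field_simp

theorem lam_point_of_ne (K : Elt d) {i j : Fin (d + 1)} (h : i ≠ j) :
    lam K i (K.points j) = 0 := by
  have := K.inner_vsub_altitudeFoot_vsub_altitudeFoot_eq_zero h
  simp only [vsub_eq_sub] at this
  rw [lam_eq_inner, nrm, inner_smul_right, ← neg_sub (K.points i) (K.altitudeFoot i),
    inner_neg_right, this]
  simp

theorem lam_point (K : Elt d) (i j : Fin (d + 1)) :
    lam K i (K.points j) = if i = j then 1 else 0 := by
  split_ifs with h
  · rw [h, lam_point_self]
  · exact lam_point_of_ne K h

/-- `λ_i` is affine. -/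
theorem lam_sum (K : Elt d) (i : Fin (d + 1)) {κ : Type*} (s : Finset κ) (w : κ → ℝ)
    (p : κ → Pt d) (hw : ∑ j ∈ s, w j = 1) :
    lam K i (∑ j ∈ s, w j • p j) = ∑ j ∈ s, w j * lam K i (p j) := by
  have h0 : ∀ x, lam K i x = lam K i 0 - inner ℝ x (nrm K i) / K.height i := by
    intro x
    have := lam_sub K i x 0
    rw [sub_zero] at this
    linarith [neg_div (K.height i) (inner ℝ x (nrm K i))]
  have h1 : ∑ j ∈ s, w j * lam K i (p j) =
      ∑ j ∈ s, w j * lam K i 0 - ∑ j ∈ s, w j * (inner ℝ (p j) (nrm K i) / K.height i) := by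
    rw [← Finset.sum_sub_distrib]
    refine Finset.sum_congr rfl fun j _ => ?_
    rw [h0 (p j), mul_sub]
  rw [h0, h1, ← Finset.sum_mul, hw, one_mul, sum_inner, Finset.sum_div]
  congr 1
  refine Finset.sum_congr rfl fun j _ => ?_
  rw [real_inner_smul_left, mul_div_assoc]

theorem exists_weights (K : Elt d) (x : Pt d) :
    ∃ w : Fin (d + 1) → ℝ, ∑ i, w i = 1 ∧ x = ∑ i, w i • K.points i := by
  have hx : x ∈ affineSpan ℝ (Set.range K.points) := by
    rw [K.span_eq_top (by simp)]
    trivial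
  obtain ⟨w, hw, h⟩ := eq_affineCombination_of_mem_affineSpan_of_fintype hx
  exact ⟨w, hw, by rw [h, Finset.affineCombination_eq_linear_combination _ _ _ hw]⟩

theorem lam_sum_smul_points (K : Elt d) (i : Fin (d + 1)) (w : Fin (d + 1) → ℝ)
    (hw : ∑ j, w j = 1) : lam K i (∑ j, w j • K.points j) = w i := by
  rw [lam_sum K i _ w K.points hw]
  simp [lam_point]

theorem sum_lam (K : Elt d) (x : Pt d) : ∑ i, lam K i x = 1 := by
  obtain ⟨w, hw, rfl⟩ := exists_weights K x
  simp_rw [lam_sum_smul_points K _ w hw, hw]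

theorem sum_lam_smul (K : Elt d) (x : Pt d) : ∑ i, lam K i x • K.points i = x := by
  obtain ⟨w, hw, rfl⟩ := exists_weights K x
  simp_rw [lam_sum_smul_points K _ w hw]

theorem body_eq_convexHull (K : Elt d) : body K = convexHull ℝ (Set.range K.points) :=
  K.convexHull_eq_closedInterior.symm

theorem mem_body_iff (K : Elt d) (x : Pt d) : x ∈ body K ↔ ∀ i, 0 ≤ lam K i x := by
  obtain ⟨w, hw, rfl⟩ := exists_weights K x
  simp_rw [lam_sum_smul_points K _ w hw]
  rw [body, ← Finset.affineCombination_eq_linear_combination _ _ _ hw,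
    Affine.Simplex.affineCombination_mem_closedInterior_iff hw]
  refine ⟨fun h i => (h i).1, fun h i => ⟨h i, ?_⟩⟩
  rw [← hw]
  exact Finset.single_le_sum (fun j _ => h j) (Finset.mem_univ i)

theorem mem_face_iff (K : Elt d) (i : Fin (d + 1)) (x : Pt d) :
    x ∈ face K i ↔ lam K i x = 0 ∧ ∀ j, 0 ≤ lam K j x := by
  obtain ⟨w, hw, rfl⟩ := exists_weights K x
  simp_rw [lam_sum_smul_points K _ w hw]
  rw [face, Affine.Simplex.faceOpposite, ← Finset.affineCombination_eq_linear_combination _ _ _ hw,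
    Affine.Simplex.affineCombination_mem_closedInterior_face_iff_nonneg _ _ hw]
  simp only [Finset.mem_compl, Finset.mem_singleton, not_not, forall_eq]
  constructor
  · rintro ⟨h1, h2⟩
    refine ⟨h2, fun j => ?_⟩
    by_cases hj : j = i
    · rw [hj, h2]
    · exact h1 j hj
  · rintro ⟨h1, h2⟩
    exact ⟨fun j _ => h2 j, h1⟩

theorem face_subset_body (K : Elt d) (i : Fin (d + 1)) : face K i ⊆ body K := fun x hx =>
  (mem_body_iff K x).2 ((mem_face_iff K i x).1 hx).2

theorem isCompact_body (K : Elt d) : IsCompact (body K) := K.isCompact_closedInterior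

theorem isCompact_face (K : Elt d) (i : Fin (d + 1)) : IsCompact (face K i) :=
  (K.faceOpposite i).isCompact_closedInterior

theorem convex_body (K : Elt d) : Convex ℝ (body K) := by
  rw [body_eq_convexHull]
  exact convex_convexHull ℝ _

theorem measurableSet_body (K : Elt d) : MeasurableSet (body K) :=
  (isCompact_body K).isClosed.measurableSet

theorem measurableSet_face (K : Elt d) (i : Fin (d + 1)) : MeasurableSet (face K i) :=
  (isCompact_face K i).isClosed.measurableSet

theorem lam_mem_Icc (K : Elt d) {x : Pt d} (hx : x ∈ body K) (i : Fin (d + 1)) :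
    lam K i x ∈ Set.Icc (0 : ℝ) 1 := by
  rw [mem_body_iff] at hx
  refine ⟨hx i, ?_⟩
  rw [← sum_lam K x]
  exact Finset.single_le_sum (fun j _ => hx j) (Finset.mem_univ i)

@[simp]
theorem val_C (a : ℝ) (x : Pt d) : val (MvPolynomial.C a) x = a := by simp [val]

@[simp]
theorem val_X (j : Fin d) (x : Pt d) : val (MvPolynomial.X j) x = x j := by simp [val]

@[simp]
theorem val_add (p q : Poly d) (x : Pt d) : val (p + q) x = val p x + val q x := by simp [val]

@[simp]
theorem val_sub (p q : Poly d) (x : Pt d) : val (p - q) x = val p x - val q x := by simp [val]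

@[simp]
theorem val_neg (p : Poly d) (x : Pt d) : val (-p) x = -val p x := by simp [val]

@[simp]
theorem val_mul (p q : Poly d) (x : Pt d) : val (p * q) x = val p x * val q x := by simp [val]

@[simp]
theorem val_zero (x : Pt d) : val (0 : Poly d) x = 0 := by simp [val]

@[simp]
theorem val_smul (a : ℝ) (p : Poly d) (x : Pt d) : val (a • p) x = a * val p x := by simp [val]

@[simp]
theorem val_sum {κ : Type*} (s : Finset κ) (p : κ → Poly d) (x : Pt d) :
    val (∑ j ∈ s, p j) x = ∑ j ∈ s, val (p j) x := by simp [val]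

theorem contDiff_val (q : Poly d) {n : ℕ∞ω} : ContDiff ℝ n (val q) := by
  induction q using MvPolynomial.induction_on with
  | C a => simpa [funext (val_C a)] using contDiff_const
  | add p q hp hq => simpa [funext (val_add p q)] using hp.add hq
  | mul_X p j hp =>
    rw [funext (val_mul p _)]
    refine hp.mul ?_
    rw [funext (val_X j)]
    fun_prop

theorem pd_val (q : Poly d) (j : Fin d) (x : Pt d) :
    pd j (val q) x = val (MvPolynomial.pderiv j q) x := by
  have hd : ∀ q : Poly d, DifferentiableAt ℝ (val q) x := fun q =>
    (contDiff_val q (n := 1)).differentiable (by simp) x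
  induction q using MvPolynomial.induction_on with
  | C a => simp [pd, funext (val_C a)]
  | add p q hp hq =>
    simp only [pd] at hp hq ⊢
    rw [funext (val_add p q), fderiv_fun_add (hd p) (hd q)]
    simp [hp, hq]
  | mul_X p l hp =>
    simp only [pd] at hp ⊢
    have hX : fderiv ℝ (val (MvPolynomial.X l : Poly d)) x = EuclideanSpace.proj l := by
      rw [funext (val_X l)]
      exact (EuclideanSpace.proj l : Pt d →L[ℝ] ℝ).hasFDerivAt.fderiv
    rw [funext (val_mul p _), fderiv_fun_mul (hd p) (hd _), hX]
    simp [hp, MvPolynomial.pderiv_X, Pi.single_apply, eq_comm (a := j)]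
    split_ifs <;> simp

theorem contDiff_lam (K : Elt d) (i : Fin (d + 1)) {n : ℕ∞ω} : ContDiff ℝ n (lam K i) :=
  contDiff_val _

theorem continuous_lam (K : Elt d) (i : Fin (d + 1)) : Continuous (lam K i) :=
  (contDiff_lam K i (n := 0)).continuous

theorem lam_add_smul (K : Elt d) (i : Fin (d + 1)) (x y : Pt d) (s : ℝ) :
    lam K i (x + s • (y - x)) = (1 - s) * lam K i x + s * lam K i y := by
  have h1 := lam_sub K i (x + s • (y - x)) x
  have h2 := lam_sub K i y x
  rw [add_sub_cancel_left, real_inner_smul_left] at h1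
  have : lam K i (x + s • (y - x)) - lam K i x = s * (lam K i y - lam K i x) := by
    rw [h1, h2]; ring
  linarith

/-- The partial derivatives of barycentric coordinates. -/
theorem pd_lam (K : Elt d) (i : Fin (d + 1)) (j : Fin d) (x : Pt d) :
    pd j (lam K i) x = -(nrm K i j) / K.height i := by
  have h : lam K i = fun y => ∑ j, (-(nrm K i j) / K.height i) * (y j - K.altitudeFoot i j) :=
    funext (lam_eq_sum K i)
  have hd : HasFDerivAt (lam K i) (∑ l, (-(nrm K i l) / K.height i) •
      (EuclideanSpace.proj l : Pt d →L[ℝ] ℝ)) x := by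
    rw [h]
    refine HasFDerivAt.fun_sum fun l _ => ?_
    refine HasFDerivAt.const_mul (HasFDerivAt.sub_const _ ?_) _
    exact (EuclideanSpace.proj l : Pt d →L[ℝ] ℝ).hasFDerivAt
  rw [pd, hd.fderiv]
  simp [ContinuousLinearMap.sum_apply]

theorem lam_add_single (K : Elt d) (i : Fin (d + 1)) (j : Fin d) (x : Pt d) :
    lam K i (x + EuclideanSpace.single j 1) = lam K i x - nrm K i j / K.height i := by
  have := lam_sub K i (x + EuclideanSpace.single j 1) x
  rw [add_sub_cancel_left, EuclideanSpace.inner_single_left] at this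
  simp only [map_one, one_mul] at this
  linarith [neg_div (K.height i) (nrm K i j)]

theorem sum_nrm_div_height (K : Elt d) (j : Fin d) : ∑ i, nrm K i j / K.height i = 0 := by
  have h1 := sum_lam K (0 : Pt d)
  have h2 := sum_lam K (0 + EuclideanSpace.single j 1 : Pt d)
  simp_rw [lam_add_single, Finset.sum_sub_distrib] at h2
  linarith

theorem sum_nrm_div_height_mul_points (K : Elt d) (j l : Fin d) :
    ∑ i, nrm K i j / K.height i * K.points i l = -(if j = l then 1 else 0) := by
  have h1 := congrArg (fun x : Pt d => x l) (sum_lam_smul K (0 : Pt d))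
  have h2 := congrArg (fun x : Pt d => x l) (sum_lam_smul K (0 + EuclideanSpace.single j 1 : Pt d))
  simp_rw [lam_add_single] at h2
  simp [sub_mul, Finset.sum_sub_distrib] at h1 h2
  rw [h1] at h2
  simp only [Pi.single_apply, eq_comm (a := l)] at h2
  linarith

theorem norm_nrm (K : Elt d) (i : Fin (d + 1)) : ‖nrm K i‖ = 1 := by
  have h := K.height_pos i
  rw [nrm, norm_smul, ← dist_eq_norm, dist_comm]
  change ‖(K.height i)⁻¹‖ * K.height i = 1
  rw [Real.norm_of_nonneg (by positivity)]
  field_simp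

/-- `(x - p_i)·n_i = h_i (1 - λ_i x)`. -/
theorem inner_sub_point_nrm (K : Elt d) (i : Fin (d + 1)) (x : Pt d) :
    inner ℝ (x - K.points i) (nrm K i) = K.height i * (1 - lam K i x) := by
  have h := K.height_pos i
  have := lam_sub K i x (K.points i)
  rw [lam_point_self] at this
  field_simp at this
  linarith

/-! ### The cone formula and the divergence theorem on a simplex -/

/-- The point at ratio `s` on the segment from the vertex `p_i` to `y`. -/
def cone (K : Elt d) (i : Fin (d + 1)) (s : ℝ) (y : Pt d) : Pt d :=
  K.points i + s • (y - K.points i)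

theorem lam_cone_self (K : Elt d) (i : Fin (d + 1)) (s : ℝ) (y : Pt d) :
    lam K i (cone K i s y) = 1 - s + s * lam K i y := by
  rw [cone, lam_add_smul, lam_point_self, mul_one]

theorem lam_cone_of_ne (K : Elt d) {i j : Fin (d + 1)} (h : j ≠ i) (s : ℝ) (y : Pt d) :
    lam K j (cone K i s y) = s * lam K j y := by
  rw [cone, lam_add_smul, lam_point_of_ne K h]
  ring

theorem slice_body (K : Elt d) (i : Fin (d + 1)) {s : ℝ} (hs : s ∈ Set.Ioc (0 : ℝ) 1)
    (B : Set (Pt d)) :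
    (B ∩ body K) ∩ {z | lam K i z = 1 - s} = cone K i s '' ({y | cone K i s y ∈ B} ∩ face K i) := by
  ext z
  constructor
  · rintro ⟨⟨hB, hK⟩, hz⟩
    have hc : cone K i s (K.points i + s⁻¹ • (z - K.points i)) = z := by
      rw [cone, add_sub_cancel_left, smul_smul, mul_inv_cancel₀ hs.1.ne', one_smul,
        add_sub_cancel]
    refine ⟨_, ⟨?_, ?_⟩, hc⟩
    · rw [Set.mem_setOf_eq, hc]
      exact hB
    · rw [mem_body_iff] at hK
      have h0 : lam K i (K.points i + s⁻¹ • (z - K.points i)) = 0 := by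
        rw [lam_add_smul, lam_point_self, hz.out]
        have := hs.1.ne'
        field_simp
        ring
      refine (mem_face_iff K i _).2 ⟨h0, fun j => ?_⟩
      by_cases hj : j = i
      · rw [hj, h0]
      · rw [lam_add_smul, lam_point_of_ne K hj]
        rw [mul_zero, zero_add]
        exact mul_nonneg (inv_nonneg.2 hs.1.le) (hK j)
  · rintro ⟨y, ⟨hB, hy⟩, rfl⟩
    rw [mem_face_iff] at hy
    have h0 : lam K i (cone K i s y) = 1 - s := by rw [lam_cone_self, hy.1]; ring
    have h1 : ∀ j, 0 ≤ lam K j (cone K i s y) := by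
      intro j
      by_cases hj : j = i
      · rw [hj, h0]
        exact sub_nonneg.2 hs.2
      · rw [lam_cone_of_ne K hj]
        exact mul_nonneg hs.1.le (hy.2 j)
    exact ⟨⟨hB, (mem_body_iff K _).2 h1⟩, h0⟩

theorem measurable_cone (K : Elt d) (i : Fin (d + 1)) :
    Measurable fun z : ℝ × Pt d => cone K i z.1 z.2 := by
  unfold cone
  fun_prop

/-- The cone formula, for sets. -/
theorem volume_inter_body (K : Elt d) (i : Fin (d + 1)) {B : Set (Pt d)} (hB : MeasurableSet B) :
    volume (B ∩ body K) = ENNReal.ofReal (K.height i) *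
      ∫⁻ s in Set.Ioc (0 : ℝ) 1, ENNReal.ofReal (s ^ (d - 1)) *
        surf (face K i) (cone K i s ⁻¹' B) := by
  have hh := K.height_pos i
  set v : Pt d := K.altitudeFoot i - K.points i with hv
  have hvn : v = K.height i • nrm K i := by
    rw [nrm, smul_smul, mul_inv_cancel₀ hh.ne', one_smul]
  have hv0 : v ≠ 0 := by
    rw [hv, sub_ne_zero]
    exact (K.ne_altitudeFoot i).symm
  have hfin : Module.finrank ℝ (Pt d) = d := by simp
  have key := EuclideanGeometry.euclideanHausdorffMeasure_eq_lintegral (K.points i) hv0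
    (hB.inter (measurableSet_body K))
  rw [hfin] at key
  rw [EuclideanSpace.euclideanHausdorffMeasure_eq_volume] at key
  rw [key]
  have hn : ‖v‖ₑ = ENNReal.ofReal (K.height i) := by
    rw [← ofReal_norm_eq_enorm, hvn, norm_smul, norm_nrm, mul_one, Real.norm_of_nonneg hh.le]
  rw [hn]
  congr 1
  have hplane : ∀ s : ℝ, ((AffineSubspace.mk' (s • v +ᵥ K.points i) (Submodule.span ℝ {v})ᗮ :
      AffineSubspace ℝ (Pt d)) : Set (Pt d)) = {z | lam K i z = 1 - s} := by
    intro s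
    ext z
    rw [SetLike.mem_coe, AffineSubspace.mem_mk', Submodule.mem_orthogonal_singleton_iff_inner_left]
    have h1 := inner_sub_point_nrm K i z
    have h2 : inner ℝ (z -ᵥ (s • v +ᵥ K.points i)) v =
        K.height i * (K.height i * (1 - lam K i z) - s * K.height i) := by
      rw [vsub_eq_sub, vadd_eq_add, add_comm, ← sub_sub, inner_sub_left, inner_smul_left,
        hvn, inner_smul_right, h1, inner_smul_right, inner_smul_left, real_inner_self_eq_norm_sq,
        norm_nrm]
      simp
      ring
    rw [h2]
    simp only [mul_eq_zero, hh.ne', false_or, Set.mem_setOf_eq]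
    constructor
    · intro h
      have : K.height i * (1 - lam K i z - s) = 0 := by linarith
      rcases mul_eq_zero.1 this with h' | h'
      · exact absurd h' hh.ne'
      · linarith
    · intro h
      rw [h]; ring
  simp_rw [hplane]
  have hae : (fun s : ℝ => (Measure.euclideanHausdorffMeasure (d - 1) : Measure (Pt d))
      ((B ∩ body K) ∩ {z | lam K i z = 1 - s})) =ᵐ[volume]
      (Set.Ioc (0 : ℝ) 1).indicator fun s => ENNReal.ofReal (s ^ (d - 1)) *
        surf (face K i) (cone K i s ⁻¹' B) := by
    have h0 : ∀ᵐ s : ℝ, s ≠ 0 := by simp [ae_iff]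
    filter_upwards [h0] with s hs0
    by_cases hs : s ∈ Set.Ioc (0 : ℝ) 1
    · rw [Set.indicator_of_mem hs, slice_body K i hs]
      have hc : cone K i s = AffineMap.homothety (K.points i) s := by
        ext y
        simp [cone, AffineMap.homothety_apply, add_comm]
      rw [hc, euclideanHausdorffMeasure_homothety_image _ _ hs0, ← hc, surf,
        Measure.restrict_apply' (measurableSet_face K i), ENNReal.smul_def, smul_eq_mul]
      congr 1
      rw [← ENNReal.ofReal_coe_nnreal]
      congr 1
      simp [abs_of_pos hs.1]
    · rw [Set.indicator_of_notMem hs]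
      convert measure_empty (μ := (Measure.euclideanHausdorffMeasure (d - 1) : Measure (Pt d)))
      rw [Set.eq_empty_iff_forall_notMem]
      rintro z ⟨⟨-, hz⟩, hz2⟩
      have := lam_mem_Icc K hz i
      rw [hz2.out] at this
      exact hs ⟨lt_of_le_of_ne (by linarith [this.2]) hs0.symm, by linarith [this.1]⟩
  rw [lintegral_congr_ae hae, lintegral_indicator measurableSet_Ioc]

theorem volume_body_lt_top (K : Elt d) : volume (body K) < ⊤ :=
  (isCompact_body K).measure_lt_top

theorem lintegral_pow_Ioc_pos (m : ℕ) : 0 < ∫⁻ s in Set.Ioc (0 : ℝ) 1, ENNReal.ofReal (s ^ m) := by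
  rw [setLIntegral_pos_iff (by fun_prop)]
  have : Function.support (fun s : ℝ => ENNReal.ofReal (s ^ m)) ∩ Set.Ioc (0 : ℝ) 1 =
      Set.Ioc (0 : ℝ) 1 := by
    rw [Set.inter_eq_right]
    intro s hs
    have := hs.1
    simp only [Function.mem_support, ne_eq, ENNReal.ofReal_eq_zero, not_le]
    positivity
  rw [this]
  simp

instance isFiniteMeasure_surf_face (K : Elt d) (i : Fin (d + 1)) :
    IsFiniteMeasure (surf (face K i)) := by
  refine ⟨lt_of_le_of_ne le_top fun h => ?_⟩
  have key := volume_inter_body K i MeasurableSet.univ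
  simp only [Set.univ_inter, Set.preimage_univ, h] at key
  rw [lintegral_mul_const _ (by fun_prop), ENNReal.mul_top (lintegral_pow_Ioc_pos _).ne',
    ENNReal.mul_top] at key
  · exact (volume_body_lt_top K).ne key
  · simp

/-- Hyperplanes `{λ_j = c}` are null sets. -/
theorem volume_lam_eq (K : Elt d) (j : Fin (d + 1)) (c : ℝ) : volume {x | lam K j x = c} = 0 := by
  have hne : ∃ x0 : Pt d, lam K j x0 ≠ c := by
    by_contra! h
    have h1 := h (K.points j)
    have : ∃ l, j ≠ l := by
      have : Nontrivial (Fin (d + 1)) := Fin.nontrivial_iff_two_le.2 (by have := NeZero.pos d; omega)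
      obtain ⟨l, hl⟩ := exists_ne j
      exact ⟨l, hl.symm⟩
    obtain ⟨l, hl⟩ := this
    have h2 := h (K.points l)
    rw [lam_point_self] at h1
    rw [lam_point_of_ne K hl] at h2
    linarith
  rcases Set.eq_empty_or_nonempty {x | lam K j x = c} with he | ⟨y, hy⟩
  · rw [he, measure_empty]
  let S : AffineSubspace ℝ (Pt d) := AffineSubspace.mk' y (Submodule.span ℝ {nrm K j})ᗮ
  have hS : ∀ x, x ∈ S ↔ lam K j x = c := by
    intro x
    rw [AffineSubspace.mem_mk', Submodule.mem_orthogonal_singleton_iff_inner_left, vsub_eq_sub]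
    have := lam_sub K j x y
    have hh := K.height_pos j
    rw [hy.out] at this
    rw [← sub_eq_zero (b := c), this]
    simp [hh.ne']
  have : {x | lam K j x = c} = (S : Set (Pt d)) := by
    ext x
    exact (hS x).symm
  rw [this]
  refine Measure.addHaar_affineSubspace _ _ fun htop => ?_
  obtain ⟨x0, hx0⟩ := hne
  exact hx0 ((hS x0).1 (htop ▸ trivial))

/-- The relative boundary of a face is a null set. -/
theorem surf_lam_eq_zero (K : Elt d) {i j : Fin (d + 1)} (h : j ≠ i) :
    surf (face K i) {y | lam K j y = 0} = 0 := by
  have hm : MeasurableSet {y : Pt d | lam K j y = 0} :=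
    (isClosed_eq (continuous_lam K j) continuous_const).measurableSet
  have key := volume_inter_body K i hm
  rw [measure_mono_null Set.inter_subset_left (volume_lam_eq K j 0)] at key
  have h2 : ∫⁻ s in Set.Ioc (0 : ℝ) 1, ENNReal.ofReal (s ^ (d - 1)) *
        surf (face K i) (cone K i s ⁻¹' {y | lam K j y = 0}) =
      ∫⁻ s in Set.Ioc (0 : ℝ) 1, ENNReal.ofReal (s ^ (d - 1)) *
        surf (face K i) {y | lam K j y = 0} := by
    refine setLIntegral_congr_fun measurableSet_Ioc fun s hs => ?_
    have : cone K i s ⁻¹' {y | lam K j y = 0} = {y | lam K j y = 0} := by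
      ext y
      simp [lam_cone_of_ne K h, hs.1.ne']
    simp only [this]
  rw [h2, lintegral_mul_const _ (by fun_prop)] at key
  have := (mul_eq_zero.1 key.symm).resolve_left (by simp)
  exact (mul_eq_zero.1 this).resolve_left (lintegral_pow_Ioc_pos _).ne'

/-- The measure `h_i s^{d-1} ds` on `(0, 1]`. -/
def coneWeight (K : Elt d) (i : Fin (d + 1)) : Measure ℝ :=
  (volume.restrict (Set.Ioc (0 : ℝ) 1)).withDensity
    fun s => ENNReal.ofReal (K.height i * s ^ (d - 1))

instance (K : Elt d) (i : Fin (d + 1)) : SFinite (coneWeight K i) := by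
  unfold coneWeight
  infer_instance

/-- The cone formula. -/
theorem restrict_body_eq_map_cone (K : Elt d) (i : Fin (d + 1)) :
    volume.restrict (body K) =
      ((coneWeight K i).prod (surf (face K i))).map fun z => cone K i z.1 z.2 := by
  ext B hB
  have hh := K.height_pos i
  rw [Measure.restrict_apply hB, Measure.map_apply (measurable_cone K i) hB,
    Measure.prod_apply (measurable_cone K i hB), volume_inter_body K i hB, coneWeight,
    lintegral_withDensity_eq_lintegral_mul _ (by fun_prop)
      (measurable_measure_prodMk_left (measurable_cone K i hB)),
    ← lintegral_const_mul' _ _ ENNReal.ofReal_ne_top]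
  refine setLIntegral_congr_fun measurableSet_Ioc fun s hs => ?_
  simp only [Pi.mul_apply]
  rw [ENNReal.ofReal_mul hh.le, mul_assoc]
  rfl

theorem integral_body_eq (K : Elt d) (i : Fin (d + 1)) {g : Pt d → ℝ} (hg : Continuous g) :
    ∫ x in body K, g x = ∫ y, (∫ s in (0 : ℝ)..1, K.height i * s ^ (d - 1) * g (cone K i s y))
      ∂(surf (face K i)) := by
  have hint : Integrable g (volume.restrict (body K)) :=
    hg.continuousOn.integrableOn_compact (isCompact_body K)
  rw [restrict_body_eq_map_cone K i] at hint ⊢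
  have hm := measurable_cone K i
  rw [integral_map hm.aemeasurable (hint.aestronglyMeasurable),
    integral_prod_symm (fun z : ℝ × Pt d => g (cone K i z.1 z.2))
      ((integrable_map_measure hint.aestronglyMeasurable hm.aemeasurable).1 hint)]
  refine integral_congr_ae (ae_of_all _ fun y => ?_)
  simp only
  rw [intervalIntegral.integral_of_le zero_le_one, coneWeight,
    integral_withDensity_eq_integral_toReal_smul (by fun_prop) (by simp)]
  refine setIntegral_congr_fun measurableSet_Ioc fun s hs => ?_
  have := K.height_pos i
  have := hs.1
  simp only [smul_eq_mul]
  rw [ENNReal.toReal_ofReal (by positivity)]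

/-- Smooth functions. -/
abbrev Smooth (φ : Pt d → ℝ) : Prop := ContDiff ℝ ∞ φ

theorem Smooth.hasFDerivAt {φ : Pt d → ℝ} (h : Smooth φ) (x : Pt d) :
    HasFDerivAt φ (fderiv ℝ φ x) x :=
  (h.differentiable (by simp) x).hasFDerivAt

theorem fderiv_apply_eq_sum {φ : Pt d → ℝ} (x y : Pt d) :
    fderiv ℝ φ x y = ∑ j, y j * pd j φ x := by
  have : y = ∑ j, y j • (EuclideanSpace.single j (1 : ℝ) : Pt d) := by
    ext l
    simp [Pi.single_apply]
  conv_lhs => rw [this]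
  simp [pd]

theorem Smooth.continuous_pd {φ : Pt d → ℝ} (h : Smooth φ) (j : Fin d) : Continuous (pd j φ) :=
  (h.continuous_fderiv (by simp)).clm_apply continuous_const

/-- The radial divergence theorem: `∫_K ∇·((x - p_i) φ) = h_i ∫_{F_i} φ`. -/
theorem integral_radial (K : Elt d) (i : Fin (d + 1)) {φ : Pt d → ℝ} (h : Smooth φ) :
    ∫ x in body K, (d * φ x + ∑ j, (x j - K.points i j) * pd j φ x) =
      K.height i * ∫ y, φ y ∂(surf (face K i)) := by
  have hc : Continuous fun x : Pt d => (d * φ x + ∑ j, (x j - K.points i j) * pd j φ x) := by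
    refine (continuous_const.mul h.continuous).add (continuous_finsetSum _ fun j _ => ?_)
    exact (by fun_prop : Continuous fun x : Pt d => x j - K.points i j).mul (h.continuous_pd j)
  rw [integral_body_eq K i hc, ← integral_const_mul]
  refine integral_congr_ae (ae_of_all _ fun y => ?_)
  simp only
  have hder : ∀ s ∈ Set.uIcc (0 : ℝ) 1, HasDerivAt (fun s => K.height i * (s ^ d * φ (cone K i s y)))
      (K.height i * s ^ (d - 1) * (d * φ (cone K i s y) +
        ∑ j, (cone K i s y j - K.points i j) * HDG.pd j φ (cone K i s y))) s := by
    intro s _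
    have h1 : HasDerivAt (fun s : ℝ => cone K i s y) (y - K.points i) s := by
      have := ((hasDerivAt_id s).smul_const (y - K.points i)).const_add (K.points i)
      simpa [cone] using! this
    have h2 := (h.hasFDerivAt (cone K i s y)).comp_hasDerivAt s h1
    have h3 := ((hasDerivAt_pow d s).mul h2).const_mul (K.height i)
    refine h3.congr_deriv ?_
    have hd : s ^ d = s ^ (d - 1) * s := by
      rw [← pow_succ, Nat.sub_add_cancel (NeZero.pos d)]
    rw [hd, fderiv_apply_eq_sum]
    have : ∑ j, (cone K i s y j - K.points i j) * HDG.pd j φ (cone K i s y) =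
        s * ∑ j, (y - K.points i) j * HDG.pd j φ (cone K i s y) := by
      rw [Finset.mul_sum]
      refine Finset.sum_congr rfl fun j _ => ?_
      simp [cone]
      ring
    rw [this]
    simp only [Function.comp]
    ring
  have hcc : Continuous fun s : ℝ => cone K i s y := by unfold cone; fun_prop
  rw [intervalIntegral.integral_eq_sub_of_hasDerivAt hder]
  · have hd := NeZero.ne d
    simp [cone, hd]
  · refine Continuous.intervalIntegrable ?_ _ _
    exact (by fun_prop : Continuous fun s : ℝ => K.height i * s ^ (d - 1)).mul (hc.comp hcc)

theorem Continuous.integrableOn_body {g : Pt d → ℝ} (hg : Continuous g) (K : Elt d) :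
    IntegrableOn g (body K) := hg.continuousOn.integrableOn_compact (isCompact_body K)

/-- The combination of the radial fields that gives a constant field. -/
theorem sum_radial (K : Elt d) (j : Fin d) (a : ℝ) (b : Fin d → ℝ) (x : Pt d) :
    ∑ i, nrm K i j / K.height i * (d * a + ∑ l, (x l - K.points i l) * b l) = b j := by
  have h1 : ∀ i, nrm K i j / K.height i * (d * a + ∑ l, (x l - K.points i l) * b l) =
      nrm K i j / K.height i * (d * a + ∑ l, x l * b l) -
        ∑ l, (nrm K i j / K.height i * K.points i l) * b l := by
    intro i
    simp_rw [sub_mul, Finset.sum_sub_distrib]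
    rw [mul_add, mul_sub, mul_add, Finset.mul_sum (f := fun l => K.points i l * b l)]
    simp_rw [mul_assoc]
    ring
  simp_rw [h1, Finset.sum_sub_distrib]
  rw [← Finset.sum_mul, sum_nrm_div_height, Finset.sum_comm]
  simp_rw [← Finset.sum_mul, sum_nrm_div_height_mul_points]
  simp

/-- The divergence theorem on a simplex. -/
theorem integral_pd (K : Elt d) (j : Fin d) {φ : Pt d → ℝ} (h : Smooth φ) :
    ∫ x in body K, pd j φ x = ∑ i, nrm K i j * ∫ y, φ y ∂(surf (face K i)) := by
  have h1 : ∀ i, nrm K i j * ∫ y, φ y ∂(surf (face K i)) = ∫ x in body K,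
      nrm K i j / K.height i * (d * φ x + ∑ l, (x l - K.points i l) * pd l φ x) := by
    intro i
    have hh := K.height_pos i
    rw [integral_const_mul, integral_radial K i h]
    field_simp
  simp_rw [h1]
  rw [← integral_finset_sum]
  · simp_rw [sum_radial]
  · intro i _
    refine Continuous.integrableOn_body (continuous_const.mul ?_) K
    refine (continuous_const.mul h.continuous).add (continuous_finsetSum _ fun j _ => ?_)
    exact (by fun_prop : Continuous fun x : Pt d => x j - K.points i j).mul (h.continuous_pd j)

/-! ### Smoothing on convex sets -/

section Homothety

variable {X : Type*} [NormedAddCommGroup X] [NormedSpace ℝ X] [FiniteDimensional ℝ X]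
  [MeasurableSpace X] [BorelSpace X] (μ : Measure X) [μ.IsAddHaarMeasure]

/-- The homothety of ratio `1 - a` centred at `y`. -/
def contract (a : ℝ) (y x : X) : X := (1 - a) • x + a • y

theorem measurable_contract (a : ℝ) (y : X) : Measurable (contract a y) := by
  unfold contract
  fun_prop

theorem contract_mem {K : Set X} (hc : Convex ℝ K) {a : ℝ} (ha : 0 ≤ a) (ha1 : a ≤ 1) {x y : X}
    (hx : x ∈ K) (hy : y ∈ K) : contract a y x ∈ K :=
  hc hx hy (by linarith) ha (by ring)

theorem map_contract_restrict_le {K : Set X} (hc : Convex ℝ K) (hK : MeasurableSet K) {a : ℝ}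
    (ha : 0 ≤ a) (ha1 : a < 1) {y : X} (hy : y ∈ K) :
    (μ.restrict K).map (contract a y) ≤
      ENNReal.ofReal (((1 - a) ^ Module.finrank ℝ X)⁻¹) • μ.restrict K := by
  have h1 : (1 - a) ≠ 0 := by linarith
  have hmap : μ.map (contract a y) =
      ENNReal.ofReal (((1 - a) ^ Module.finrank ℝ X)⁻¹) • μ := by
    have hc : (contract a y : X → X) = (fun x => x + a • y) ∘ (fun x => (1 - a) • x) := rfl
    have hpos : 0 ≤ ((1 - a) ^ Module.finrank ℝ X)⁻¹ := by
      have : 0 < 1 - a := by linarith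
      positivity
    rw [hc, ← Measure.map_map (by fun_prop) (by fun_prop), Measure.map_addHaar_smul μ h1,
      Measure.map_smul, map_add_right_eq_self, abs_of_nonneg hpos]
  refine Measure.le_iff.2 fun B hB => ?_
  rw [Measure.map_apply (measurable_contract a y) hB,
    Measure.restrict_apply (measurable_contract a y hB), Measure.smul_apply,
    Measure.restrict_apply hB, ← Measure.smul_apply, ← hmap,
    Measure.map_apply (measurable_contract a y) (hB.inter hK)]
  exact measure_mono fun x hx => ⟨hx.1, contract_mem hc ha ha1.le hx.2 hy⟩

theorem eLpNorm_comp_contract_le {K : Set X} (hc : Convex ℝ K) (hK : MeasurableSet K) {a : ℝ}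
    (ha : 0 ≤ a) (ha1 : a ≤ 1 / 2) {y : X} (hy : y ∈ K) {F : X → ℝ}
    (hF : AEStronglyMeasurable F (μ.restrict K)) :
    eLpNorm (fun x => F (contract a y x)) 2 (μ.restrict K) ≤
      ENNReal.ofReal (2 ^ Module.finrank ℝ X) ^ (1 / 2 : ℝ) * eLpNorm F 2 (μ.restrict K) := by
  have hle := map_contract_restrict_le μ hc hK ha (by linarith) hy
  have hle2 : (μ.restrict K).map (contract a y) ≤
      ENNReal.ofReal (2 ^ Module.finrank ℝ X) • μ.restrict K := by
    refine hle.trans (Measure.le_iff.2 fun B _ => ?_)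
    simp only [Measure.smul_apply, smul_eq_mul]
    gcongr
    rw [← inv_pow]
    have : (1 - a)⁻¹ ≤ 2 := by
      rw [inv_le_comm₀ (by linarith) (by norm_num)]
      linarith
    have h0 : 0 ≤ (1 - a)⁻¹ := inv_nonneg.2 (by linarith)
    gcongr
  have hac : (μ.restrict K).map (contract a y) ≪ μ.restrict K :=
    (Measure.absolutelyContinuous_of_le hle2).trans (Measure.smul_absolutelyContinuous)
  have h2 : (1 / (2 : ℝ≥0∞)).toReal = (1 / 2 : ℝ) := by simp
  calc eLpNorm (fun x => F (contract a y x)) 2 (μ.restrict K)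
      = eLpNorm F 2 ((μ.restrict K).map (contract a y)) :=
        (eLpNorm_map_measure (hF.mono_ac hac) (measurable_contract a y).aemeasurable).symm
    _ ≤ eLpNorm F 2 (ENNReal.ofReal (2 ^ Module.finrank ℝ X) • μ.restrict K) :=
        eLpNorm_mono_measure _ hle2
    _ = _ := by
        rw [eLpNorm_smul_measure_of_ne_top (by simp), h2, smul_eq_mul]

theorem aestronglyMeasurable_comp_contract {K : Set X} (hc : Convex ℝ K) (hK : MeasurableSet K)
    {a : ℝ} (ha : 0 ≤ a) (ha1 : a ≤ 1 / 2) {y : X} (hy : y ∈ K) {F : X → ℝ}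
    (hF : AEStronglyMeasurable F (μ.restrict K)) :
    AEStronglyMeasurable (fun x => F (contract a y x)) (μ.restrict K) := by
  have hac : (μ.restrict K).map (contract a y) ≪ μ.restrict K :=
    (Measure.absolutelyContinuous_of_le
      (map_contract_restrict_le μ hc hK ha (by linarith) hy)).trans
      (Measure.smul_absolutelyContinuous)
  exact (hF.mono_ac hac).comp_aemeasurable (measurable_contract a y).aemeasurable

/-- Contractions are strongly continuous in `L²`, uniformly in the centre. -/
theorem exists_eLpNorm_contract_sub_le {K : Set X} (hc : Convex ℝ K) (hK : IsCompact K)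
    {F : X → ℝ} (hF : MemLp F 2 (μ.restrict K)) {η : ℝ≥0∞} (hη : η ≠ 0) :
    ∃ a₀ > 0, a₀ ≤ 1 / 2 ∧ ∀ a, 0 ≤ a → a < a₀ → ∀ y ∈ K,
      eLpNorm (fun x => F (contract a y x) - F x) 2 (μ.restrict K) ≤ η := by
  have hKm := hK.isClosed.measurableSet
  have hKfin : μ K ≠ ⊤ := hK.measure_lt_top.ne
  have : IsFiniteMeasure (μ.restrict K) := ⟨by simpa using hK.measure_lt_top⟩
  set C : ℝ≥0∞ := ENNReal.ofReal (2 ^ Module.finrank ℝ X) ^ (1 / 2 : ℝ) with hC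
  have hCfin : C ≠ ⊤ := ENNReal.rpow_ne_top_of_nonneg (by norm_num) ENNReal.ofReal_ne_top
  set δ : ℝ≥0∞ := η / 3 / (C + 1) with hδ
  have hδ0 : δ ≠ 0 :=
    (ENNReal.div_pos (ENNReal.div_pos hη (by simp)).ne' (by simp [hCfin])).ne'
  obtain ⟨g, -, hgF, hgc, hgm⟩ := hF.exists_hasCompactSupport_eLpNorm_sub_le (by simp) hδ0
  have hFg : eLpNorm (fun x => F x - g x) 2 (μ.restrict K) ≤ δ := hgF
  obtain ⟨M, hM⟩ := hK.isBounded.subset_closedBall 0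
  set ν : ℝ≥0∞ := (μ.restrict K) Set.univ ^ (2 : ℝ≥0∞).toReal⁻¹ with hν
  have hνfin : ν ≠ ⊤ := ENNReal.rpow_ne_top_of_nonneg (by simp) (measure_ne_top _ _)
  obtain ⟨ε, hε, hεη⟩ : ∃ ε : ℝ, 0 < ε ∧ ν * ENNReal.ofReal ε ≤ η / 3 := by
    by_cases hηt : η = ⊤
    · refine ⟨1, one_pos, ?_⟩
      rw [hηt, ENNReal.top_div_of_ne_top (by simp)]
      exact le_top
    refine ⟨(η / 3 / (ν + 1)).toReal, ENNReal.toReal_pos ?_ ?_, ?_⟩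
    · exact (ENNReal.div_pos (ENNReal.div_pos hη (by simp)).ne' (by simp [hνfin])).ne'
    · exact (ENNReal.div_lt_top (ENNReal.div_lt_top hηt (by simp)).ne (by simp)).ne
    · rw [ENNReal.ofReal_toReal
        (ENNReal.div_lt_top (ENNReal.div_lt_top hηt (by simp)).ne (by simp)).ne]
      calc ν * (η / 3 / (ν + 1)) ≤ (ν + 1) * (η / 3 / (ν + 1)) := by gcongr; exact le_self_add
        _ ≤ η / 3 := ENNReal.mul_div_le
  have huc := hK.uniformContinuousOn_of_continuous hgc.continuousOn
  rw [Metric.uniformContinuousOn_iff_le] at huc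
  obtain ⟨t, ht, hgt⟩ := huc ε hε
  have hM1 : 0 < 2 * |M| + 1 := by positivity
  refine ⟨min (1 / 2) (t / (2 * |M| + 1)), by positivity, min_le_left _ _,
    fun a ha haa y hy => ?_⟩
  have ha2 : a ≤ 1 / 2 := haa.le.trans (min_le_left _ _)
  have hat : a * (2 * |M|) ≤ t := by
    have h1 : a ≤ t / (2 * |M| + 1) := haa.le.trans (min_le_right _ _)
    rw [le_div_iff₀ hM1] at h1
    nlinarith
  have hmid : eLpNorm (fun x => g (contract a y x) - g x) 2 (μ.restrict K) ≤ η / 3 := by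
    refine le_trans (eLpNorm_le_of_ae_bound (C := ε) ?_) hεη
    filter_upwards [ae_restrict_mem hKm] with x hx
    rw [← dist_eq_norm]
    refine hgt _ (contract_mem hc ha (by linarith) hx hy) _ hx ?_
    rw [dist_eq_norm]
    have : contract a y x - x = a • (y - x) := by
      simp only [contract, sub_smul, one_smul, smul_sub]
      abel
    rw [this, norm_smul, Real.norm_of_nonneg ha]
    have hx' := mem_closedBall_zero_iff.1 (hM hx)
    have hy' := mem_closedBall_zero_iff.1 (hM hy)
    have : ‖y - x‖ ≤ 2 * |M| := by
      have := norm_sub_le y x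
      linarith [le_abs_self M]
    exact (mul_le_mul_of_nonneg_left this ha).trans hat
  have hFgm : AEStronglyMeasurable (fun x => F x - g x) (μ.restrict K) :=
    hF.1.sub hgm.1
  have hfirst : eLpNorm (fun x => F (contract a y x) - g (contract a y x)) 2 (μ.restrict K) ≤
      C * δ := by
    refine (eLpNorm_comp_contract_le μ hc hKm ha ha2 hy hFgm).trans ?_
    gcongr
  have hFc := aestronglyMeasurable_comp_contract μ hc hKm ha ha2 hy hF.1
  have hgc' := aestronglyMeasurable_comp_contract μ hc hKm ha ha2 hy hgm.1
  have hlast : eLpNorm (fun x => g x - F x) 2 (μ.restrict K) ≤ δ := by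
    rw [← eLpNorm_neg]
    refine le_trans (le_of_eq ?_) hFg
    congr 1
    ext x
    simp
  have hdecomp : (fun x => F (contract a y x) - F x) =
      ((fun x => F (contract a y x) - g (contract a y x)) + fun x => g (contract a y x) - g x) +
        fun x => g x - F x := by
    ext x
    simp
  rw [hdecomp]
  refine (eLpNorm_add_le ((hFc.sub hgc').add (hgc'.sub hgm.1)) (hgm.1.sub hF.1) (by norm_num)).trans
    ?_
  refine (add_le_add (eLpNorm_add_le (hFc.sub hgc') (hgc'.sub hgm.1) (by norm_num)) le_rfl).trans ?_
  refine (add_le_add (add_le_add hfirst hmid) hlast).trans ?_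
  have e1 : (C + 1) * δ ≤ η / 3 := ENNReal.mul_div_le
  calc C * δ + η / 3 + δ = (C + 1) * δ + η / 3 := by ring
    _ ≤ η / 3 + η / 3 := by gcongr
    _ ≤ η := by
      calc η / 3 + η / 3 ≤ η / 3 + η / 3 + η / 3 := le_self_add
        _ = η := ENNReal.add_thirds η

end Homothety

/-- An average of functions is bounded in `L²` by the bound for the functions. -/
theorem eLpNorm_integral_le {X Y : Type*} [MeasurableSpace X] [MeasurableSpace Y]
    {μ : Measure X} {P : Measure Y} [SFinite μ] [IsProbabilityMeasure P] {H : X → Y → ℝ}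
    (hH : AEStronglyMeasurable (Function.uncurry H) (μ.prod P)) {η : ℝ≥0∞}
    (hη : ∀ᵐ y ∂P, eLpNorm (fun x => H x y) 2 μ ≤ η) :
    eLpNorm (fun x => ∫ y, H x y ∂P) 2 μ ≤ η := by
  have hsq : ∀ (g : X → ℝ), eLpNorm g 2 μ ^ 2 = ∫⁻ x, ‖g x‖ₑ ^ 2 ∂μ := by
    intro g
    have := eLpNorm_nnreal_pow_eq_lintegral (f := g) (μ := μ) (p := 2) (by norm_num)
    simpa using this
  rw [← ENNReal.pow_le_pow_left_iff (n := 2) (by norm_num), hsq]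
  have hjensen : ∀ᵐ x ∂μ, ‖∫ y, H x y ∂P‖ₑ ^ 2 ≤ ∫⁻ y, ‖H x y‖ₑ ^ 2 ∂P := by
    filter_upwards [hH.prodMk_left] with x hx
    calc ‖∫ y, H x y ∂P‖ₑ ^ 2 ≤ (∫⁻ y, ‖H x y‖ₑ ∂P) ^ 2 := by
          gcongr
          exact enorm_integral_le_lintegral_enorm _
      _ ≤ ∫⁻ y, ‖H x y‖ₑ ^ 2 ∂P := by
          have h1 : eLpNorm (H x) 1 P ≤ eLpNorm (H x) 2 P :=
            eLpNorm_le_eLpNorm_of_exponent_le (by norm_num) hx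
          rw [eLpNorm_one_eq_lintegral_enorm] at h1
          have h2 := eLpNorm_nnreal_pow_eq_lintegral (f := H x) (μ := P) (p := 2) (by norm_num)
          have h3 : eLpNorm (H x) 2 P ^ 2 = ∫⁻ y, ‖H x y‖ₑ ^ 2 ∂P := by simpa using h2
          rw [← h3]
          gcongr
  calc ∫⁻ x, ‖∫ y, H x y ∂P‖ₑ ^ 2 ∂μ ≤ ∫⁻ x, ∫⁻ y, ‖H x y‖ₑ ^ 2 ∂P ∂μ := lintegral_mono_ae hjensen
    _ = ∫⁻ y, ∫⁻ x, ‖H x y‖ₑ ^ 2 ∂μ ∂P :=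
        lintegral_lintegral_swap (hH.enorm.pow_const 2)
    _ ≤ ∫⁻ _, η ^ 2 ∂P := by
        refine lintegral_mono_ae ?_
        filter_upwards [hη] with y hy
        rw [← hsq]
        gcongr
    _ = η ^ 2 := by simp

/-! ### Smoothing operators on a simplex -/

theorem mem_interior_body (K : Elt d) {x : Pt d} (h : ∀ i, 0 < lam K i x) :
    x ∈ interior (body K) := by
  have ho : IsOpen {x : Pt d | ∀ i, 0 < lam K i x} := by
    simp only [Set.setOf_forall]
    exact isOpen_iInter_of_finite fun i => isOpen_lt continuous_const (continuous_lam K i)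
  exact interior_maximal (fun y hy => (mem_body_iff K y).2 fun i => (hy i).le) ho h

theorem exists_mem_interior_body (K : Elt d) : ∃ x, x ∈ interior (body K) := by
  have hw : ∑ _j : Fin (d + 1), ((d : ℝ) + 1)⁻¹ = 1 := by
    have : (d : ℝ) + 1 ≠ 0 := by positivity
    simp [this]
  refine ⟨∑ j, ((d : ℝ) + 1)⁻¹ • K.points j, mem_interior_body K fun i => ?_⟩
  rw [lam_sum_smul_points K i (fun _ => ((d : ℝ) + 1)⁻¹) hw]
  positivity

theorem restrict_interior_body (K : Elt d) :
    volume.restrict (interior (body K)) = volume.restrict (body K) := by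
  refine Measure.restrict_congr_set ?_
  exact interior_ae_eq_of_null_frontier ((convex_body K).addHaar_frontier _)

theorem exists_mollifier (K : Elt d) : ∃ ρ : Pt d → ℝ, Smooth ρ ∧ HasCompactSupport ρ ∧
    tsupport ρ ⊆ interior (body K) ∧ (∀ x, 0 ≤ ρ x) ∧ ∫ x, ρ x = 1 := by
  obtain ⟨x, hx⟩ := exists_mem_interior_body K
  obtain ⟨r, hr, hrK⟩ := Metric.isOpen_iff.1 isOpen_interior x hx
  let b : ContDiffBump x := ⟨r / 4, r / 2, by positivity, by linarith⟩
  refine ⟨b.normed volume, b.contDiff_normed, b.hasCompactSupport_normed, ?_, b.nonneg_normed,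
    b.integral_normed⟩
  rw [b.tsupport_normed_eq]
  exact (Metric.closedBall_subset_ball (by simp only [b]; linarith)).trans hrK

/-- A mollifier supported in the interior of `K`. -/
def mol (K : Elt d) : Pt d → ℝ := (exists_mollifier K).choose

theorem mol_smooth (K : Elt d) : Smooth (mol K) := (exists_mollifier K).choose_spec.1

theorem mol_compact (K : Elt d) : HasCompactSupport (mol K) := (exists_mollifier K).choose_spec.2.1

theorem mol_tsupport (K : Elt d) : tsupport (mol K) ⊆ interior (body K) :=
  (exists_mollifier K).choose_spec.2.2.1

theorem mol_nonneg (K : Elt d) (x : Pt d) : 0 ≤ mol K x := (exists_mollifier K).choose_spec.2.2.2.1 x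

theorem mol_integral (K : Elt d) : ∫ x, mol K x = 1 := (exists_mollifier K).choose_spec.2.2.2.2

/-- The probability measure with density `mol K`. -/
def molM (K : Elt d) : Measure (Pt d) := volume.withDensity fun x => ENNReal.ofReal (mol K x)

instance (K : Elt d) : IsProbabilityMeasure (molM K) := by
  refine ⟨?_⟩
  rw [molM, withDensity_apply _ MeasurableSet.univ, setLIntegral_univ,
    ← ofReal_integral_eq_lintegral_ofReal, mol_integral, ENNReal.ofReal_one]
  · exact (mol_smooth K).continuous.integrable_of_hasCompactSupport (mol_compact K)
  · exact ae_of_all _ (mol_nonneg K)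

theorem ae_molM_mem (K : Elt d) : ∀ᵐ y ∂(molM K), y ∈ body K := by
  rw [molM, ae_withDensity_iff (by have := (mol_smooth K).continuous; fun_prop)]
  refine ae_of_all _ fun y hy => ?_
  have : mol K y ≠ 0 := fun h => hy (by simp [h])
  exact interior_subset (mol_tsupport K (subset_tsupport _ this))

theorem integral_molM (K : Elt d) (g : Pt d → ℝ) : ∫ y, g y ∂(molM K) = ∫ y, g y * mol K y := by
  have := (mol_smooth K).continuous
  rw [molM, integral_withDensity_eq_integral_toReal_smul (by fun_prop) (by simp)]
  refine integral_congr_ae (ae_of_all _ fun y => ?_)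
  simp only [smul_eq_mul]
  rw [ENNReal.toReal_ofReal (mol_nonneg K y), mul_comm]

/-- The dilated mollifier. -/
def molScaled (K : Elt d) (a : ℝ) (v : Pt d) : ℝ := (a ^ d)⁻¹ * mol K (-(a⁻¹ • v))

theorem molScaled_smooth (K : Elt d) (a : ℝ) : Smooth (molScaled K a) :=
  contDiff_const.mul ((mol_smooth K).comp (by fun_prop))

theorem molScaled_compact (K : Elt d) {a : ℝ} (ha : a ≠ 0) : HasCompactSupport (molScaled K a) := by
  have h1 : HasCompactSupport fun v : Pt d => mol K (-(a⁻¹ • v)) := by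
    have := (mol_compact K).comp_homeomorph (Homeomorph.smulOfNeZero (-a⁻¹) (by simpa using ha))
    simpa [Function.comp_def] using this
  exact h1.mul_left

/-- The smoothing operator `f ↦ ∫ ρ(y) f((1 - a) x + a y) dy`. -/
def smoothing (K : Elt d) (a : ℝ) (f : Pt d → ℝ) (x : Pt d) : ℝ :=
  ∫ w in body K, f w * molScaled K a ((1 - a) • x - w)

theorem smoothing_congr (K : Elt d) (a : ℝ) {f g : Pt d → ℝ}
    (h : f =ᵐ[volume.restrict (body K)] g) : smoothing K a f = smoothing K a g := by
  ext x
  refine integral_congr_ae ?_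
  filter_upwards [h] with w hw
  rw [hw]

theorem smoothing_eq_convolution (K : Elt d) (a : ℝ) (f : Pt d → ℝ) (x : Pt d) :
    smoothing K a f x = (convolution ((body K).indicator f) (molScaled K a)
      (ContinuousLinearMap.mul ℝ ℝ) volume) ((1 - a) • x) := by
  rw [smoothing, convolution, ← integral_indicator (measurableSet_body K)]
  congr 1
  ext w
  by_cases hw : w ∈ body K <;> simp [hw]

theorem isFiniteMeasure_restrict_body (K : Elt d) : IsFiniteMeasure (volume.restrict (body K)) :=
  ⟨by simpa using volume_body_lt_top K⟩

attribute [instance] isFiniteMeasure_restrict_body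

theorem memL2_integrable {K : Elt d} {f : Pt d → ℝ} (hf : MemLp f 2 (volume.restrict (body K))) :
    Integrable f (volume.restrict (body K)) := hf.integrable (by norm_num)

theorem locallyIntegrable_indicator {K : Elt d} {f : Pt d → ℝ}
    (hf : MemLp f 2 (volume.restrict (body K))) :
    LocallyIntegrable ((body K).indicator f) volume :=
  ((integrable_indicator_iff (measurableSet_body K)).2 (memL2_integrable hf)).locallyIntegrable

theorem smoothing_smooth (K : Elt d) {a : ℝ} (ha : a ≠ 0) {f : Pt d → ℝ}
    (hf : MemLp f 2 (volume.restrict (body K))) : Smooth (smoothing K a f) := by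
  have h1 := (molScaled_compact K ha).contDiff_convolution_right (n := ⊤)
    (ContinuousLinearMap.mul ℝ ℝ) (locallyIntegrable_indicator hf) (molScaled_smooth K a)
  have h2 : smoothing K a f = (convolution ((body K).indicator f) (molScaled K a)
      (ContinuousLinearMap.mul ℝ ℝ) volume) ∘ fun x => (1 - a) • x :=
    funext (smoothing_eq_convolution K a f)
  rw [h2]
  exact h1.comp (by fun_prop)

theorem pd_smoothing (K : Elt d) {a : ℝ} (ha : a ≠ 0) {f : Pt d → ℝ}
    (hf : MemLp f 2 (volume.restrict (body K))) (j : Fin d) (x : Pt d) :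
    pd j (smoothing K a f) x =
      (1 - a) * ∫ w in body K, f w * pd j (molScaled K a) ((1 - a) • x - w) := by
  have h1 := (molScaled_compact K ha).hasFDerivAt_convolution_right
    (ContinuousLinearMap.mul ℝ ℝ) (locallyIntegrable_indicator hf)
    ((molScaled_smooth K a).of_le (by simp)) ((1 - a) • x)
  have h2 : smoothing K a f = (convolution ((body K).indicator f) (molScaled K a)
      (ContinuousLinearMap.mul ℝ ℝ) volume) ∘ fun x => (1 - a) • x :=
    funext (smoothing_eq_convolution K a f)
  have h3 : HasFDerivAt (fun x : Pt d => (1 - a) • x)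
      ((1 - a) • ContinuousLinearMap.id ℝ (Pt d)) x := (hasFDerivAt_id x).const_smul (1 - a)
  have h4 := h1.comp x h3
  rw [← h2] at h4
  have hint : ConvolutionExistsAt ((body K).indicator f) (fderiv ℝ (molScaled K a)) ((1 - a) • x)
      ((ContinuousLinearMap.mul ℝ ℝ).precompR (Pt d)) volume :=
    ((molScaled_compact K ha).fderiv ℝ).convolutionExists_right _ (locallyIntegrable_indicator hf)
      ((molScaled_smooth K a).continuous_fderiv (by simp)) _
  rw [pd, h4.fderiv]
  simp only [ContinuousLinearMap.comp_apply, ContinuousLinearMap.smul_apply,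
    ContinuousLinearMap.id_apply, map_smul, smul_eq_mul]
  congr 1
  rw [convolution, ContinuousLinearMap.integral_apply hint,
    ← integral_indicator (measurableSet_body K)]
  congr 1
  ext w
  by_cases hw : w ∈ body K <;> simp [hw, pd, ContinuousLinearMap.precompR]

/-- The smoothing operators commute with the weak divergence, up to the factor `1 - a`. -/
theorem sum_pd_smoothing (K : Elt d) {a : ℝ} (ha : 0 < a) (ha1 : a < 1) {V : Fin d → Pt d → ℝ}
    {D : Pt d → ℝ} (hV : ∀ j, MemLp (V j) 2 (volume.restrict (body K)))
    (hD : HasWeakDiv (interior (body K)) V D) {x : Pt d} (hx : x ∈ body K) :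
    ∑ j, pd j (smoothing K a (V j)) x = (1 - a) * smoothing K a D x := by
  have hφs : Smooth fun w => molScaled K a ((1 - a) • x - w) :=
    (molScaled_smooth K a).comp (by fun_prop)
  have hφc : HasCompactSupport fun w => molScaled K a ((1 - a) • x - w) := by
    have := (molScaled_compact K ha.ne').comp_homeomorph (Homeomorph.subLeft ((1 - a) • x))
    simpa [Function.comp_def] using this
  have hφt : tsupport (fun w => molScaled K a ((1 - a) • x - w)) ⊆ interior (body K) := by
    have hcl : IsClosed ((fun w : Pt d => a⁻¹ • (w - (1 - a) • x)) ⁻¹' tsupport (mol K)) :=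
      (isClosed_tsupport _).preimage (by fun_prop)
    refine (closure_minimal (fun w hw => ?_) hcl).trans fun w hw => ?_
    · refine subset_tsupport _ fun h => hw ?_
      simp only [molScaled]
      rw [← smul_neg, neg_sub, h, mul_zero]
    · have h1 := mol_tsupport K hw
      have h2 : w = (1 - a) • x + a • (a⁻¹ • (w - (1 - a) • x)) := by
        rw [smul_smul, mul_inv_cancel₀ ha.ne', one_smul]
        abel
      rw [h2]
      exact (convex_body K).combo_self_interior_mem_interior hx h1 (by linarith) ha (by ring)
  have hpd : ∀ j w, pd j (fun w => molScaled K a ((1 - a) • x - w)) w =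
      -pd j (molScaled K a) ((1 - a) • x - w) := by
    intro j w
    have h1 := ((molScaled_smooth K a).hasFDerivAt ((1 - a) • x - w)).comp w
      ((hasFDerivAt_id w).const_sub ((1 - a) • x))
    have h2 : fderiv ℝ (fun w => molScaled K a ((1 - a) • x - w)) w = _ := h1.fderiv
    rw [pd, h2]
    simp [pd]
  have key := hD _ ⟨hφs, hφc, hφt⟩
  rw [restrict_interior_body] at key
  simp_rw [pd_smoothing K ha.ne' (hV _), ← Finset.mul_sum]
  congr 1
  rw [← integral_finset_sum]
  · have : ∀ w, ∑ j, V j w * pd j (molScaled K a) ((1 - a) • x - w) =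
        -∑ j, V j w * pd j (fun w => molScaled K a ((1 - a) • x - w)) w := by
      intro w
      simp_rw [hpd, mul_neg, Finset.sum_neg_distrib, neg_neg]
    simp_rw [this]
    rw [integral_neg, key, neg_neg, smoothing]
  · intro j _
    have hc : Continuous fun w => pd j (molScaled K a) ((1 - a) • x - w) :=
      ((molScaled_smooth K a).continuous_pd j).comp (by fun_prop)
    obtain ⟨C, hC⟩ := (isCompact_body K).exists_bound_of_continuousOn hc.continuousOn
    refine (memL2_integrable (hV j)).mul_bdd (c := C) hc.aestronglyMeasurable ?_
    filter_upwards [ae_restrict_mem (measurableSet_body K)] with w hw using hC w hw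

theorem smoothing_eq_average (K : Elt d) {a : ℝ} (ha : 0 < a) (ha1 : a ≤ 1) (f : Pt d → ℝ)
    {x : Pt d} (hx : x ∈ body K) : smoothing K a f x = ∫ y, f (contract a y x) ∂(molM K) := by
  have h1 : ∫ y, f (contract a y x) ∂(molM K) =
      ∫ y, (body K).indicator f (contract a y x) ∂(molM K) := by
    refine integral_congr_ae ?_
    filter_upwards [ae_molM_mem K] with y hy
    rw [Set.indicator_of_mem (contract_mem (convex_body K) ha.le ha1 hx hy)]
  rw [h1, integral_molM, smoothing, ← integral_indicator (measurableSet_body K)]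
  set G : Pt d → ℝ := fun w => (body K).indicator f w * mol K (a⁻¹ • (w - (1 - a) • x)) with hG
  have h2 : (fun y => (body K).indicator f (contract a y x) * mol K y) =
      fun y => G ((1 - a) • x + a • y) := by
    ext y
    simp only [hG, contract]
    rw [add_sub_cancel_left, smul_smul, inv_mul_cancel₀ ha.ne', one_smul]
  have h3 : ∫ y, G ((1 - a) • x + a • y) = (a ^ d)⁻¹ * ∫ w, G w := by
    have := Measure.integral_comp_smul volume (fun y => G ((1 - a) • x + y)) a
    rw [this, integral_add_left_eq_self]
    simp [abs_of_pos ha]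
  rw [h2, h3, ← integral_const_mul]
  congr 1
  ext w
  by_cases hw : w ∈ body K
  · simp only [hG, Set.indicator_of_mem hw, molScaled]
    rw [← smul_neg, neg_sub]
    ring
  · simp [hG, hw]

theorem integrable_contract (K : Elt d) {a : ℝ} (ha : 0 < a) (ha1 : a ≤ 1) {f : Pt d → ℝ}
    (hf : MemLp f 2 (volume.restrict (body K))) {x : Pt d} (hx : x ∈ body K) :
    Integrable (fun y => f (contract a y x)) (molM K) := by
  have hcon : Measurable fun y => contract a y x := by unfold contract; fun_prop
  have hmc := (mol_smooth K).continuous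
  have h1 : (fun y => (body K).indicator f (contract a y x)) =ᵐ[molM K]
      fun y => f (contract a y x) := by
    filter_upwards [ae_molM_mem K] with y hy
    rw [Set.indicator_of_mem (contract_mem (convex_body K) ha.le ha1 hx hy)]
  refine Integrable.congr ?_ h1
  rw [molM, integrable_withDensity_iff (by fun_prop) (by simp)]
  have h2 : Integrable ((body K).indicator f) volume :=
    (integrable_indicator_iff (measurableSet_body K)).2 (memL2_integrable hf)
  have h3 : Integrable (fun y => (body K).indicator f (contract a y x)) volume := by
    unfold contract
    exact ((integrable_comp_smul_iff volume _ ha.ne').2 (h2.comp_add_left ((1 - a) • x)))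
  obtain ⟨C, hC⟩ := (mol_compact K).exists_bound_of_continuous hmc
  have hmm : Measurable fun y => (ENNReal.ofReal (mol K y)).toReal := by
    have := hmc.measurable
    fun_prop
  refine h3.mul_bdd (c := C) hmm.aestronglyMeasurable (ae_of_all _ fun y => ?_)
  rw [ENNReal.toReal_ofReal (mol_nonneg K y)]
  exact hC y

theorem tendsto_smoothing (K : Elt d) {f : Pt d → ℝ}
    (hf : MemLp f 2 (volume.restrict (body K))) :
    Tendsto (fun a => eLpNorm (fun x => smoothing K a f x - f x) 2 (volume.restrict (body K)))
      (𝓝[>] 0) (𝓝 0) := by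
  wlog hfm : Measurable f generalizing f
  · set g := hf.1.mk f with hg
    have hfg : f =ᵐ[volume.restrict (body K)] g := hf.1.ae_eq_mk
    have := this ((memLp_congr_ae hfg).1 hf) hf.1.stronglyMeasurable_mk.measurable
    refine this.congr fun a => ?_
    rw [smoothing_congr K a hfg]
    refine eLpNorm_congr_ae ?_
    filter_upwards [hfg] with x hx
    rw [hx]
  rw [ENNReal.tendsto_nhds_zero]
  intro η hη
  obtain ⟨a₀, ha₀, ha2, h⟩ := exists_eLpNorm_contract_sub_le volume (convex_body K)
    (isCompact_body K) hf hη.ne'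
  filter_upwards [Ioo_mem_nhdsGT ha₀] with a ha
  have hle : a ≤ 1 := by linarith [ha.2]
  have h1 : eLpNorm (fun x => ∫ y, (f (contract a y x) - f x) ∂(molM K)) 2
      (volume.restrict (body K)) ≤ η := by
    refine eLpNorm_integral_le ?_ ?_
    · refine Measurable.aestronglyMeasurable ?_
      have : Measurable fun z : Pt d × Pt d => contract a z.2 z.1 := by unfold contract; fun_prop
      exact (hfm.comp this).sub (hfm.comp measurable_fst)
    · filter_upwards [ae_molM_mem K] with y hy using h a ha.1.le ha.2 y hy
  refine le_trans (le_of_eq (eLpNorm_congr_ae ?_)) h1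
  filter_upwards [ae_restrict_mem (measurableSet_body K)] with x hx
  rw [integral_sub (integrable_contract K ha.1 hle hf hx) (integrable_const _),
    ← smoothing_eq_average K ha.1 hle f hx]
  simp

/-! ### The Sobolev–Slobodeckij seminorm -/

/-- The difference quotient whose `L²` norm is the Sobolev–Slobodeckij seminorm. -/
def quot (s : ℝ) (f : Pt d → ℝ) (z : Pt d × Pt d) : ℝ :=
  (f z.1 - f z.2) / ‖z.1 - z.2‖ ^ (((d : ℝ) + 2 * s) / 2)

theorem enorm_quot_sq (s : ℝ) (f : Pt d → ℝ) (x y : Pt d) :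
    ‖quot s f (x, y)‖ₑ ^ 2 = ENNReal.ofReal ((f x - f y) ^ 2 / ‖x - y‖ ^ ((d : ℝ) + 2 * s)) := by
  rw [← ofReal_norm_eq_enorm, ← ENNReal.ofReal_pow (norm_nonneg _), quot, Real.norm_eq_abs, sq_abs,
    div_pow, ← Real.rpow_natCast (_ ^ _) 2, ← Real.rpow_mul (norm_nonneg _)]
  congr 3
  push_cast
  ring

theorem aestronglyMeasurable_quot (s : ℝ) {S : Set (Pt d)} {f : Pt d → ℝ}
    (hf : AEStronglyMeasurable f (volume.restrict S)) :
    AEStronglyMeasurable (quot s f) ((volume.restrict S).prod (volume.restrict S)) := by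
  have h1 : Measurable fun z : Pt d × Pt d => ‖z.1 - z.2‖ ^ (((d : ℝ) + 2 * s) / 2) := by fun_prop
  have := (hf.comp_fst (ν := volume.restrict S)).sub (hf.comp_snd (μ := volume.restrict S))
  exact (this.aemeasurable.div h1.aemeasurable).aestronglyMeasurable

theorem eLpNorm_two_sq {X : Type*} [MeasurableSpace X] {μ : Measure X} (g : X → ℝ) :
    eLpNorm g 2 μ ^ 2 = ∫⁻ x, ‖g x‖ₑ ^ 2 ∂μ := by
  have := eLpNorm_nnreal_pow_eq_lintegral (f := g) (μ := μ) (p := 2) (by norm_num)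
  simpa using this

theorem slobodeckijSq_eq (s : ℝ) {S : Set (Pt d)} {f : Pt d → ℝ}
    (hf : AEStronglyMeasurable f (volume.restrict S)) :
    slobodeckijSq s S f = eLpNorm (quot s f) 2 ((volume.restrict S).prod (volume.restrict S)) ^ 2 := by
  rw [eLpNorm_two_sq, lintegral_prod _ ((aestronglyMeasurable_quot s hf).enorm.pow_const 2)]
  simp_rw [enorm_quot_sq]
  rfl

theorem slobodeckijSq_mono (s : ℝ) {S T : Set (Pt d)} (h : S ⊆ T) (f : Pt d → ℝ) :
    slobodeckijSq s S f ≤ slobodeckijSq s T f :=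
  (lintegral_mono fun _ => lintegral_mono_set h).trans (lintegral_mono_set h)

theorem slobodeckijSq_interior_body (s : ℝ) (K : Elt d) (f : Pt d → ℝ) :
    slobodeckijSq s (interior (body K)) f = slobodeckijSq s (body K) f := by
  simp only [slobodeckijSq, restrict_interior_body]

theorem slobodeckijSq_congr (s : ℝ) {S : Set (Pt d)} {f g : Pt d → ℝ}
    (h : f =ᵐ[volume.restrict S] g) : slobodeckijSq s S f = slobodeckijSq s S g := by
  refine lintegral_congr_ae ?_
  filter_upwards [h] with x hx
  refine lintegral_congr_ae ?_
  filter_upwards [h] with y hy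
  rw [hx, hy]

theorem slobodeckijSq_sub_le (s : ℝ) {S : Set (Pt d)} {f g : Pt d → ℝ}
    (hf : AEStronglyMeasurable f (volume.restrict S))
    (hg : AEStronglyMeasurable g (volume.restrict S)) :
    slobodeckijSq s S (fun x => f x - g x) ^ (1 / 2 : ℝ) ≤
      slobodeckijSq s S f ^ (1 / 2 : ℝ) + slobodeckijSq s S g ^ (1 / 2 : ℝ) := by
  rw [slobodeckijSq_eq s hf, slobodeckijSq_eq s hg, slobodeckijSq_eq s (f := fun x => f x - g x) (hf.sub hg)]
  simp only [← ENNReal.rpow_natCast, ← ENNReal.rpow_mul]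
  norm_num
  have : quot s (f - g) = quot s f - quot s g := by
    ext z
    simp only [quot, Pi.sub_apply]
    ring
  change eLpNorm (quot s (f - g)) 2 _ ≤ _
  rw [this]
  exact eLpNorm_sub_le (aestronglyMeasurable_quot s hf) (aestronglyMeasurable_quot s hg)
    (by norm_num)

theorem contract_sub_contract {X : Type*} [NormedAddCommGroup X] [NormedSpace ℝ X] (a : ℝ)
    (y x x' : X) : contract a y x - contract a y x' = (1 - a) • (x - x') := by
  simp only [contract, smul_sub]
  abel

theorem tendsto_slobodeckijSq_smoothing {s : ℝ} (hs0 : 0 < s) (K : Elt d) {f : Pt d → ℝ}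
    (hf : MemLp f 2 (volume.restrict (body K))) (hs : slobodeckijSq s (body K) f < ⊤) :
    Tendsto (fun a => slobodeckijSq s (body K) (fun x => smoothing K a f x - f x))
      (𝓝[>] 0) (𝓝 0) := by
  wlog hfm : Measurable f generalizing f
  · set g := hf.1.mk f with hg
    have hfg : f =ᵐ[volume.restrict (body K)] g := hf.1.ae_eq_mk
    have := this ((memLp_congr_ae hfg).1 hf) (by rwa [← slobodeckijSq_congr s hfg])
      hf.1.stronglyMeasurable_mk.measurable
    refine this.congr fun a => ?_
    rw [smoothing_congr K a hfg]
    refine slobodeckijSq_congr s ?_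
    filter_upwards [hfg] with x hx
    rw [hx]
  set κ : ℝ := ((d : ℝ) + 2 * s) / 2 with hκ
  set μ : Measure (Pt d × Pt d) := (volume.restrict (body K)).prod (volume.restrict (body K)) with hμ
  have hμ' : μ = (volume.prod volume : Measure (Pt d × Pt d)).restrict (body K ×ˢ body K) := by
    rw [hμ, Measure.prod_restrict]
  set F := quot s f with hF
  have hFm : Measurable F := by
    have h1 : Measurable fun z : Pt d × Pt d => ‖z.1 - z.2‖ ^ (((d : ℝ) + 2 * s) / 2) := by fun_prop
    exact ((hfm.comp measurable_fst).sub (hfm.comp measurable_snd)).div h1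
  have hFL : MemLp F 2 μ := by
    refine ⟨hFm.aestronglyMeasurable, ?_⟩
    rw [slobodeckijSq_eq s hf.1] at hs
    exact (ENNReal.pow_lt_top_iff.1 hs).resolve_right (by norm_num)
  have hsmooth : ∀ a ∈ Set.Ioo (0 : ℝ) 1, AEStronglyMeasurable (fun x => smoothing K a f x - f x)
      (volume.restrict (body K)) := fun a ha =>
    (smoothing_smooth K ha.1.ne' hf).continuous.aestronglyMeasurable.sub hf.1
  suffices h : Tendsto (fun a => eLpNorm (quot s fun x => smoothing K a f x - f x) 2 μ)
      (𝓝[>] 0) (𝓝 0) by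
    have h2 := ((ENNReal.continuous_pow 2).tendsto 0).comp h
    simp only [ne_eq, OfNat.ofNat_ne_zero, not_false_eq_true, zero_pow] at h2
    refine h2.congr' ?_
    filter_upwards [Ioo_mem_nhdsGT (zero_lt_one (α := ℝ))] with a ha
    rw [slobodeckijSq_eq s (hsmooth a ha)]
    rfl
  rw [ENNReal.tendsto_nhds_zero]
  intro η hη
  have hη2 : η / 2 ≠ 0 := (ENNReal.div_pos hη.ne' (by simp)).ne'
  obtain ⟨a₀, ha₀, ha2, h⟩ := exists_eLpNorm_contract_sub_le (volume.prod volume : Measure (Pt d × Pt d))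
    ((convex_body K).prod (convex_body K)) ((isCompact_body K).prod (isCompact_body K))
    (hμ' ▸ hFL) hη2
  have hscal : Tendsto (fun a : ℝ => ‖(1 - a) ^ κ - 1‖ₑ * eLpNorm F 2 μ) (𝓝[>] 0) (𝓝 0) := by
    have h1 : Tendsto (fun a : ℝ => (1 - a) ^ κ - 1) (𝓝 0) (𝓝 0) := by
      have hc : ContinuousAt (fun a : ℝ => (1 - a) ^ κ - 1) 0 := by
        refine ContinuousAt.sub ?_ continuousAt_const
        exact ContinuousAt.rpow_const (by fun_prop) (by simp)
      have := hc.tendsto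
      simpa using this
    have h2 := (h1.mono_left (nhdsWithin_le_nhds (s := Set.Ioi 0))).enorm
    rw [enorm_zero] at h2
    have := ENNReal.Tendsto.mul_const h2 (Or.inr hFL.2.ne) (b := eLpNorm F 2 μ)
    simpa using this
  have hev := (ENNReal.tendsto_nhds_zero.1 hscal) (η / 2) (pos_iff_ne_zero.2 hη2)
  filter_upwards [Ioo_mem_nhdsGT ha₀, hev] with a ha hsc
  have hle : a ≤ 1 := by linarith [ha.2]
  have h1a : 0 < 1 - a := by linarith [ha.2]
  set c : ℝ := (1 - a) ^ κ with hc
  have hκ0 : 0 ≤ κ := by positivity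
  have hc1 : ‖c‖ₑ ≤ 1 := by
    rw [← ofReal_norm_eq_enorm, Real.norm_of_nonneg (by positivity)]
    rw [ENNReal.ofReal_le_one]
    exact Real.rpow_le_one h1a.le (by linarith [ha.1]) hκ0
  have hcomp : ∀ y (z : Pt d × Pt d), c * F (contract a (y, y) z) =
      (f (contract a y z.1) - f (contract a y z.2)) / ‖z.1 - z.2‖ ^ κ := by
    intro y z
    have h1 : contract a (y, y) z = (contract a y z.1, contract a y z.2) := rfl
    rw [h1, hF]
    simp only [quot]
    rw [contract_sub_contract, norm_smul, Real.norm_of_nonneg h1a.le,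
      Real.mul_rpow h1a.le (norm_nonneg _), ← hκ, ← hc]
    have : c ≠ 0 := by positivity
    by_cases hz : ‖z.1 - z.2‖ ^ κ = 0
    · simp [hz]
    · field_simp
  have h1 : eLpNorm (fun z => ∫ y, (c * F (contract a (y, y) z) - F z) ∂(molM K)) 2 μ ≤ η := by
    refine eLpNorm_integral_le ?_ ?_
    · refine Measurable.aestronglyMeasurable ?_
      have : Measurable fun z : (Pt d × Pt d) × Pt d => contract a (z.2, z.2) z.1 := by
        unfold contract
        fun_prop
      exact ((hFm.comp this).const_mul c).sub (hFm.comp measurable_fst)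
    · filter_upwards [ae_molM_mem K] with y hy
      have hb := h a ha.1.le ha.2 (y, y) ⟨hy, hy⟩
      rw [← hμ'] at hb
      have hcm : Measurable fun z => F (contract a (y, y) z) := hFm.comp (measurable_contract a _)
      have hdec : (fun z => c * F (contract a (y, y) z) - F z) =
          (c • fun z => F (contract a (y, y) z) - F z) + ((c - 1) • F) := by
        ext z
        simp
        ring
      rw [hdec]
      refine (eLpNorm_add_le ((hcm.sub hFm).aestronglyMeasurable.const_smul c)
        (hFm.aestronglyMeasurable.const_smul _) (by norm_num)).trans ?_
      rw [eLpNorm_const_smul, eLpNorm_const_smul]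
      calc ‖c‖ₑ * eLpNorm (fun z => F (contract a (y, y) z) - F z) 2 μ + ‖c - 1‖ₑ * eLpNorm F 2 μ
          ≤ 1 * (η / 2) + η / 2 := by gcongr
        _ = η := by rw [one_mul, ENNReal.add_halves]
  refine le_trans (le_of_eq (eLpNorm_congr_ae ?_)) h1
  have hmem : ∀ᵐ z ∂μ, z ∈ body K ×ˢ body K := by
    rw [hμ']
    exact ae_restrict_mem ((measurableSet_body K).prod (measurableSet_body K))
  filter_upwards [hmem] with z hz
  have i1 := integrable_contract K ha.1 hle hf hz.1
  have i2 := integrable_contract K ha.1 hle hf hz.2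
  have i3 : Integrable (fun y => c * F (contract a (y, y) z)) (molM K) := by
    simp_rw [hcomp]
    exact (i1.sub i2).div_const _
  rw [integral_sub i3 (integrable_const _)]
  simp_rw [hcomp]
  rw [integral_div, integral_sub i1 i2, ← smoothing_eq_average K ha.1 hle f hz.1,
    ← smoothing_eq_average K ha.1 hle f hz.2]
  simp only [integral_const, probReal_univ, one_smul, hF, quot, ← hκ]
  ring

/-! ### Convergence in `L²` -/

section L2

variable {X : Type*} [MeasurableSpace X] {μ : Measure X}

theorem integrable_fun_mul {f g : X → ℝ} (hf : MemLp f 2 μ) (hg : MemLp g 2 μ) :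
    Integrable (fun x => f x * g x) μ := hf.integrable_mul hg

theorem lintegral_enorm_mul_le {f g : X → ℝ} (hf : AEStronglyMeasurable f μ)
    (hg : AEStronglyMeasurable g μ) :
    ∫⁻ x, ‖f x‖ₑ * ‖g x‖ₑ ∂μ ≤ eLpNorm f 2 μ * eLpNorm g 2 μ := by
  have h := ENNReal.lintegral_mul_le_Lp_mul_Lq μ (Real.HolderConjugate.two_two) hf.enorm hg.enorm
  have e : ∀ u : X → ℝ, eLpNorm u 2 μ = (∫⁻ x, ‖u x‖ₑ ^ (2 : ℝ) ∂μ) ^ (1 / 2 : ℝ) := by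
    intro u
    rw [eLpNorm_eq_lintegral_rpow_enorm_toReal (by norm_num) (by norm_num)]
    simp
  rw [e, e]
  exact h

theorem enorm_integral_mul_le {f g : X → ℝ} (hf : AEStronglyMeasurable f μ)
    (hg : AEStronglyMeasurable g μ) :
    ‖∫ x, f x * g x ∂μ‖ₑ ≤ eLpNorm f 2 μ * eLpNorm g 2 μ := by
  refine (enorm_integral_le_lintegral_enorm _).trans ?_
  simp_rw [enorm_mul]
  exact lintegral_enorm_mul_le hf hg

theorem tendsto_integral_mul {f : ℕ → X → ℝ} {g ψ : X → ℝ} (hf : ∀ n, MemLp (f n) 2 μ)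
    (hg : MemLp g 2 μ) (hψ : MemLp ψ 2 μ)
    (h : Tendsto (fun n => eLpNorm (fun x => f n x - g x) 2 μ) atTop (𝓝 0)) :
    Tendsto (fun n => ∫ x, f n x * ψ x ∂μ) atTop (𝓝 (∫ x, g x * ψ x ∂μ)) := by
  rw [tendsto_iff_edist_tendsto_0]
  have h2 : Tendsto (fun n => eLpNorm (fun x => f n x - g x) 2 μ * eLpNorm ψ 2 μ) atTop (𝓝 0) := by
    have := ENNReal.Tendsto.mul_const h (Or.inr hψ.2.ne) (b := eLpNorm ψ 2 μ)
    simpa using this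
  refine tendsto_of_tendsto_of_tendsto_of_le_of_le tendsto_const_nhds h2 (fun _ => zero_le)
    fun n => ?_
  simp only
  rw [edist_eq_enorm_sub, ← integral_sub (integrable_fun_mul (hf n) hψ) (integrable_fun_mul hg hψ)]
  simp_rw [← sub_mul]
  exact enorm_integral_mul_le ((hf n).1.sub hg.1) hψ.1

theorem exists_tendsto_of_cauchy {f : ℕ → X → ℝ} (hf : ∀ n, MemLp (f n) 2 μ)
    (h : Tendsto (fun p : ℕ × ℕ => eLpNorm (fun x => f p.1 x - f p.2 x) 2 μ) atTop (𝓝 0)) :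
    ∃ g, MemLp g 2 μ ∧ Tendsto (fun n => eLpNorm (fun x => f n x - g x) 2 μ) atTop (𝓝 0) := by
  have : Fact ((1 : ℝ≥0∞) ≤ 2) := ⟨by norm_num⟩
  let F : ℕ → Lp ℝ 2 μ := fun n => (hf n).toLp (f n)
  have hF : CauchySeq F := by
    rw [Lp.cauchySeq_Lp_iff_cauchySeq_eLpNorm]
    refine h.congr fun p => eLpNorm_congr_ae ?_
    filter_upwards [(hf p.1).coeFn_toLp, (hf p.2).coeFn_toLp] with x h1 h2
    simp only [F, Pi.sub_apply, h1, h2]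
  obtain ⟨G, hG⟩ := cauchySeq_tendsto_of_complete hF
  refine ⟨G, Lp.memLp G, ?_⟩
  rw [Lp.tendsto_Lp_iff_tendsto_eLpNorm'] at hG
  refine hG.congr fun n => eLpNorm_congr_ae ?_
  filter_upwards [(hf n).coeFn_toLp] with x h1
  simp only [F, Pi.sub_apply, h1]

theorem tendsto_eLpNorm_sub_of_tendsto {f : ℕ → X → ℝ} {g : X → ℝ} (hf : ∀ n, MemLp (f n) 2 μ)
    (hg : MemLp g 2 μ)
    (h : Tendsto (fun n => eLpNorm (fun x => f n x - g x) 2 μ) atTop (𝓝 0)) :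
    Tendsto (fun p : ℕ × ℕ => eLpNorm (fun x => f p.1 x - f p.2 x) 2 μ) atTop (𝓝 0) := by
  have h2 : Tendsto (fun p : ℕ × ℕ => eLpNorm (fun x => f p.1 x - g x) 2 μ +
      eLpNorm (fun x => f p.2 x - g x) 2 μ) atTop (𝓝 0) := by
    rw [← prod_atTop_atTop_eq]
    simpa using (h.comp tendsto_fst).add (h.comp tendsto_snd)
  refine tendsto_of_tendsto_of_tendsto_of_le_of_le tendsto_const_nhds h2 (fun _ => zero_le)
    fun p => ?_
  have : (fun x => f p.1 x - f p.2 x) = (fun x => f p.1 x - g x) - fun x => f p.2 x - g x := by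
    ext x
    simp
  simp only
  rw [this]
  exact eLpNorm_sub_le ((hf _).1.sub hg.1) ((hf _).1.sub hg.1) (by norm_num)

end L2

theorem Continuous.memLp_body {g : Pt d → ℝ} (hg : Continuous g) (K : Elt d) :
    MemLp g 2 (volume.restrict (body K)) := by
  obtain ⟨C, hC⟩ := (isCompact_body K).exists_bound_of_continuousOn hg.continuousOn
  refine MemLp.of_bound hg.aestronglyMeasurable C ?_
  filter_upwards [ae_restrict_mem (measurableSet_body K)] with x hx using hC x hx

theorem ae_surf_mem (K : Elt d) (i : Fin (d + 1)) : ∀ᵐ x ∂(surf (face K i)), x ∈ face K i :=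
  ae_restrict_mem (measurableSet_face K i)

theorem Continuous.memLp_face {g : Pt d → ℝ} (hg : Continuous g) (K : Elt d) (i : Fin (d + 1)) :
    MemLp g 2 (surf (face K i)) := by
  obtain ⟨C, hC⟩ := (isCompact_face K i).exists_bound_of_continuousOn hg.continuousOn
  refine MemLp.of_bound hg.aestronglyMeasurable C ?_
  filter_upwards [ae_surf_mem K i] with x hx using hC x hx

/-! ### Weak derivatives -/

theorem HasWeakPartial.hasWeakDiv {Ω : Set (Pt d)} {j : Fin d} {f g : Pt d → ℝ}
    (h : HasWeakPartial Ω j f g) : HasWeakDiv Ω (fun c => if c = j then f else 0) g := by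
  intro φ hφ
  rw [← h φ hφ]
  congr 1
  ext x
  rw [Finset.sum_eq_single j]
  · simp
  · intro b _ hb
    simp [hb]
  · simp

theorem IsTest.eq_zero {Ω : Set (Pt d)} {φ : Pt d → ℝ} (h : IsTest Ω φ) {x : Pt d} (hx : x ∉ Ω) :
    φ x = 0 := image_eq_zero_of_notMem_tsupport fun h' => hx (h.2.2 h')

theorem IsTest.pd_eq_zero {Ω : Set (Pt d)} {φ : Pt d → ℝ} (h : IsTest Ω φ) {x : Pt d} (hx : x ∉ Ω)
    (j : Fin d) : pd j φ x = 0 := by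
  have : fderiv ℝ φ x = 0 := image_eq_zero_of_notMem_tsupport
    fun h' => hx (h.2.2 (tsupport_fderiv_subset ℝ h'))
  simp [pd, this]

theorem HasWeakDiv.mono {Ω Ω' : Set (Pt d)} (hsub : Ω' ⊆ Ω)
    {V : Fin d → Pt d → ℝ} {D : Pt d → ℝ} (h : HasWeakDiv Ω V D) : HasWeakDiv Ω' V D := by
  intro φ hφ
  have hφ2 : IsTest Ω φ := ⟨hφ.1, hφ.2.1, hφ.2.2.trans hsub⟩
  have key := h φ hφ2
  rw [setIntegral_eq_integral_of_forall_compl_eq_zero fun x hx => by simp [hφ2.pd_eq_zero hx],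
    setIntegral_eq_integral_of_forall_compl_eq_zero fun x hx => by simp [hφ2.eq_zero hx]] at key
  rw [setIntegral_eq_integral_of_forall_compl_eq_zero fun x hx => by simp [hφ.pd_eq_zero hx],
    setIntegral_eq_integral_of_forall_compl_eq_zero fun x hx => by simp [hφ.eq_zero hx]]
  exact key

theorem HasWeakPartial.mono {Ω Ω' : Set (Pt d)} (hsub : Ω' ⊆ Ω) {j : Fin d}
    {f g : Pt d → ℝ} (h : HasWeakPartial Ω j f g) : HasWeakPartial Ω' j f g := by
  intro φ hφ
  have hφ2 : IsTest Ω φ := ⟨hφ.1, hφ.2.1, hφ.2.2.trans hsub⟩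
  have key := h φ hφ2
  rw [setIntegral_eq_integral_of_forall_compl_eq_zero fun x hx => by simp [hφ2.pd_eq_zero hx],
    setIntegral_eq_integral_of_forall_compl_eq_zero fun x hx => by simp [hφ2.eq_zero hx]] at key
  rw [setIntegral_eq_integral_of_forall_compl_eq_zero fun x hx => by simp [hφ.pd_eq_zero hx],
    setIntegral_eq_integral_of_forall_compl_eq_zero fun x hx => by simp [hφ.eq_zero hx]]
  exact key

theorem IsTest.memLp {Ω : Set (Pt d)} {φ : Pt d → ℝ} (h : IsTest Ω φ) (μ : Measure (Pt d))
    [IsFiniteMeasureOnCompacts μ] : MemLp φ 2 μ :=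
  h.1.continuous.memLp_of_hasCompactSupport h.2.1

theorem ae_eq_of_integral_test_eq {Ω : Set (Pt d)} (hΩ : IsOpen Ω) {f g : Pt d → ℝ}
    (hf : MemL2 Ω f) (hg : MemL2 Ω g)
    (h : ∀ φ, IsTest Ω φ → ∫ x in Ω, f x * φ x = ∫ x in Ω, g x * φ x) :
    f =ᵐ[volume.restrict Ω] g := by
  have hli : ∀ u, MemL2 Ω u → LocallyIntegrableOn u Ω volume := by
    intro u hu
    refine (locallyIntegrableOn_iff hΩ.isLocallyClosed).2 fun k hk hkc => ?_
    have : IsFiniteMeasure (volume.restrict k) := ⟨by simpa using hkc.measure_lt_top⟩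
    have h1 : MemLp u 2 (volume.restrict k) := MemLp.mono_measure (Measure.restrict_mono hk le_rfl) hu
    exact h1.integrable (by norm_num)
  have key := hΩ.ae_eq_zero_of_integral_contDiff_smul_eq_zero (f := fun x => f x - g x)
    ((hli f hf).sub (hli g hg)) fun φ h1 h2 h3 => ?_
  · rw [EventuallyEq, ae_restrict_iff' hΩ.measurableSet]
    filter_upwards [key] with x hx hxΩ using sub_eq_zero.1 (hx hxΩ)
  · have ht : IsTest Ω φ := ⟨h1, h2, h3⟩
    have e := h φ ht
    rw [← sub_eq_zero, ← integral_sub (integrable_fun_mul hf (ht.memLp _))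
      (integrable_fun_mul hg (ht.memLp _)),
      setIntegral_eq_integral_of_forall_compl_eq_zero fun x hx => by simp [ht.eq_zero hx]] at e
    rw [← e]
    congr 1
    ext x
    simp only [smul_eq_mul]
    ring

theorem HasWeakDiv.ae_unique {Ω : Set (Pt d)} (hΩ : IsOpen Ω) {V : Fin d → Pt d → ℝ}
    {D D' : Pt d → ℝ} (hD : MemL2 Ω D) (hD' : MemL2 Ω D') (h : HasWeakDiv Ω V D)
    (h' : HasWeakDiv Ω V D') : D =ᵐ[volume.restrict Ω] D' :=
  ae_eq_of_integral_test_eq hΩ hD hD' fun φ hφ => by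
    have := h φ hφ
    rw [h' φ hφ] at this
    exact (neg_injective this).symm

theorem HasWeakPartial.ae_unique {Ω : Set (Pt d)} (hΩ : IsOpen Ω) {j : Fin d}
    {f g g' : Pt d → ℝ} (hg : MemL2 Ω g) (hg' : MemL2 Ω g') (h : HasWeakPartial Ω j f g)
    (h' : HasWeakPartial Ω j f g') : g =ᵐ[volume.restrict Ω] g' :=
  HasWeakDiv.ae_unique hΩ hg hg' h.hasWeakDiv h'.hasWeakDiv

/-! ### Traces on the faces of a simplex -/

/-- The parameters of the smoothing sequence. -/
def sa (n : ℕ) : ℝ := 1 / ((n : ℝ) + 2)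

theorem sa_pos (n : ℕ) : 0 < sa n := by unfold sa; positivity

theorem sa_lt_one (n : ℕ) : sa n < 1 := by
  unfold sa
  rw [div_lt_one (by positivity)]
  have : (0 : ℝ) ≤ n := n.cast_nonneg
  linarith

theorem tendsto_sa : Tendsto sa atTop (𝓝[>] 0) := by
  refine tendsto_nhdsWithin_iff.2 ⟨?_, Eventually.of_forall sa_pos⟩
  have h : Tendsto (fun n : ℕ => (n : ℝ) + 2) atTop atTop :=
    tendsto_atTop_add_const_right _ _ tendsto_natCast_atTop_atTop
  refine (tendsto_inv_atTop_zero.comp h).congr fun n => ?_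
  simp [sa]

theorem tendstoL2_smoothing (K : Elt d) {f : Pt d → ℝ}
    (hf : MemLp f 2 (volume.restrict (body K))) :
    TendstoL2 (volume.restrict (body K)) (fun n => smoothing K (sa n) f) f :=
  (tendsto_smoothing K hf).comp tendsto_sa

theorem tendstoL2_const_mul_smoothing (K : Elt d) {f : Pt d → ℝ}
    (hf : MemLp f 2 (volume.restrict (body K))) :
    TendstoL2 (volume.restrict (body K)) (fun n x => (1 - sa n) * smoothing K (sa n) f x) f := by
  have h1 := tendstoL2_smoothing K hf
  have h2 : Tendsto (fun n => ‖sa n‖ₑ * eLpNorm f 2 (volume.restrict (body K))) atTop (𝓝 0) := by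
    have h3 := (tendsto_sa.mono_right nhdsWithin_le_nhds).enorm
    rw [enorm_zero] at h3
    simpa using ENNReal.Tendsto.mul_const h3 (Or.inr hf.2.ne)
      (b := eLpNorm f 2 (volume.restrict (body K)))
  have h3 := h1.add h2
  rw [add_zero] at h3
  refine tendsto_of_tendsto_of_tendsto_of_le_of_le tendsto_const_nhds h3 (fun _ => zero_le)
    fun n => ?_
  have hs := (smoothing_smooth K (sa_pos n).ne' hf).continuous.aestronglyMeasurable
    (μ := volume.restrict (body K))
  have hdec : (fun x => (1 - sa n) * smoothing K (sa n) f x - f x) =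
      ((1 - sa n) • fun x => smoothing K (sa n) f x - f x) - (sa n) • f := by
    ext x
    simp
    ring
  simp only
  rw [hdec]
  refine (eLpNorm_sub_le ((hs.sub hf.1).const_smul _) (hf.1.const_smul _) (by norm_num)).trans ?_
  rw [eLpNorm_const_smul, eLpNorm_const_smul]
  gcongr
  have : ‖1 - sa n‖ₑ ≤ 1 := by
    rw [← ofReal_norm_eq_enorm, Real.norm_of_nonneg (by linarith [sa_lt_one n]),
      ENNReal.ofReal_le_one]
    linarith [sa_pos n]
  calc _ ≤ 1 * eLpNorm (fun x => smoothing K (sa n) f x - f x) 2 (volume.restrict (body K)) := by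
        gcongr
        exact le_rfl
    _ = _ := one_mul _

theorem memL2_interior_body (K : Elt d) {f : Pt d → ℝ} :
    MemL2 (interior (body K)) f ↔ MemLp f 2 (volume.restrict (body K)) := by
  rw [MemL2, restrict_interior_body]

theorem pd_smoothing_of_hasWeakPartial (K : Elt d) {a : ℝ} (ha : 0 < a) (ha1 : a < 1) {j : Fin d}
    {f g : Pt d → ℝ} (hf : MemLp f 2 (volume.restrict (body K)))
    (h : HasWeakPartial (interior (body K)) j f g) {x : Pt d} (hx : x ∈ body K) :
    pd j (smoothing K a f) x = (1 - a) * smoothing K a g x := by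
  rw [← sum_pd_smoothing K ha ha1 (fun c => ?_) h.hasWeakDiv hx, Finset.sum_eq_single j]
  · simp
  · intro b _ hb
    have : smoothing K a (0 : Pt d → ℝ) = fun _ => 0 := by
      ext y
      simp [smoothing]
    simp [hb, this, pd]
  · simp
  · split_ifs
    · exact hf
    · exact MemLp.zero

theorem tendstoL2_pd_smoothing (K : Elt d) {j : Fin d} {f g : Pt d → ℝ}
    (hf : MemLp f 2 (volume.restrict (body K))) (hg : MemLp g 2 (volume.restrict (body K)))
    (h : HasWeakPartial (interior (body K)) j f g) :
    TendstoL2 (volume.restrict (body K)) (fun n => pd j (smoothing K (sa n) f)) g := by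
  refine (tendstoL2_const_mul_smoothing K hg).congr fun n => eLpNorm_congr_ae ?_
  filter_upwards [ae_restrict_mem (measurableSet_body K)] with x hx
  rw [pd_smoothing_of_hasWeakPartial K (sa_pos n) (sa_lt_one n) hf h hx]

theorem pd_mul {φ ψ : Pt d → ℝ} (hφ : Smooth φ) (hψ : Smooth ψ) (j : Fin d) (x : Pt d) :
    pd j (fun x => φ x * ψ x) x = pd j φ x * ψ x + φ x * pd j ψ x := by
  have := ((hφ.hasFDerivAt x).mul (hψ.hasFDerivAt x)).fderiv
  simp only [pd]
  rw [show (fun x => φ x * ψ x) = φ * ψ from rfl, this]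
  simp
  ring

theorem pd_sub {φ ψ : Pt d → ℝ} (hφ : Smooth φ) (hψ : Smooth ψ) (j : Fin d) (x : Pt d) :
    pd j (fun x => φ x - ψ x) x = pd j φ x - pd j ψ x := by
  have := ((hφ.hasFDerivAt x).sub (hψ.hasFDerivAt x)).fderiv
  simp only [pd]
  rw [show (fun x => φ x - ψ x) = φ - ψ from rfl, this]
  simp

theorem eLpNorm_two_sq_eq_ofReal {X : Type*} [MeasurableSpace X] {μ : Measure X} {f : X → ℝ}
    (hf : MemLp f 2 μ) : eLpNorm f 2 μ ^ 2 = ENNReal.ofReal (∫ x, f x ^ 2 ∂μ) := by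
  rw [eLpNorm_two_sq, ofReal_integral_eq_lintegral_ofReal hf.integrable_sq
    (ae_of_all _ fun x => sq_nonneg _)]
  refine lintegral_congr fun x => ?_
  rw [← ofReal_norm_eq_enorm, ← ENNReal.ofReal_pow (norm_nonneg _), Real.norm_eq_abs, sq_abs]

/-- The trace inequality on a face of a simplex. -/
theorem exists_trace_inequality (K : Elt d) (i : Fin (d + 1)) : ∃ C : ℝ, 0 ≤ C ∧
    ∀ φ : Pt d → ℝ, Smooth φ → ∫ x, φ x ^ 2 ∂(surf (face K i)) ≤
      C * ((∫ x in body K, φ x ^ 2) + ∑ j, ∫ x in body K, pd j φ x ^ 2) := by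
  obtain ⟨R, hR⟩ := (isCompact_body K).exists_bound_of_continuousOn
    (f := fun x => ‖x - K.points i‖) (by fun_prop)
  have hh := K.height_pos i
  have hR0 : 0 ≤ R := by
    obtain ⟨x, hx⟩ := exists_mem_interior_body K
    exact (norm_nonneg _).trans (hR x (interior_subset hx))
  refine ⟨(d + d * R + R) / K.height i, by positivity, fun φ hφ => ?_⟩
  have hφφ : Smooth fun x => φ x * φ x := hφ.mul hφ
  have h1 := integral_radial K i hφφ
  have hc1 : Continuous fun x => φ x ^ 2 := hφ.continuous.pow 2
  have hc2 : ∀ j, Continuous fun x => HDG.pd j φ x ^ 2 := fun j => (hφ.continuous_pd j).pow 2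
  have h2 : ∫ x in body K, (d * (φ x * φ x) + ∑ j, (x j - K.points i j) * HDG.pd j (fun x => φ x * φ x) x) ≤
      ∫ x in body K, ((d + d * R) * φ x ^ 2 + R * ∑ j, HDG.pd j φ x ^ 2) := by
    refine setIntegral_mono_on ?_ ?_ (measurableSet_body K) fun x hx => ?_
    · refine Continuous.integrableOn_body ?_ K
      refine (continuous_const.mul hφφ.continuous).add (continuous_finsetSum _ fun j _ => ?_)
      exact (by fun_prop : Continuous fun x : Pt d => x j - K.points i j).mul
        (hφφ.continuous_pd j)
    · refine Continuous.integrableOn_body ?_ K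
      exact (continuous_const.mul hc1).add
        (continuous_const.mul (continuous_finsetSum _ fun j _ => hc2 j))
    · have hb : ∀ j, (x j - K.points i j) * HDG.pd j (fun x => φ x * φ x) x ≤
          R * φ x ^ 2 + R * HDG.pd j φ x ^ 2 := by
        intro j
        have hp : HDG.pd j (fun x => φ x * φ x) x = 2 * (φ x * HDG.pd j φ x) := by
          rw [pd_mul hφ hφ j x]
          ring
        have hxj : |x j - K.points i j| ≤ R := by
          have e1 := hR x hx
          rw [norm_norm] at e1
          exact (PiLp.norm_apply_le (x - K.points i) j).trans e1
        rw [hp]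
        have e2 : |2 * (φ x * HDG.pd j φ x)| ≤ φ x ^ 2 + HDG.pd j φ x ^ 2 := by
          rw [abs_le]
          constructor <;> nlinarith [sq_nonneg (φ x + HDG.pd j φ x), sq_nonneg (φ x - HDG.pd j φ x)]
        calc _ ≤ |(x j - K.points i j) * (2 * (φ x * HDG.pd j φ x))| := le_abs_self _
          _ = |x j - K.points i j| * |2 * (φ x * HDG.pd j φ x)| := abs_mul _ _
          _ ≤ R * (φ x ^ 2 + HDG.pd j φ x ^ 2) := mul_le_mul hxj e2 (abs_nonneg _) hR0
          _ = _ := by ring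
      have hs := Finset.sum_le_sum fun j (_ : j ∈ Finset.univ) => hb j
      rw [Finset.sum_add_distrib, ← Finset.mul_sum (f := fun j => HDG.pd j φ x ^ 2)] at hs
      simp only [Finset.sum_const, Finset.card_univ, Fintype.card_fin, nsmul_eq_mul] at hs
      linarith [sq (φ x)]
  rw [h1, integral_add, integral_const_mul, integral_const_mul, integral_finset_sum] at h2
  · simp_rw [← sq] at h2
    rw [div_mul_eq_mul_div, le_div_iff₀ hh]
    have p1 : 0 ≤ ∫ x in body K, φ x ^ 2 := integral_nonneg fun x => sq_nonneg _
    have p2 : 0 ≤ ∑ j, ∫ x in body K, HDG.pd j φ x ^ 2 :=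
      Finset.sum_nonneg fun j _ => integral_nonneg fun x => sq_nonneg _
    have p3 : 0 ≤ (d + d * R) * ∑ j, ∫ x in body K, HDG.pd j φ x ^ 2 := by positivity
    have p4 : 0 ≤ R * ∫ x in body K, φ x ^ 2 := by positivity
    nlinarith
  · exact fun j _ => Continuous.integrableOn_body (hc2 j) K
  · exact Continuous.integrableOn_body (continuous_const.mul hc1) K
  · exact Continuous.integrableOn_body
      (continuous_const.mul (continuous_finsetSum _ fun j _ => hc2 j)) K

theorem exists_isTrace (K : Elt d) (i : Fin (d + 1)) {f : Pt d → ℝ} {Df : Fin d → Pt d → ℝ}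
    (hf : MemL2 (interior (body K)) f)
    (hDf : ∀ j, MemL2 (interior (body K)) (Df j) ∧ HasWeakPartial (interior (body K)) j f (Df j)) :
    ∃ γ, IsTrace K (face K i) f γ := by
  rw [memL2_interior_body] at hf
  have hDL : ∀ j, MemLp (Df j) 2 (volume.restrict (body K)) := fun j =>
    (memL2_interior_body K).1 (hDf j).1
  have hs : ∀ n, Smooth (smoothing K (sa n) f) := fun n => smoothing_smooth K (sa_pos n).ne' hf
  have hconv := tendstoL2_smoothing K hf
  have hpd := fun j => tendstoL2_pd_smoothing K hf (hDL j) (hDf j).2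
  obtain ⟨C, hC0, hC⟩ := exists_trace_inequality K i
  have hcauchy : Tendsto (fun p : ℕ × ℕ => eLpNorm (fun x => smoothing K (sa p.1) f x -
      smoothing K (sa p.2) f x) 2 (surf (face K i))) atTop (𝓝 0) := by
    have h1 := tendsto_eLpNorm_sub_of_tendsto (fun n => Continuous.memLp_body (hs n).continuous K)
      hf hconv
    have h2 := fun j => tendsto_eLpNorm_sub_of_tendsto
      (fun n => Continuous.memLp_body ((hs n).continuous_pd j) K) (hDL j) (hpd j)
    have hsq : ∀ {u : ℕ × ℕ → ℝ≥0∞}, Tendsto u atTop (𝓝 0) →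
        Tendsto (fun p => u p ^ 2) atTop (𝓝 0) := by
      intro u hu
      simpa [Function.comp_def] using ((ENNReal.continuous_pow 2).tendsto 0).comp hu
    have h3 := (hsq h1).add (tendsto_finsetSum Finset.univ fun j _ => hsq (h2 j))
    have h4 := ENNReal.Tendsto.const_mul h3 (Or.inr ENNReal.ofReal_ne_top) (a := ENNReal.ofReal C)
    simp only [Finset.sum_const_zero, add_zero, mul_zero] at h4
    have h5 := (ENNReal.continuous_rpow_const (y := (2 : ℝ)⁻¹)).tendsto 0 |>.comp h4
    rw [ENNReal.zero_rpow_of_pos (by norm_num)] at h5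
    refine tendsto_of_tendsto_of_tendsto_of_le_of_le tendsto_const_nhds h5 (fun _ => zero_le)
      fun p => ?_
    simp only [Function.comp]
    rw [ENNReal.le_rpow_inv_iff (by norm_num)]
    have hd := (hs p.1).sub (hs p.2)
    have hd' : Smooth fun x => smoothing K (sa p.1) f x - smoothing K (sa p.2) f x := hd
    have e0 := Continuous.memLp_face hd'.continuous K i
    have e1 := Continuous.memLp_body hd'.continuous K
    have hpdsub : ∀ j, (fun x => pd j (smoothing K (sa p.1) f) x - pd j (smoothing K (sa p.2) f) x) =
        pd j fun x => smoothing K (sa p.1) f x - smoothing K (sa p.2) f x := fun j =>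
      funext fun x => (pd_sub (hs p.1) (hs p.2) j x).symm
    simp_rw [hpdsub]
    have e2 := fun j => Continuous.memLp_body (hd'.continuous_pd j) K
    have e3 : ∀ t : ℝ≥0∞, t ^ (2 : ℝ) = t ^ 2 := fun t => by
      rw [← ENNReal.rpow_natCast]
      norm_num
    rw [e3, eLpNorm_two_sq_eq_ofReal e0, eLpNorm_two_sq_eq_ofReal e1]
    simp_rw [fun j => eLpNorm_two_sq_eq_ofReal (e2 j)]
    rw [← ENNReal.ofReal_sum_of_nonneg fun j _ => integral_nonneg fun x => sq_nonneg _,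
      ← ENNReal.ofReal_add (integral_nonneg fun x => sq_nonneg _)
        (Finset.sum_nonneg fun j _ => integral_nonneg fun x => sq_nonneg _),
      ← ENNReal.ofReal_mul hC0]
    exact ENNReal.ofReal_le_ofReal (hC _ hd')
  obtain ⟨γ, hγ, hγl⟩ := exists_tendsto_of_cauchy
    (fun n => Continuous.memLp_face (hs n).continuous K i) hcauchy
  exact ⟨γ, hγ, Df, hDf, fun n => smoothing K (sa n) f, hs, hconv, hpd, hγl⟩

theorem TendstoL2.congr_right {μ : Measure (Pt d)} {f : ℕ → Pt d → ℝ} {g g' : Pt d → ℝ}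
    (h : TendstoL2 μ f g) (hg : g =ᵐ[μ] g') : TendstoL2 μ f g' := by
  refine Tendsto.congr (fun n => eLpNorm_congr_ae ?_) h
  filter_upwards [hg] with x hx
  rw [hx]

/-- The trace does not depend on the choice of the weak derivatives and of the sequence: it is
determined by the radial divergence theorem. -/
theorem IsTrace.integral_radial {K : Elt d} {i : Fin (d + 1)} {f γ : Pt d → ℝ}
    (h : IsTrace K (face K i) f γ) {Df : Fin d → Pt d → ℝ}
    (hf : MemL2 (interior (body K)) f)
    (hDf : ∀ j, MemL2 (interior (body K)) (Df j) ∧ HasWeakPartial (interior (body K)) j f (Df j))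
    {φ : Pt d → ℝ} (hφ : Smooth φ) :
    ∫ x in body K, (d * (f x * φ x) +
        ∑ j, (x j - K.points i j) * (Df j x * φ x + f x * pd j φ x)) =
      K.height i * ∫ y, γ y * φ y ∂(surf (face K i)) := by
  obtain ⟨hγ, Df', hDf', ψ, hψ, hψf, hψD, hψγ⟩ := h
  rw [memL2_interior_body] at hf
  have hDL : ∀ j, MemLp (Df j) 2 (volume.restrict (body K)) := fun j =>
    (memL2_interior_body K).1 (hDf j).1
  have hψD2 : ∀ j, TendstoL2 (volume.restrict (body K)) (fun n => pd j (ψ n)) (Df j) := by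
    intro j
    refine (hψD j).congr_right ?_
    rw [← restrict_interior_body]
    exact HasWeakPartial.ae_unique isOpen_interior (hDf' j).1 (hDf j).1 (hDf' j).2 (hDf j).2
  set A : Pt d → ℝ := fun x => d * φ x + ∑ j, (x j - K.points i j) * pd j φ x with hA
  have hAc : Continuous A := by
    refine (continuous_const.mul hφ.continuous).add (continuous_finsetSum _ fun j _ => ?_)
    exact (by fun_prop : Continuous fun x : Pt d => x j - K.points i j).mul (hφ.continuous_pd j)
  have hBc : ∀ j, Continuous fun x : Pt d => (x j - K.points i j) * φ x := fun j =>
    (by fun_prop : Continuous fun x : Pt d => x j - K.points i j).mul hφ.continuous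
  have hAL := Continuous.memLp_body hAc K
  have hBL := fun j => Continuous.memLp_body (hBc j) K
  have split : ∀ (u : Pt d → ℝ) (Du : Fin d → Pt d → ℝ), MemLp u 2 (volume.restrict (body K)) →
      (∀ j, MemLp (Du j) 2 (volume.restrict (body K))) →
      ∫ x in body K, (d * (u x * φ x) +
        ∑ j, (x j - K.points i j) * (Du j x * φ x + u x * pd j φ x)) =
      (∫ x in body K, u x * A x) + ∑ j, ∫ x in body K, Du j x * ((x j - K.points i j) * φ x) := by
    intro u Du hu hDu
    rw [← integral_finset_sum _ fun j _ => integrable_fun_mul (hDu j) (hBL j),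
      ← integral_add (integrable_fun_mul hu hAL)
        (integrable_finset_sum _ fun j _ => integrable_fun_mul (hDu j) (hBL j))]
    congr 1
    ext x
    simp only [hA, Pi.mul_apply, mul_add, Finset.sum_add_distrib, Finset.mul_sum]
    have e1 : ∀ j, (x j - K.points i j) * (Du j x * φ x) = Du j x * ((x j - K.points i j) * φ x) :=
      fun j => by ring
    have e2 : ∀ j, (x j - K.points i j) * (u x * pd j φ x) =
        u x * ((x j - K.points i j) * pd j φ x) := fun j => by ring
    simp_rw [e1, e2]
    ring
  have hlim : Tendsto (fun n => (∫ x in body K, ψ n x * A x) +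
      ∑ j, ∫ x in body K, pd j (ψ n) x * ((x j - K.points i j) * φ x)) atTop
      (𝓝 ((∫ x in body K, f x * A x) + ∑ j, ∫ x in body K, Df j x * ((x j - K.points i j) * φ x))) := by
    refine (tendsto_integral_mul (fun n => Continuous.memLp_body (hψ n).continuous K) hf hAL
      hψf).add (tendsto_finsetSum _ fun j _ => ?_)
    exact tendsto_integral_mul (fun n => Continuous.memLp_body (Smooth.continuous_pd (hψ n) j) K)
      (hDL j) (hBL j) (hψD2 j)
  have hlim2 : Tendsto (fun n => K.height i * ∫ y, ψ n y * φ y ∂(surf (face K i))) atTop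
      (𝓝 (K.height i * ∫ y, γ y * φ y ∂(surf (face K i)))) :=
    (tendsto_integral_mul (fun n => Continuous.memLp_face (hψ n).continuous K i) hγ
      (Continuous.memLp_face hφ.continuous K i) hψγ).const_mul _
  rw [split f Df hf hDL]
  refine tendsto_nhds_unique hlim (hlim2.congr fun n => ?_)
  have hs : Smooth fun x => ψ n x * φ x := (hψ n).mul hφ
  rw [← HDG.integral_radial K i hs]
  rw [← split (ψ n) (fun j => pd j (ψ n)) (Continuous.memLp_body (hψ n).continuous K)
    fun j => Continuous.memLp_body (Smooth.continuous_pd (hψ n) j) K]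
  simp_rw [pd_mul (hψ n) hφ]

/-- Green's formula for functions in `H¹(K)`. -/
theorem green_trace {K : Elt d} {f : Pt d → ℝ} {γ : Fin (d + 1) → Pt d → ℝ}
    (h : ∀ i, IsTrace K (face K i) f (γ i)) {Df : Fin d → Pt d → ℝ}
    (hf : MemL2 (interior (body K)) f)
    (hDf : ∀ j, MemL2 (interior (body K)) (Df j) ∧ HasWeakPartial (interior (body K)) j f (Df j))
    {φ : Pt d → ℝ} (hφ : Smooth φ) (j : Fin d) :
    ∫ x in body K, (Df j x * φ x + f x * pd j φ x) =
      ∑ i, nrm K i j * ∫ y, γ i y * φ y ∂(surf (face K i)) := by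
  have h1 : ∀ i, nrm K i j * ∫ y, γ i y * φ y ∂(surf (face K i)) = ∫ x in body K,
      nrm K i j / K.height i * (d * (f x * φ x) +
        ∑ l, (x l - K.points i l) * (Df l x * φ x + f x * pd l φ x)) := by
    intro i
    have hh := K.height_pos i
    rw [integral_const_mul, (h i).integral_radial hf hDf hφ]
    field_simp
  simp_rw [h1]
  rw [memL2_interior_body] at hf
  rw [← integral_finset_sum]
  · refine integral_congr_ae (ae_of_all _ fun x => ?_)
    simp only
    rw [sum_radial K j (f x * φ x) (fun l => Df l x * φ x + f x * pd l φ x) x]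
  · intro i _
    refine Integrable.const_mul (Integrable.add ?_ (integrable_finset_sum _ fun l _ => ?_)) _
    · exact (hf.integrable_mul (Continuous.memLp_body hφ.continuous K)).const_mul _
    · have e1 := ((memL2_interior_body K).1 (hDf l).1).integrable_mul (Continuous.memLp_body
        ((by fun_prop : Continuous fun x : Pt d => x l - K.points i l).mul hφ.continuous) K)
      have e2 := hf.integrable_mul (Continuous.memLp_body
        ((by fun_prop : Continuous fun x : Pt d => x l - K.points i l).mul
          (hφ.continuous_pd l)) K)
      refine (e1.add e2).congr (ae_of_all _ fun x => ?_)
      simp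
      ring

/-- A field with trace zero moments is determined almost everywhere. -/
theorem ae_eq_zero_of_integral_smooth {K : Elt d} {i : Fin (d + 1)} {γ : Pt d → ℝ}
    (hγ : MemLp γ 2 (surf (face K i)))
    (h : ∀ φ, Smooth φ → ∫ y, γ y * φ y ∂(surf (face K i)) = 0) :
    γ =ᵐ[surf (face K i)] 0 := by
  refine ae_eq_zero_of_integral_contDiff_smul_eq_zero
    (hγ.integrable (by norm_num)).locallyIntegrable fun φ hφ _ => ?_
  rw [← h φ hφ]
  congr 1
  ext y
  simp [mul_comm]

/-- Integration by parts for smooth functions. -/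
theorem integral_by_parts (K : Elt d) (j : Fin d) {φ ψ : Pt d → ℝ} (hφ : Smooth φ)
    (hψ : Smooth ψ) :
    ∫ x in body K, (pd j φ x * ψ x + φ x * pd j ψ x) =
      ∑ i, nrm K i j * ∫ y, φ y * ψ y ∂(surf (face K i)) := by
  have hs : Smooth fun x => φ x * ψ x := hφ.mul hψ
  rw [← integral_pd K j hs]
  simp_rw [pd_mul hφ hψ]

/-! ### Degrees of polynomials -/

theorem mem_polyLE {m : ℕ} {p : Poly d} : p ∈ PolyLE d m ↔ p.totalDegree ≤ m :=
  MvPolynomial.mem_restrictTotalDegree _ _ _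

theorem polyLE_mono {m n : ℕ} (h : m ≤ n) {p : Poly d} (hp : p ∈ PolyLE d m) : p ∈ PolyLE d n :=
  mem_polyLE.2 ((mem_polyLE.1 hp).trans h)

theorem mul_mem_polyLE {m n l : ℕ} {p q : Poly d} (hp : p ∈ PolyLE d m) (hq : q ∈ PolyLE d n)
    (h : m + n ≤ l) : p * q ∈ PolyLE d l :=
  mem_polyLE.2 ((MvPolynomial.totalDegree_mul p q).trans
    ((add_le_add (mem_polyLE.1 hp) (mem_polyLE.1 hq)).trans h))

theorem C_mem_polyLE (m : ℕ) (a : ℝ) : MvPolynomial.C a ∈ PolyLE d m :=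
  mem_polyLE.2 (by simp)

theorem mul_C_mem_polyLE {m : ℕ} {p : Poly d} (hp : p ∈ PolyLE d m) (a : ℝ) :
    p * MvPolynomial.C a ∈ PolyLE d m := mul_mem_polyLE hp (C_mem_polyLE 0 a) le_rfl

theorem X_mem_polyLE (j : Fin d) : (MvPolynomial.X j : Poly d) ∈ PolyLE d 1 :=
  mem_polyLE.2 (by simp)

theorem bary_mem_polyLE (K : Elt d) (i : Fin (d + 1)) : bary K i ∈ PolyLE d 1 := by
  refine Submodule.sum_mem _ fun j _ => mul_mem_polyLE (n := 1) (C_mem_polyLE 0 _) ?_ (by simp)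
  exact Submodule.sub_mem _ (X_mem_polyLE j) (C_mem_polyLE 1 _)

theorem monomial_mem_polyLE {m : ℕ} {s : Fin d →₀ ℕ} (a : ℝ) (h : s.sum (fun _ => id) ≤ m) :
    MvPolynomial.monomial s a ∈ PolyLE d m :=
  mem_polyLE.2 ((MvPolynomial.totalDegree_monomial_le s a).trans h)

theorem sum_le_of_mem_support {m : ℕ} {p : Poly d} (hp : p ∈ PolyLE d m) {s : Fin d →₀ ℕ}
    (hs : s ∈ p.support) : s.sum (fun _ => id) ≤ m :=
  (MvPolynomial.le_totalDegree hs).trans (mem_polyLE.1 hp)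

theorem sum_sub_single {s : Fin d →₀ ℕ} {j : Fin d} (h : s j ≠ 0) :
    (s - Finsupp.single j 1).sum (fun _ => id) + 1 = s.sum (fun _ => id) := by
  have h1 : s = (s - Finsupp.single j 1) + Finsupp.single j 1 := by
    rw [tsub_add_cancel_of_le]
    rw [Finsupp.single_le_iff]
    omega
  conv_rhs => rw [h1]
  rw [Finsupp.sum_add_index' (fun _ => rfl) (fun _ _ _ => rfl)]
  simp

theorem pderiv_mem_polyLE {m : ℕ} {p : Poly d} (hp : p ∈ PolyLE d m) (j : Fin d) :
    MvPolynomial.pderiv j p ∈ PolyLE d (m - 1) := by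
  rw [p.as_sum, map_sum]
  refine Submodule.sum_mem _ fun s hs => ?_
  rw [MvPolynomial.pderiv_monomial]
  by_cases h0 : s j = 0
  · simp [h0]
  · refine monomial_mem_polyLE _ ?_
    have h1 := sum_le_of_mem_support hp hs
    have h2 := sum_sub_single h0
    omega

theorem pderiv_comm (i j : Fin d) (p : Poly d) :
    MvPolynomial.pderiv i (MvPolynomial.pderiv j p) =
      MvPolynomial.pderiv j (MvPolynomial.pderiv i p) := by
  induction p using MvPolynomial.induction_on with
  | C a => simp
  | add p q hp hq => simp [hp, hq]
  | mul_X p l hp =>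
    simp only [MvPolynomial.pderiv_mul, MvPolynomial.pderiv_X, map_add, hp]
    by_cases h1 : i = l <;> by_cases h2 : j = l <;> simp [h1, h2, Pi.single_apply]

/-! ### `L²` projections -/

theorem exists_of_ker_le {V M : Type*} [AddCommGroup V] [Module ℝ V] [FiniteDimensional ℝ V]
    [AddCommGroup M] [Module ℝ M] (B : M →ₗ[ℝ] Module.Dual ℝ V) (ℓ : M →ₗ[ℝ] ℝ)
    (h : ∀ m, B m = 0 → ℓ m = 0) : ∃ v : V, ∀ m, B m v = ℓ m := by
  have h1 : ℓ ∈ LinearMap.range B.dualMap := by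
    rw [LinearMap.range_dualMap_eq_dualAnnihilator_ker]
    rw [Submodule.mem_dualAnnihilator]
    exact fun m hm => h m hm
  obtain ⟨ψ, hψ⟩ := h1
  refine ⟨(Module.evalEquiv ℝ V).symm ψ, fun m => ?_⟩
  rw [← hψ]
  simp [LinearMap.dualMap_apply]

/-- The pairing of an `L²` function with polynomials. -/
def pairing (μ : Measure (Pt d)) (hμ : ∀ q : Poly d, MemLp (val q) 2 μ) (f : Pt d → ℝ)
    (hf : MemLp f 2 μ) : Poly d →ₗ[ℝ] ℝ where
  toFun q := ∫ x, f x * val q x ∂μ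
  map_add' p q := by
    simp only [val_add, mul_add]
    exact integral_add (integrable_fun_mul hf (hμ p)) (integrable_fun_mul hf (hμ q))
  map_smul' a q := by
    simp only [val_smul, RingHom.id_apply, smul_eq_mul]
    rw [← integral_const_mul]
    congr 1
    ext x
    ring

/-- The `L²` scalar product of polynomials. -/
def polyForm (μ : Measure (Pt d)) (hμ : ∀ q : Poly d, MemLp (val q) 2 μ) :
    Poly d →ₗ[ℝ] Poly d →ₗ[ℝ] ℝ :=
  LinearMap.mk₂ ℝ (fun p q => ∫ x, val q x * val p x ∂μ)
    (fun p p' q => by exact (pairing μ hμ (val q) (hμ q)).map_add p p')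
    (fun a p q => by exact (pairing μ hμ (val q) (hμ q)).map_smul a p)
    (fun p q q' => by
      simp_rw [mul_comm _ (val p _)]
      exact (pairing μ hμ (val p) (hμ p)).map_add q q')
    (fun a p q => by
      simp_rw [mul_comm _ (val p _)]
      exact (pairing μ hμ (val p) (hμ p)).map_smul a q)

theorem ae_eq_zero_of_integral_sq {X : Type*} [MeasurableSpace X] {μ : Measure X} {f : X → ℝ}
    (hf : MemLp f 2 μ) (h : ∫ x, f x * f x ∂μ = 0) : f =ᵐ[μ] 0 := by
  have := (integral_eq_zero_iff_of_nonneg (fun x => mul_self_nonneg (f x))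
    (integrable_fun_mul hf hf)).1 h
  filter_upwards [this] with x hx
  simpa using hx

theorem exists_projection (μ : Measure (Pt d)) (hμ : ∀ q : Poly d, MemLp (val q) 2 μ) (m : ℕ)
    {f : Pt d → ℝ} (hf : MemLp f 2 μ) : ∃ q ∈ PolyLE d m, ∀ w ∈ PolyLE d m,
      ∫ x, val q x * val w x ∂μ = ∫ x, f x * val w x ∂μ := by
  obtain ⟨q, hq⟩ := exists_of_ker_le (V := PolyLE d m) (M := PolyLE d m)
    (((polyForm μ hμ).compl₂ (PolyLE d m).subtype).comp (PolyLE d m).subtype)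
    ((pairing μ hμ f hf).comp (PolyLE d m).subtype) fun w hw => by
      have h1 : ∫ x, val (w : Poly d) x * val (w : Poly d) x ∂μ = 0 := LinearMap.congr_fun hw w
      have h2 := ae_eq_zero_of_integral_sq (hμ w) h1
      change ∫ x, f x * val (w : Poly d) x ∂μ = 0
      refine integral_eq_zero_of_ae ?_
      filter_upwards [h2] with x hx
      simp [hx]
  exact ⟨q, q.2, fun w hw => hq ⟨w, hw⟩⟩

theorem memLp_val_body (K : Elt d) (q : Poly d) : MemLp (val q) 2 (volume.restrict (body K)) :=
  Continuous.memLp_body (contDiff_val q (n := 0)).continuous K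

theorem memLp_val_face (K : Elt d) (i : Fin (d + 1)) (q : Poly d) :
    MemLp (val q) 2 (surf (face K i)) :=
  Continuous.memLp_face (contDiff_val q (n := 0)).continuous K i

theorem elemProj_spec (m : ℕ) (K : Elt d) {f : Pt d → ℝ}
    (hf : MemLp f 2 (volume.restrict (body K))) : elemProj m K f ∈ PolyLE d m ∧
    ∀ w ∈ PolyLE d m, ∫ x in body K, val (elemProj m K f) x * val w x =
      ∫ x in body K, f x * val w x :=
  Classical.epsilon_spec (p := fun q => q ∈ PolyLE d m ∧
    ∀ w ∈ PolyLE d m, ∫ x in body K, val q x * val w x = ∫ x in body K, f x * val w x) (by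
      obtain ⟨q, h1, h2⟩ := exists_projection (volume.restrict (body K)) (memLp_val_body K) m hf
      exact ⟨q, h1, h2⟩)

theorem faceProj_spec (m : ℕ) (K : Elt d) (i : Fin (d + 1)) {f : Pt d → ℝ}
    (hf : MemLp f 2 (surf (face K i))) : ∃ q ∈ PolyLE d m, faceProj m (face K i) f = val q ∧
    ∀ w ∈ PolyLE d m, ∫ x, val q x * val w x ∂(surf (face K i)) =
      ∫ x, f x * val w x ∂(surf (face K i)) := by
  have h := Classical.epsilon_spec (p := fun q : Poly d => q ∈ PolyLE d m ∧
    ∀ w ∈ PolyLE d m, ∫ x, val q x * val w x ∂(surf (face K i)) =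
      ∫ x, f x * val w x ∂(surf (face K i))) (by
      obtain ⟨q, h1, h2⟩ := exists_projection (surf (face K i)) (memLp_val_face K i) m hf
      exact ⟨q, h1, h2⟩)
  exact ⟨_, h.1, rfl, h.2⟩

/-! ### The Brezzi–Douglas–Marini projection -/

theorem smooth_val (q : Poly d) : Smooth (val q) := contDiff_val q

theorem sum_sub_mul_nrm (K : Elt d) (i : Fin (d + 1)) (x y : Pt d) :
    ∑ j, (x j - y j) * nrm K i j = -K.height i * (lam K i x - lam K i y) := by
  have hh := K.height_pos i
  have h1 : ∑ j, (x j - y j) * nrm K i j = inner ℝ (x - y) (nrm K i) := by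
    rw [PiLp.inner_apply]
    refine Finset.sum_congr rfl fun j _ => ?_
    simp
    ring
  rw [lam_sub, h1]
  field_simp

/-- Every polynomial of degree at most `k ≥ 1` is a combination of the barycentric coordinates with
coefficients of degree at most `k - 1`. -/
theorem exists_bary_decomposition (K : Elt d) {k : ℕ} (hk : 1 ≤ k) {w : Poly d}
    (hw : w ∈ PolyLE d k) : ∃ g : Fin (d + 1) → Poly d, (∀ l, g l ∈ PolyLE d (k - 1)) ∧
      ∀ x, val w x = ∑ l, lam K l x * val (g l) x := by
  have key : ∀ s ∈ w.support, ∃ g : Fin (d + 1) → Poly d, (∀ l, g l ∈ PolyLE d (k - 1)) ∧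
      ∀ x, val (MvPolynomial.monomial s (w.coeff s)) x = ∑ l, lam K l x * val (g l) x := by
    intro s hs
    have hdeg := sum_le_of_mem_support hw hs
    by_cases h0 : s = 0
    · refine ⟨fun _ => MvPolynomial.C (w.coeff s), fun l => C_mem_polyLE _ _, fun x => ?_⟩
      rw [← Finset.sum_mul, sum_lam, one_mul, h0]
      rfl
    · obtain ⟨j, hj⟩ := Finsupp.ne_iff.1 h0
      have hj : s j ≠ 0 := hj
      set m : Poly d := MvPolynomial.monomial (s - Finsupp.single j 1) (w.coeff s) with hm
      have hmdeg : m ∈ PolyLE d (k - 1) := by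
        refine monomial_mem_polyLE _ ?_
        have := sum_sub_single hj
        omega
      refine ⟨fun l => m * MvPolynomial.C (K.points l j), fun l => mul_C_mem_polyLE hmdeg _,
        fun x => ?_⟩
      have e1 : MvPolynomial.monomial s (w.coeff s) = m * MvPolynomial.X j := by
        rw [hm, MvPolynomial.X, MvPolynomial.monomial_mul, mul_one, tsub_add_cancel_of_le]
        rw [Finsupp.single_le_iff]
        omega
      have e2 : x j = ∑ l, lam K l x * K.points l j := by
        have := congrArg (fun y : Pt d => y j) (sum_lam_smul K x)
        simpa using this.symm
      rw [e1, val_mul, val_X]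
      conv_lhs => rw [e2]
      rw [Finset.mul_sum]
      refine Finset.sum_congr rfl fun l _ => ?_
      simp
      ring
  choose! g hg1 hg2 using key
  refine ⟨fun l => ∑ s ∈ w.support, g s l,
    fun l => Submodule.sum_mem _ fun s hs => hg1 s hs l, fun x => ?_⟩
  conv_lhs => rw [w.as_sum]
  rw [val_sum, Finset.sum_congr rfl fun s hs => hg2 s hs x, Finset.sum_comm]
  refine Finset.sum_congr rfl fun l _ => ?_
  rw [val_sum, Finset.mul_sum]

/-- Normal traces on a face can be prescribed arbitrarily, with vanishing normal traces on the
other faces. -/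
theorem exists_normal_lift (K : Elt d) {k : ℕ} (hk : 1 ≤ k) (i : Fin (d + 1)) {w : Poly d}
    (hw : w ∈ PolyLE d k) : ∃ q : Fin d → Poly d, (∀ j, q j ∈ PolyLE d k) ∧
      (∀ x ∈ face K i, ∑ j, val (q j) x * nrm K i j = val w x) ∧
      ∀ l ≠ i, ∀ x ∈ face K l, ∑ j, val (q j) x * nrm K l j = 0 := by
  obtain ⟨g, hg, hgw⟩ := exists_bary_decomposition K hk hw
  have hh := K.height_pos i
  refine ⟨fun j => ∑ l, bary K l * g l *
    MvPolynomial.C ((K.points l j - K.points i j) / K.height i), fun j => ?_, ?_, ?_⟩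
  · refine Submodule.sum_mem _ fun l _ => mul_C_mem_polyLE ?_ _
    exact mul_mem_polyLE (bary_mem_polyLE K l) (hg l) (by omega)
  all_goals
    have key : ∀ (m : Fin (d + 1)) (x : Pt d), ∑ j, val (∑ l, bary K l * g l *
        MvPolynomial.C ((K.points l j - K.points i j) / K.height i)) x * nrm K m j =
        ∑ l, lam K l x * val (g l) x / K.height i *
          (-K.height m * (lam K m (K.points l) - lam K m (K.points i))) := by
      intro m x
      simp only [val_sum, val_mul, val_C, Finset.sum_mul]
      rw [Finset.sum_comm]
      refine Finset.sum_congr rfl fun l _ => ?_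
      rw [← sum_sub_mul_nrm, Finset.mul_sum]
      refine Finset.sum_congr rfl fun j _ => ?_
      rw [lam]
      ring
  · intro x hx
    rw [mem_face_iff] at hx
    rw [key, hgw]
    refine Finset.sum_congr rfl fun l _ => ?_
    by_cases hl : i = l
    · subst hl
      simp [hx.1]
    · rw [lam_point_of_ne K hl, lam_point_self]
      field_simp
      ring
  · intro m hm x hx
    rw [mem_face_iff] at hx
    rw [key]
    refine Finset.sum_eq_zero fun l _ => ?_
    by_cases hl : m = l
    · subst hl
      simp [hx.1]
    · rw [lam_point_of_ne K hl, lam_point_of_ne K hm]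
      simp

/-- The derivative of `s` along the edge from `p_m` to `p_l`. -/
def edgeDeriv (K : Elt d) (s : Poly d) (l m : Fin (d + 1)) : Poly d :=
  ∑ j, MvPolynomial.pderiv j s * MvPolynomial.C (K.points l j - K.points m j)

/-- The edge bubble field that tests `∇s`. -/
def edgeBubble (K : Elt d) (s : Poly d) (j : Fin d) : Poly d :=
  ∑ l, ∑ m, bary K l * bary K m * edgeDeriv K s l m * MvPolynomial.C (K.points l j - K.points m j)

theorem edgeBubble_mem (K : Elt d) {k : ℕ} (hk : 2 ≤ k) {s : Poly d} (hs : s ∈ PolyLE d (k - 1))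
    (j : Fin d) : edgeBubble K s j ∈ PolyLE d k := by
  refine Submodule.sum_mem _ fun l _ => Submodule.sum_mem _ fun m _ => mul_C_mem_polyLE ?_ _
  refine mul_mem_polyLE (mul_mem_polyLE (bary_mem_polyLE K l) (bary_mem_polyLE K m) le_rfl)
    (n := k - 1 - 1) (Submodule.sum_mem _ fun c _ => mul_C_mem_polyLE (pderiv_mem_polyLE hs c) _) ?_
  omega

theorem edgeBubble_normal (K : Elt d) (s : Poly d) (i : Fin (d + 1)) {x : Pt d}
    (hx : x ∈ face K i) : ∑ j, val (edgeBubble K s j) x * nrm K i j = 0 := by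
  rw [mem_face_iff] at hx
  have key : ∑ j, val (edgeBubble K s j) x * nrm K i j =
      ∑ l, ∑ m, lam K l x * lam K m x * val (edgeDeriv K s l m) x *
        (-K.height i * (lam K i (K.points l) - lam K i (K.points m))) := by
    simp only [edgeBubble, val_sum, val_mul, val_C, Finset.sum_mul]
    rw [Finset.sum_comm]
    refine Finset.sum_congr rfl fun l _ => ?_
    rw [Finset.sum_comm]
    refine Finset.sum_congr rfl fun m _ => ?_
    rw [← sum_sub_mul_nrm, Finset.mul_sum]
    refine Finset.sum_congr rfl fun j _ => ?_
    simp only [lam]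
    ring
  rw [key]
  refine Finset.sum_eq_zero fun l _ => Finset.sum_eq_zero fun m _ => ?_
  by_cases hl : i = l
  · subst hl
    simp [hx.1]
  by_cases hm : i = m
  · subst hm
    simp [hx.1]
  rw [lam_point_of_ne K hl, lam_point_of_ne K hm]
  simp

theorem edgeBubble_mul_grad (K : Elt d) (s : Poly d) (x : Pt d) :
    ∑ j, val (edgeBubble K s j) x * val (MvPolynomial.pderiv j s) x =
      ∑ l, ∑ m, lam K l x * lam K m x * val (edgeDeriv K s l m) x ^ 2 := by
  simp only [edgeBubble, val_sum, val_mul, val_C, Finset.sum_mul]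
  rw [Finset.sum_comm]
  refine Finset.sum_congr rfl fun l _ => ?_
  rw [Finset.sum_comm]
  refine Finset.sum_congr rfl fun m _ => ?_
  have : val (edgeDeriv K s l m) x = ∑ j, val (MvPolynomial.pderiv j s) x *
      (K.points l j - K.points m j) := by simp [edgeDeriv]
  rw [sq, ← mul_assoc]
  nth_rw 3 [this]
  rw [Finset.mul_sum]
  refine Finset.sum_congr rfl fun j _ => ?_
  simp only [lam]
  ring

theorem pderiv_eq_zero_of_edgeDeriv (K : Elt d) (s : Poly d) {x : Pt d}
    (h : ∀ l m, val (edgeDeriv K s l m) x = 0) (j : Fin d) :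
    val (MvPolynomial.pderiv j s) x = 0 := by
  have h1 : ∑ i, nrm K i j / K.height i * val (edgeDeriv K s i 0) x = 0 := by simp [h]
  have h2 : ∑ i, nrm K i j / K.height i * val (edgeDeriv K s i 0) x =
      ∑ c, val (MvPolynomial.pderiv c s) x * ∑ i, (nrm K i j / K.height i * K.points i c -
        nrm K i j / K.height i * K.points 0 c) := by
    simp only [edgeDeriv, val_sum, val_mul, val_C, Finset.mul_sum]
    rw [Finset.sum_comm]
    refine Finset.sum_congr rfl fun c _ => Finset.sum_congr rfl fun i _ => ?_
    ring
  rw [h2] at h1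
  simp only [Finset.sum_sub_distrib, ← Finset.sum_mul, sum_nrm_div_height,
    sum_nrm_div_height_mul_points] at h1
  simpa using h1

theorem ae_lam_pos (K : Elt d) : ∀ᵐ x ∂(volume.restrict (body K)), ∀ i, 0 < lam K i x := by
  rw [ae_all_iff]
  intro i
  have h1 : ∀ᵐ x : Pt d, lam K i x ≠ 0 := by
    rw [ae_iff]
    simpa using volume_lam_eq K i 0
  filter_upwards [ae_restrict_mem (measurableSet_body K), ae_restrict_of_ae h1] with x hx h0
  exact lt_of_le_of_ne ((mem_body_iff K x).1 hx i) h0.symm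

/-- The space `P_k^*(K)` as a submodule. -/
def pStar (k : ℕ) (K : Elt d) : Submodule ℝ (Fin d → Poly d) where
  carrier := {w | MemPStar k K w}
  zero_mem' := ⟨fun j => Submodule.zero_mem _, by simp [pdiv], fun i x _ => by simp⟩
  add_mem' := by
    rintro a b ⟨h1, h2, h3⟩ ⟨h1', h2', h3'⟩
    refine ⟨fun j => Submodule.add_mem _ (h1 j) (h1' j), ?_, fun i x hx => ?_⟩
    · simp only [pdiv] at h2 h2' ⊢
      simp [Finset.sum_add_distrib, h2, h2']
    · simp [add_mul, Finset.sum_add_distrib, h3 i x hx, h3' i x hx]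
  smul_mem' := by
    rintro c a ⟨h1, h2, h3⟩
    refine ⟨fun j => Submodule.smul_mem _ _ (h1 j), ?_, fun i x hx => ?_⟩
    · simp only [pdiv] at h2 ⊢
      simp [← Finset.smul_sum, h2]
    · have := h3 i x hx
      simp only [Pi.smul_apply, val_smul, mul_assoc, ← Finset.mul_sum, this, mul_zero]

/-- The unknowns dual to the degrees of freedom. -/
abbrev BDMTest (k : ℕ) (K : Elt d) : Type :=
  (Fin (d + 1) → PolyLE d k) × PolyLE d (k - 1) × pStar k K

/-- The degrees of freedom of the field `u` with face normal traces `γ`, as a linear functional. -/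
def bdmData (k : ℕ) (K : Elt d) (u : Fin d → Pt d → ℝ) (γ : Fin (d + 1) → Pt d → ℝ)
    (hu : ∀ j, MemLp (u j) 2 (volume.restrict (body K)))
    (hγ : ∀ i, MemLp (γ i) 2 (surf (face K i))) : BDMTest k K →ₗ[ℝ] ℝ :=
  (∑ i, ((pairing _ (memLp_val_face K i) (γ i) (hγ i)).comp (PolyLE d k).subtype).comp
    (LinearMap.proj i)).comp (LinearMap.fst ℝ _ _) +
  ∑ j, (pairing _ (memLp_val_body K) (u j) (hu j)).comp
    ((MvPolynomial.pderiv j : Derivation ℝ (Poly d) (Poly d)).toLinearMap.comp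
      ((PolyLE d (k - 1)).subtype.comp ((LinearMap.fst ℝ _ _).comp (LinearMap.snd ℝ _ _))) +
    (LinearMap.proj j).comp ((pStar k K).subtype.comp
      ((LinearMap.snd ℝ _ _).comp (LinearMap.snd ℝ _ _))))

theorem bdmData_apply (k : ℕ) (K : Elt d) (u : Fin d → Pt d → ℝ) (γ : Fin (d + 1) → Pt d → ℝ)
    (hu : ∀ j, MemLp (u j) 2 (volume.restrict (body K)))
    (hγ : ∀ i, MemLp (γ i) 2 (surf (face K i))) (m : BDMTest k K) :
    bdmData k K u γ hu hγ m = (∑ i, ∫ x, γ i x * val (m.1 i : Poly d) x ∂(surf (face K i))) +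
      ∑ j, ((∫ x in body K, u j x * val (MvPolynomial.pderiv j (m.2.1 : Poly d)) x) +
        ∫ x in body K, u j x * val ((m.2.2 : Fin d → Poly d) j) x) := by
  simp [bdmData, map_add]
  rfl

theorem memLp_normal (K : Elt d) (i : Fin (d + 1)) {μ : Measure (Pt d)} {γ : Fin d → Pt d → ℝ}
    (hγ : ∀ j, MemLp (γ j) 2 μ) : MemLp (fun x => ∑ j, γ j x * nrm K i j) 2 μ :=
  memLp_finset_sum _ fun j _ => (hγ j).mul_const _

theorem bdmData_val (k : ℕ) (K : Elt d) (q : Fin d → Poly d) (m : BDMTest k K) :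
    bdmData k K (fun j => val (q j)) (fun i x => ∑ j, val (q j) x * nrm K i j)
      (fun j => memLp_val_body K _) (fun i => memLp_normal K i fun j => memLp_val_face K i _) m =
      (∑ i, ∑ j, nrm K i j * polyForm _ (memLp_val_face K i) (m.1 i) (q j)) +
      ∑ j, (polyForm _ (memLp_val_body K) (MvPolynomial.pderiv j (m.2.1 : Poly d)) (q j) +
        polyForm _ (memLp_val_body K) ((m.2.2 : Fin d → Poly d) j) (q j)) := by
  rw [bdmData_apply]
  congr 1
  refine Finset.sum_congr rfl fun i _ => ?_
  simp only [Finset.sum_mul]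
  rw [integral_finset_sum]
  · refine Finset.sum_congr rfl fun j _ => ?_
    change _ = nrm K i j * ∫ x, val (q j) x * val (m.1 i : Poly d) x ∂(surf (face K i))
    rw [← integral_const_mul]
    refine integral_congr_ae (Eventually.of_forall fun x => ?_)
    ring
  · intro j _
    exact integrable_fun_mul ((memLp_val_face K i _).mul_const _) (memLp_val_face K i _)

/-- The degrees of freedom of polynomial fields, as a bilinear form. -/
def bdmForm (k : ℕ) (K : Elt d) :
    BDMTest k K →ₗ[ℝ] Module.Dual ℝ (Fin d → PolyLE d k) :=
  LinearMap.mk₂ ℝ (fun m q => bdmData k K (fun j => val (q j : Poly d))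
      (fun i x => ∑ j, val (q j : Poly d) x * nrm K i j) (fun j => memLp_val_body K _)
      (fun i => memLp_normal K i fun j => memLp_val_face K i _) m)
    (fun m m' q => map_add _ m m')
    (fun a m q => map_smul _ a m)
    (fun m q q' => by
      simp only [bdmData_val, Pi.add_apply, Submodule.coe_add, map_add, mul_add,
        Finset.sum_add_distrib]
      ring)
    (fun a m q => by
      simp only [bdmData_val, Pi.smul_apply, Submodule.coe_smul, map_smul, smul_eq_mul, mul_add,
        Finset.mul_sum, Finset.sum_add_distrib]
      congr 1
      refine Finset.sum_congr rfl fun i _ => Finset.sum_congr rfl fun j _ => ?_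
      ring)

theorem bdmForm_apply (k : ℕ) (K : Elt d) (m : BDMTest k K) (q : Fin d → PolyLE d k) :
    bdmForm k K m q =
      (∑ i, ∫ x, (∑ j, val (q j : Poly d) x * nrm K i j) * val (m.1 i : Poly d) x
        ∂(surf (face K i))) +
      ∑ j, ((∫ x in body K, val (q j : Poly d) x *
          val (MvPolynomial.pderiv j (m.2.1 : Poly d)) x) +
        ∫ x in body K, val (q j : Poly d) x * val ((m.2.2 : Fin d → Poly d) j) x) :=
  bdmData_apply k K _ _ _ _ m

/-- Divergence-free fields without normal trace are orthogonal to gradients. -/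
theorem integral_pStar_mul_grad {k : ℕ} {K : Elt d} {z : Fin d → Poly d} (hz : MemPStar k K z)
    (s : Poly d) :
    ∑ j, ∫ x in body K, val (z j) x * val (MvPolynomial.pderiv j s) x = 0 := by
  have h1 : ∀ j, ∫ x in body K, val (z j) x * val (MvPolynomial.pderiv j s) x =
      (∑ i, nrm K i j * ∫ y, val (z j) y * val s y ∂(surf (face K i))) -
        ∫ x in body K, val (MvPolynomial.pderiv j (z j)) x * val s x := by
    intro j
    have h := integral_by_parts K j (smooth_val (z j)) (smooth_val s)
    simp only [pd_val] at h
    rw [integral_add (integrable_fun_mul (memLp_val_body K _) (memLp_val_body K _))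
      (integrable_fun_mul (memLp_val_body K _) (memLp_val_body K _))] at h
    linarith
  simp only [h1, Finset.sum_sub_distrib]
  rw [← integral_finset_sum _ fun j _ =>
    integrable_fun_mul (memLp_val_body K _) (memLp_val_body K _)]
  have h2 : ∀ x, ∑ j, val (MvPolynomial.pderiv j (z j)) x * val s x = 0 := by
    intro x
    rw [← Finset.sum_mul, ← val_sum]
    have := hz.2.1
    rw [pdiv] at this
    simp [this]
  simp only [h2, integral_zero, sub_zero]
  rw [Finset.sum_comm]
  refine Finset.sum_eq_zero fun i _ => ?_
  simp only [← integral_const_mul]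
  rw [← integral_finset_sum _ fun j _ =>
    (integrable_fun_mul (memLp_val_face K i _) (memLp_val_face K i _)).const_mul _]
  refine integral_eq_zero_of_ae ?_
  filter_upwards [ae_surf_mem K i] with x hx
  have := hz.2.2 i x hx
  have e : ∑ j, nrm K i j * (val (z j) x * val s x) =
      (∑ j, val (z j) x * nrm K i j) * val s x := by
    rw [Finset.sum_mul]
    exact Finset.sum_congr rfl fun j _ => by ring
  simp [e, this]

/-- The degrees of freedom determine their dual unknowns, as functions on `K` and its faces. -/
theorem ae_eq_zero_of_bdmForm_eq_zero {k : ℕ} (hk : 1 ≤ k) (K : Elt d) (m : BDMTest k K)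
    (h : bdmForm k K m = 0) :
    (∀ i, val (m.1 i : Poly d) =ᵐ[surf (face K i)] 0) ∧
    (∀ j, val (MvPolynomial.pderiv j (m.2.1 : Poly d)) =ᵐ[volume.restrict (body K)] 0) ∧
    ∀ j, val ((m.2.2 : Fin d → Poly d) j) =ᵐ[volume.restrict (body K)] 0 := by
  obtain ⟨w, s, z⟩ := m
  have hz := z.2
  have h' : ∀ q, bdmForm k K (w, s, z) q = 0 := fun q => LinearMap.congr_fun h q
  simp only [bdmForm_apply, Finset.sum_add_distrib] at h'
  -- the divergence-free part
  have hz0 : ∀ j, val ((z : Fin d → Poly d) j) =ᵐ[volume.restrict (body K)] 0 := by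
    have h1 := h' fun j => ⟨(z : Fin d → Poly d) j, hz.1 j⟩
    simp only at h1
    rw [integral_pStar_mul_grad hz] at h1
    have h2 : ∀ i, ∫ x, (∑ j, val ((z : Fin d → Poly d) j) x * nrm K i j) * val (w i : Poly d) x
        ∂(surf (face K i)) = 0 := by
      intro i
      refine integral_eq_zero_of_ae ?_
      filter_upwards [ae_surf_mem K i] with x hx
      simp [hz.2.2 i x hx]
    simp only [h2, Finset.sum_const_zero, zero_add] at h1
    rw [Finset.sum_eq_zero_iff_of_nonneg] at h1
    · exact fun j => ae_eq_zero_of_integral_sq (memLp_val_body K _) (h1 j (Finset.mem_univ j))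
    · exact fun j _ => integral_nonneg fun x => mul_self_nonneg _
  have hz1 : ∀ (q : Fin d → PolyLE d k) (j : Fin d),
      ∫ x in body K, val (q j : Poly d) x * val ((z : Fin d → Poly d) j) x = 0 := by
    intro q j
    refine integral_eq_zero_of_ae ?_
    filter_upwards [hz0 j] with x hx
    simp [hx]
  simp only [hz1, Finset.sum_const_zero, add_zero] at h'
  -- the gradient part
  have hs0 : ∀ j, val (MvPolynomial.pderiv j (s : Poly d)) =ᵐ[volume.restrict (body K)] 0 := by
    rcases Nat.lt_or_ge k 2 with hk2 | hk2
    · obtain rfl : k = 1 := by omega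
      intro j
      have hs : (s : Poly d) ∈ PolyLE d 0 := s.2
      have : MvPolynomial.pderiv j (s : Poly d) = 0 := by
        have h0 := MvPolynomial.totalDegree_eq_zero_iff_eq_C.1
          (Nat.le_zero.1 ((MvPolynomial.mem_restrictTotalDegree _ _ _).1 hs))
        rw [h0]
        simp
      rw [this]
      exact Eventually.of_forall fun x => by simp
    · have h1 := h' fun j => ⟨edgeBubble K s j, edgeBubble_mem K hk2 s.2 j⟩
      have h2 : ∀ i, ∫ x, (∑ j, val (edgeBubble K s j) x * nrm K i j) * val (w i : Poly d) x
          ∂(surf (face K i)) = 0 := by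
        intro i
        refine integral_eq_zero_of_ae ?_
        filter_upwards [ae_surf_mem K i] with x hx
        simp [edgeBubble_normal K s i hx]
      simp only [h2, Finset.sum_const_zero, zero_add] at h1
      rw [← integral_finset_sum _ fun j _ =>
        integrable_fun_mul (memLp_val_body K _) (memLp_val_body K _)] at h1
      simp only [edgeBubble_mul_grad] at h1
      have hnn : ∀ x ∈ body K, ∀ l m : Fin (d + 1),
          0 ≤ lam K l x * lam K m x * val (edgeDeriv K s l m) x ^ 2 := fun x hx l m =>
        mul_nonneg (mul_nonneg ((mem_body_iff K x).1 hx l) ((mem_body_iff K x).1 hx m)) (sq_nonneg _)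
      rw [integral_eq_zero_iff_of_nonneg_ae] at h1
      · have key : ∀ᵐ x ∂(volume.restrict (body K)), ∀ l m, val (edgeDeriv K s l m) x = 0 := by
          filter_upwards [h1, ae_lam_pos K, ae_restrict_mem (measurableSet_body K)] with x hx hp hb
          simp only [Pi.zero_apply] at hx
          rw [Finset.sum_eq_zero_iff_of_nonneg fun l _ =>
            Finset.sum_nonneg fun m _ => hnn x hb l m] at hx
          intro l m
          have h3 := hx l (Finset.mem_univ l)
          rw [Finset.sum_eq_zero_iff_of_nonneg fun m _ => hnn x hb l m] at h3
          have h4 := h3 m (Finset.mem_univ m)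
          have h5 : lam K l x * lam K m x ≠ 0 := mul_ne_zero (hp l).ne' (hp m).ne'
          simpa [h5] using h4
        intro j
        filter_upwards [key] with x hx
        exact pderiv_eq_zero_of_edgeDeriv K s hx j
      · filter_upwards [ae_restrict_mem (measurableSet_body K)] with x hb
        exact Finset.sum_nonneg fun l _ => Finset.sum_nonneg fun m _ => hnn x hb l m
      · simp only [← edgeBubble_mul_grad]
        exact integrable_finset_sum _ fun j _ =>
          integrable_fun_mul (memLp_val_body K _) (memLp_val_body K _)
  have hs1 : ∀ (q : Fin d → PolyLE d k) (j : Fin d),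
      ∫ x in body K, val (q j : Poly d) x * val (MvPolynomial.pderiv j (s : Poly d)) x = 0 := by
    intro q j
    refine integral_eq_zero_of_ae ?_
    filter_upwards [hs0 j] with x hx
    simp [hx]
  simp only [hs1, Finset.sum_const_zero, add_zero] at h'
  refine ⟨fun i => ?_, hs0, hz0⟩
  -- the face part
  obtain ⟨q, hq, hq1, hq2⟩ := exists_normal_lift K hk i (w i).2
  have h1 := h' fun j => ⟨q j, hq j⟩
  simp only at h1
  rw [Finset.sum_eq_single i] at h1
  · refine ae_eq_zero_of_integral_sq (memLp_val_face K i _) ?_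
    rw [← h1]
    refine integral_congr_ae ?_
    filter_upwards [ae_surf_mem K i] with x hx
    simp [hq1 x hx]
  · intro l _ hl
    refine integral_eq_zero_of_ae ?_
    filter_upwards [ae_surf_mem K l] with x hx
    simp [hq2 l hl x hx]
  · simp

theorem curl2_bubble_mem_pStar (hd : d = 2) {k : ℕ} (hk : 2 ≤ k) (K : Elt d) {s : Poly d}
    (hs : s ∈ PolyLE d (k - 2)) : MemPStar k K (curl2 (bubble K * s)) := by
  subst hd
  have e0 : curl2 (bubble K * s) 0 = MvPolynomial.pderiv 1 (bubble K * s) := by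
    simp [curl2, Fin.sum_univ_two]
  have e1 : curl2 (bubble K * s) 1 = -MvPolynomial.pderiv 0 (bubble K * s) := by
    simp [curl2, Fin.sum_univ_two]
  have hb : bubble K * s ∈ PolyLE 2 (k + 1) := by
    have : bubble K ∈ PolyLE 2 3 := by
      rw [bubble, Fin.prod_univ_three]
      exact mul_mem_polyLE (mul_mem_polyLE (bary_mem_polyLE K 0) (bary_mem_polyLE K 1) le_rfl)
        (bary_mem_polyLE K 2) le_rfl
    exact mul_mem_polyLE this hs (by omega)
  refine ⟨fun j => ?_, ?_, fun i x hx => ?_⟩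
  · fin_cases j
    · exact e0 ▸ pderiv_mem_polyLE hb 1
    · exact e1 ▸ Submodule.neg_mem _ (pderiv_mem_polyLE hb 0)
  · rw [pdiv, Fin.sum_univ_two, e0, e1, map_neg, pderiv_comm 0 1]
    ring
  · rw [mem_face_iff] at hx
    have hx0 : val (bary K i) x = 0 := hx.1
    obtain ⟨m, hm⟩ : ∃ m, bubble K * s = bary K i * m :=
      ⟨(∏ l ∈ Finset.univ.erase i, bary K l) * s, by
        rw [bubble, ← Finset.mul_prod_erase _ _ (Finset.mem_univ i), mul_assoc]⟩
    have hp : ∀ j, val (MvPolynomial.pderiv j (bubble K * s)) x =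
        -(nrm K i j) / K.height i * val m x := by
      intro j
      rw [hm, MvPolynomial.pderiv_mul, val_add, val_mul, val_mul, hx0, ← pd_val]
      have := pd_lam K i j x
      rw [show lam K i = val (bary K i) from rfl] at this
      rw [this]
      ring
    rw [Fin.sum_univ_two, e0, e1, val_neg, hp, hp]
    ring

/-- Existence of the Brezzi–Douglas–Marini projection. -/
theorem exists_isBDM {k : ℕ} (hk : 1 ≤ k) (K : Elt d) {u : Fin d → Pt d → ℝ}
    {γ : Fin (d + 1) → Fin d → Pt d → ℝ}
    (hu : ∀ j, MemLp (u j) 2 (volume.restrict (body K)))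
    (hγ : ∀ i j, MemLp (γ i j) 2 (surf (face K i))) : ∃ q, IsBDM k K u γ q := by
  obtain ⟨q, hq⟩ := exists_of_ker_le (bdmForm k K)
    (bdmData k K u (fun i x => ∑ j, γ i j x * nrm K i j) hu fun i => memLp_normal K i (hγ i))
    fun m hm => by
      obtain ⟨h1, h2, h3⟩ := ae_eq_zero_of_bdmForm_eq_zero hk K m hm
      rw [bdmData_apply]
      have e1 : ∀ i, ∫ x, (∑ j, γ i j x * nrm K i j) * val (m.1 i : Poly d) x
          ∂(surf (face K i)) = 0 := fun i => integral_eq_zero_of_ae <| by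
        filter_upwards [h1 i] with x hx
        simp [hx]
      have e2 : ∀ j, ∫ x in body K, u j x * val (MvPolynomial.pderiv j (m.2.1 : Poly d)) x = 0 :=
        fun j => integral_eq_zero_of_ae <| by
          filter_upwards [h2 j] with x hx
          simp [hx]
      have e3 : ∀ j, ∫ x in body K, u j x * val ((m.2.2 : Fin d → Poly d) j) x = 0 :=
        fun j => integral_eq_zero_of_ae <| by
          filter_upwards [h3 j] with x hx
          simp [hx]
      simp [e1, e2, e3]
  simp only [bdmForm_apply, bdmData_apply] at hq
  have hsum : ∀ (f : Fin d → Pt d → ℝ) (_ : ∀ j, MemLp (f j) 2 (volume.restrict (body K)))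
      (w : Fin d → Poly d), ∫ x in body K, ∑ j, f j x * val (w j) x =
        ∑ j, ∫ x in body K, f j x * val (w j) x := fun f hf w =>
    integral_finset_sum _ fun j _ => integrable_fun_mul (hf j) (memLp_val_body K _)
  have hstar : ∀ w, MemPStar k K w → ∫ x in body K, ∑ j, val (q j : Poly d) x * val (w j) x =
      ∫ x in body K, ∑ j, u j x * val (w j) x := by
    intro w hw
    rw [hsum _ (fun j => memLp_val_body K _), hsum _ hu]
    have := hq (0, 0, ⟨w, hw⟩)
    simpa using this
  refine ⟨fun j => q j, fun j => (q j).2, fun i w hw => ?_, fun s hs => ?_, fun h2 hk2 s hs => ?_,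
    fun _ => hstar⟩
  · have := hq (Pi.single i ⟨w, hw⟩, 0, 0)
    simp only [Submodule.coe_zero, map_zero, val_zero, mul_zero, integral_zero, add_zero,
      Finset.sum_const_zero, Pi.zero_apply] at this
    rw [Finset.sum_eq_single i, Finset.sum_eq_single i] at this
    · simpa using this
    · intro l _ hl
      simp [hl]
    · simp
    · intro l _ hl
      simp [hl]
    · simp
  · rw [hsum _ (fun j => memLp_val_body K _), hsum _ hu]
    have := hq (0, ⟨s, hs⟩, 0)
    simpa using this
  · exact hstar _ (curl2_bubble_mem_pStar h2 hk2 K hs)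

/-! ### Geometry of triangulations -/

theorem convex_lam_eq_zero (K : Elt d) (i : Fin (d + 1)) : Convex ℝ {x | lam K i x = 0} := by
  intro x hx y hy a b _ _ hab
  simp only [Set.mem_setOf_eq] at hx hy ⊢
  have e : a • x + b • y = x + b • (y - x) := by
    rw [← eq_sub_iff_add_eq] at hab
    rw [hab]
    module
  rw [e, lam_add_smul, hx, hy]
  ring

theorem lam_eq_sum_lam_mul (K K' : Elt d) (j : Fin (d + 1)) (x : Pt d) :
    lam K j x = ∑ l, lam K' l x * lam K j (K'.points l) := by
  conv_lhs => rw [← sum_lam_smul K' x]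
  exact lam_sum K j _ _ _ (sum_lam K' x)

theorem point_mem_face (K : Elt d) {i j : Fin (d + 1)} (h : j ≠ i) : K.points j ∈ face K i := by
  rw [mem_face_iff]
  refine ⟨lam_point_of_ne K h.symm, fun l => ?_⟩
  rw [lam_point]
  split_ifs <;> norm_num

theorem point_mem_body (K : Elt d) (j : Fin (d + 1)) : K.points j ∈ body K := by
  rw [mem_body_iff]
  intro l
  rw [lam_point]
  split_ifs <;> norm_num

theorem face_eq_convexHull (K : Elt d) (i : Fin (d + 1)) :
    face K i = convexHull ℝ (K.points '' {i}ᶜ) := by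
  apply Set.Subset.antisymm
  · intro x hx
    rw [mem_face_iff] at hx
    rw [← sum_lam_smul K x]
    have h1 : ∑ j, lam K j x • K.points j = ∑ j ∈ Finset.univ.erase i, lam K j x • K.points j := by
      rw [← Finset.add_sum_erase _ _ (Finset.mem_univ i), hx.1]
      simp
    have h2 : ∑ j ∈ Finset.univ.erase i, lam K j x = 1 := by
      rw [← sum_lam K x, ← Finset.add_sum_erase _ _ (Finset.mem_univ i), hx.1]
      simp
    rw [h1]
    refine (convex_convexHull ℝ _).sum_mem (fun j _ => hx.2 j) h2 fun j hj => ?_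
    exact subset_convexHull ℝ _ ⟨j, by simpa using hj, rfl⟩
  · refine convexHull_min ?_ ?_
    · rintro _ ⟨j, hj, rfl⟩
      exact point_mem_face K hj
    · have : face K i = body K ∩ {x | lam K i x = 0} := by
        ext x
        simp only [mem_face_iff, Set.mem_inter_iff, mem_body_iff, Set.mem_setOf_eq, and_comm]
      rw [this]
      exact (convex_body K).inter (convex_lam_eq_zero K i)

/-- Two distinct simplices that meet in the convex hull of their common vertices. -/
def Conform (K K' : Elt d) : Prop :=
  Set.range K.points ≠ Set.range K'.points ∧
    body K ∩ body K' = convexHull ℝ (Set.range K.points ∩ Set.range K'.points)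

theorem Conform.symm {K K' : Elt d} (h : Conform K K') : Conform K' K :=
  ⟨h.1.symm, by rw [Set.inter_comm, h.2, Set.inter_comm]⟩

theorem Conform.point_mem_range {K K' : Elt d} (h : Conform K K') {x : Pt d} (hx : x ∈ body K)
    (hx' : x ∈ body K') {j : Fin (d + 1)} (hj : lam K j x ≠ 0) :
    K.points j ∈ Set.range K'.points := by
  by_contra hcon
  have hmem : x ∈ convexHull ℝ (Set.range K.points ∩ Set.range K'.points) := by
    rw [← h.2]
    exact ⟨hx, hx'⟩
  refine hj (convexHull_min (t := {x | lam K j x = 0}) ?_ (convex_lam_eq_zero K j) hmem)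
  rintro _ ⟨⟨l, rfl⟩, hl⟩
  refine lam_point_of_ne K ?_
  rintro rfl
  exact hcon hl

theorem range_eq_of_subset {K K' : Elt d} (h : Set.range K.points ⊆ Set.range K'.points) :
    Set.range K.points = Set.range K'.points := by
  refine Set.eq_of_subset_of_ncard_le h ?_ (Set.finite_range _)
  rw [← Set.image_univ, ← Set.image_univ, Set.ncard_image_of_injective _ K.independent.injective,
    Set.ncard_image_of_injective _ K'.independent.injective]

theorem Conform.exists_notMem {K K' : Elt d} (h : Conform K K') :
    ∃ i, K.points i ∉ Set.range K'.points := by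
  by_contra! hcon
  refine h.1 (range_eq_of_subset ?_)
  rintro _ ⟨i, rfl⟩
  exact hcon i

theorem Conform.volume_inter {K K' : Elt d} (h : Conform K K') :
    volume (body K ∩ body K') = 0 := by
  obtain ⟨i, hi⟩ := h.exists_notMem
  refine measure_mono_null ?_ (volume_lam_eq K i 0)
  intro x hx
  by_contra hcon
  exact hi (h.point_mem_range hx.1 hx.2 hcon)

/-- Two simplices on opposite sides of a common face. -/
structure Adjacent (K : Elt d) (i : Fin (d + 1)) (K' : Elt d) (i' : Fin (d + 1)) (a : ℝ) : Prop where
  pos : 0 < a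
  face_eq : face K i = face K' i'
  lam_eq : ∀ x, lam K i x = -a * lam K' i' x
  nrm_eq : nrm K i = -nrm K' i'
  exists_left : ∀ l ≠ i', ∃ j ≠ i, ∀ x,
    lam K j x = lam K' l x + lam K j (K'.points i') * lam K' i' x
  exists_right : ∀ j ≠ i, ∃ l ≠ i', ∀ x,
    lam K j x = lam K' l x + lam K j (K'.points i') * lam K' i' x

theorem exists_relint_face (K : Elt d) (i : Fin (d + 1)) :
    ∃ b, lam K i b = 0 ∧ ∀ j ≠ i, 0 < lam K j b := by
  have hd : (0 : ℝ) < d := by exact_mod_cast Nat.pos_of_ne_zero (NeZero.ne d)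
  have hw : ∑ j : Fin (d + 1), (if j = i then 0 else 1 / (d : ℝ)) = 1 := by
    rw [← Finset.add_sum_erase _ _ (Finset.mem_univ i)]
    rw [Finset.sum_congr rfl fun j hj => if_neg (Finset.ne_of_mem_erase hj)]
    simp
  refine ⟨∑ j, (if j = i then 0 else 1 / (d : ℝ)) • K.points j, ?_, fun j hj => ?_⟩
  · rw [lam_sum_smul_points K i (fun j => if j = i then 0 else 1 / (d : ℝ)) hw]
    simp
  · rw [lam_sum_smul_points K j (fun j => if j = i then 0 else 1 / (d : ℝ)) hw]
    simp [hj, hd]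

theorem Conform.adjacent {K K' : Elt d} (h : Conform K K') {i i' : Fin (d + 1)}
    (hF : face K i = face K' i') : ∃ a, Adjacent K i K' i' a := by
  have hL : ∀ j ≠ i, ∃ l ≠ i', K.points j = K'.points l := by
    intro j hj
    have h1 : K.points j ∈ face K' i' := hF ▸ point_mem_face K hj
    obtain ⟨l, hl⟩ := h.point_mem_range (j := j) (face_subset_body K i (point_mem_face K hj))
      (face_subset_body K' i' h1) (by rw [lam_point_self]; norm_num)
    refine ⟨l, ?_, hl.symm⟩
    rintro rfl
    rw [mem_face_iff, ← hl, lam_point_self] at h1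
    exact one_ne_zero h1.1
  have hR : ∀ l ≠ i', ∃ j ≠ i, K.points j = K'.points l := by
    intro l hl
    have h1 : K'.points l ∈ face K i := hF ▸ point_mem_face K' hl
    obtain ⟨j, hj⟩ := h.symm.point_mem_range (j := l)
      (face_subset_body K' i' (point_mem_face K' hl))
      (face_subset_body K i h1) (by rw [lam_point_self]; norm_num)
    refine ⟨j, ?_, hj⟩
    rintro rfl
    rw [mem_face_iff, ← hj, lam_point_self] at h1
    exact one_ne_zero h1.1
  have hi0 : K.points i ∉ Set.range K'.points := by
    intro hcon
    refine h.1 (range_eq_of_subset ?_)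
    rintro _ ⟨j, rfl⟩
    by_cases hj : j = i
    · exact hj ▸ hcon
    · obtain ⟨l, -, hl⟩ := hL j hj
      exact ⟨l, hl.symm⟩
  have hi0' : K'.points i' ∉ Set.range K.points := by
    rintro ⟨j, hj⟩
    by_cases hji : j = i
    · exact hi0 ⟨i', by rw [← hj, hji]⟩
    · obtain ⟨l, hl, hl'⟩ := hL j hji
      exact hl (K'.independent.injective (hl'.symm.trans hj))
  have hlam : ∀ x, lam K i x = lam K i (K'.points i') * lam K' i' x := by
    intro x
    rw [lam_eq_sum_lam_mul K K', Finset.sum_eq_single i', mul_comm]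
    · intro l _ hl
      obtain ⟨j, hj, hj'⟩ := hR l hl
      rw [← hj', lam_point_of_ne K hj.symm, mul_zero]
    · simp
  have hneg : lam K i (K'.points i') < 0 := by
    by_contra! hcon
    obtain ⟨b, hb0, hb⟩ := exists_relint_face K i
    have hbF : b ∈ face K' i' := by
      rw [← hF, mem_face_iff]
      refine ⟨hb0, fun j => ?_⟩
      by_cases hj : j = i
      · rw [hj, hb0]
      · exact (hb j hj).le
    have hev : ∀ᶠ s in 𝓝[>] (0 : ℝ), ∀ j, 0 ≤ lam K j (b + s • (K'.points i' - b)) := by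
      rw [eventually_all]
      intro j
      by_cases hj : j = i
      · filter_upwards [self_mem_nhdsWithin] with s hs
        rw [lam_add_smul, hj, hb0, mul_zero, zero_add]
        exact mul_nonneg (le_of_lt hs) hcon
      · have hc : Continuous fun s : ℝ => lam K j (b + s • (K'.points i' - b)) :=
          (continuous_lam K j).comp (by fun_prop)
        have := hc.tendsto 0
        simp only [zero_smul, add_zero] at this
        filter_upwards [(this.mono_left nhdsWithin_le_nhds).eventually (lt_mem_nhds (hb j hj))]
          with s hs using hs.le
    obtain ⟨s, ⟨hs0, hs1⟩, hs⟩ :=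
      ((eventually_of_mem (Ioo_mem_nhdsGT (zero_lt_one' ℝ)) fun _ h => h).and hev).exists
    have h1 : b + s • (K'.points i' - b) ∈ body K := (mem_body_iff K _).2 hs
    have h2 : b + s • (K'.points i' - b) ∈ body K' :=
      (convex_body K').add_smul_sub_mem (face_subset_body _ _ hbF) (point_mem_body K' i')
        ⟨hs0.le, hs1.le⟩
    refine hi0' (h.symm.point_mem_range (j := i') h2 h1 ?_)
    rw [lam_add_smul, ((mem_face_iff _ _ _).1 hbF).1, lam_point_self]
    simp [hs0.ne']
  have hexp : ∀ j ≠ i, ∀ l ≠ i', K.points j = K'.points l → ∀ x,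
      lam K j x = lam K' l x + lam K j (K'.points i') * lam K' i' x := by
    intro j hj l hl hjl x
    rw [lam_eq_sum_lam_mul K K', ← Finset.add_sum_erase _ _ (Finset.mem_univ i'),
      Finset.sum_eq_single l]
    · rw [← hjl, lam_point_self]
      ring
    · intro m hm hml
      obtain ⟨j', hj', hjm⟩ := hR m (Finset.ne_of_mem_erase hm)
      rw [← hjm, lam_point_of_ne K, mul_zero]
      rintro rfl
      exact hml (K'.independent.injective (hjm.symm.trans hjl))
    · intro hm
      exact absurd (Finset.mem_erase.2 ⟨hl, Finset.mem_univ l⟩) hm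
  refine ⟨-lam K i (K'.points i'), neg_pos.2 hneg, hF, fun x => by rw [neg_neg]; exact hlam x,
    ?_, fun l hl => ?_, fun j hj => ?_⟩
  · have hpd : ∀ c, nrm K i c / K.height i =
        lam K i (K'.points i') * (nrm K' i' c / K'.height i') := by
      intro c
      have h1 := lam_add_single K i c 0
      have h2 := lam_add_single K' i' c 0
      have h3 := hlam (0 + EuclideanSpace.single c 1)
      have h4 := hlam 0
      rw [h1, h2, h4] at h3
      linarith
    have hh := K.height_pos i
    have hh' := K'.height_pos i'
    set t := -(lam K i (K'.points i')) * K.height i / K'.height i' with ht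
    have htpos : 0 < t := div_pos (mul_pos (neg_pos.2 hneg) hh) hh'
    have hv : nrm K i = -(t • nrm K' i') := by
      ext c
      have := hpd c
      simp only [PiLp.neg_apply, PiLp.smul_apply, smul_eq_mul, ht]
      field_simp at this ⊢
      linarith
    have hn := norm_nrm K i
    rw [hv, norm_neg, norm_smul, norm_nrm, mul_one, Real.norm_of_nonneg htpos.le] at hn
    rw [hv, hn, one_smul]
  · obtain ⟨j, hj, hjl⟩ := hR l hl
    exact ⟨j, hj, hexp j hj l hl hjl⟩
  · obtain ⟨l, hl, hjl⟩ := hL j hj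
    exact ⟨l, hl, hexp j hj l hl hjl⟩

theorem face_injective (K : Elt d) {i i' : Fin (d + 1)} (h : face K i = face K i') : i = i' := by
  by_contra hne
  have h1 : K.points i ∈ face K i := h ▸ point_mem_face K hne
  rw [mem_face_iff, lam_point_self] at h1
  exact one_ne_zero h1.1

/-- Two conforming simplices whose intersection contains a relative interior point of a face of one
of them share that face. -/
theorem Conform.exists_face_eq {K K' : Elt d} (h : Conform K K') {i : Fin (d + 1)} {y : Pt d}
    (hy : y ∈ body K') (hy0 : lam K i y = 0) (hyp : ∀ j ≠ i, 0 < lam K j y) :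
    ∃ i', face K i = face K' i' := by
  have hyK : y ∈ body K := by
    rw [mem_body_iff]
    intro j
    by_cases hj : j = i
    · rw [hj, hy0]
    · exact (hyp j hj).le
  have hsub : K.points '' {i}ᶜ ⊆ Set.range K'.points := by
    rintro _ ⟨j, hj, rfl⟩
    exact h.point_mem_range hyK hy (hyp j hj).ne'
  have hc1 : (K.points '' {i}ᶜ).ncard = d := by
    rw [Set.ncard_image_of_injective _ K.independent.injective, Set.ncard_compl, Set.ncard_singleton]
    simp
  have hc2 : (Set.range K'.points).ncard = d + 1 := by
    rw [← Set.image_univ, Set.ncard_image_of_injective _ K'.independent.injective]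
    simp
  have hc3 : (Set.range K'.points \ K.points '' {i}ᶜ).ncard = 1 := by
    rw [Set.ncard_sdiff hsub ((Set.toFinite _)), hc1, hc2]
    omega
  obtain ⟨z, hz⟩ := Set.ncard_eq_one.1 hc3
  have hz' : z ∈ Set.range K'.points \ K.points '' {i}ᶜ := hz ▸ rfl
  obtain ⟨⟨i', rfl⟩, hz2⟩ := hz'
  refine ⟨i', ?_⟩
  rw [face_eq_convexHull, face_eq_convexHull]
  congr 1
  apply Set.Subset.antisymm
  · intro x hx
    obtain ⟨l, rfl⟩ := hsub hx
    refine ⟨l, ?_, rfl⟩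
    rintro rfl
    exact hz2 hx
  · rintro _ ⟨l, hl, rfl⟩
    by_contra hcon
    have : K'.points l ∈ Set.range K'.points \ K.points '' {i}ᶜ := ⟨⟨l, rfl⟩, hcon⟩
    rw [hz] at this
    exact hl (K'.independent.injective this)

namespace Triangulation

variable {Ω : Set (Pt d)} {ι : Type*}

theorem conform (𝒯 : Triangulation Ω ι) {s t : ι} (h : s ≠ t) :
    Conform (𝒯.elt s) (𝒯.elt t) := ⟨𝒯.distinct s t h, 𝒯.conforming s t⟩

theorem isOpen (𝒯 : Triangulation Ω ι) : IsOpen Ω := by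
  rw [𝒯.cover]
  exact isOpen_interior

theorem interior_body_subset (𝒯 : Triangulation Ω ι) (t : ι) :
    interior (body (𝒯.elt t)) ⊆ Ω := by
  conv_rhs => rw [𝒯.cover]
  exact interior_mono (Set.subset_iUnion (fun t => body (𝒯.elt t)) t)

theorem adjacent (𝒯 : Triangulation Ω ι) {t t' : ι} {i i' : Fin (d + 1)}
    (hne : (t, i) ≠ (t', i')) (h : face (𝒯.elt t) i = face (𝒯.elt t') i') :
    ∃ a, Adjacent (𝒯.elt t) i (𝒯.elt t') i' a := by
  refine (𝒯.conform ?_).adjacent h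
  rintro rfl
  exact hne (by rw [face_injective _ h])

/-- A face belongs to at most two elements. -/
theorem eq_of_face_eq (𝒯 : Triangulation Ω ι) {x y z : ι × Fin (d + 1)} (hxy : x ≠ y) (hxz : x ≠ z)
    (h : face (𝒯.elt x.1) x.2 = face (𝒯.elt y.1) y.2)
    (h' : face (𝒯.elt x.1) x.2 = face (𝒯.elt z.1) z.2) : y = z := by
  by_contra hyz
  obtain ⟨a, ha⟩ := 𝒯.adjacent hxy h
  obtain ⟨b, hb⟩ := 𝒯.adjacent hxz h'
  obtain ⟨c, hc⟩ := 𝒯.adjacent hyz (h.symm.trans h')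
  have h1 := ha.lam_eq ((𝒯.elt z.1).points z.2)
  have h2 := hb.lam_eq ((𝒯.elt z.1).points z.2)
  have h3 := hc.lam_eq ((𝒯.elt z.1).points z.2)
  rw [lam_point_self] at h2 h3
  have ha0 := ha.pos
  have hb0 := hb.pos
  have hc0 := hc.pos
  rw [h2, h3] at h1
  nlinarith [mul_pos ha0 hc0]

variable [Fintype ι]

theorem body_subset_closure (𝒯 : Triangulation Ω ι) (t : ι) : body (𝒯.elt t) ⊆ closure Ω := by
  have h := (convex_body (𝒯.elt t)).closure_interior_eq_closure_of_nonempty_interior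
    (exists_mem_interior_body (𝒯.elt t))
  exact (subset_closure.trans h.symm.subset).trans (closure_mono (𝒯.interior_body_subset t))

/-- A face that belongs to only one element lies on the boundary. -/
theorem face_subset_frontier (𝒯 : Triangulation Ω ι) {t : ι} {i : Fin (d + 1)}
    (h : ∀ t' i', face (𝒯.elt t) i = face (𝒯.elt t') i' → (t', i') = (t, i)) :
    face (𝒯.elt t) i ⊆ frontier Ω := by
  set K := 𝒯.elt t with hK
  intro x hx
  rw [𝒯.isOpen.frontier_eq]
  refine ⟨𝒯.body_subset_closure t (face_subset_body K i hx), fun hxΩ => ?_⟩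
  rw [mem_face_iff] at hx
  -- a relative interior point of the face in `Ω`
  obtain ⟨b, hb0, hb⟩ := exists_relint_face K i
  have hc : Continuous fun s : ℝ => x + s • (b - x) := by fun_prop
  have hev : ∀ᶠ s in 𝓝[>] (0 : ℝ), x + s • (b - x) ∈ Ω := by
    have := hc.tendsto 0
    simp only [zero_smul, add_zero] at this
    exact (this.mono_left nhdsWithin_le_nhds).eventually (𝒯.isOpen.mem_nhds hxΩ)
  obtain ⟨s, ⟨hs0, hs1⟩, hs⟩ :=
    ((eventually_of_mem (Ioo_mem_nhdsGT (zero_lt_one' ℝ)) fun _ h => h).and hev).exists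
  set y := x + s • (b - x) with hy
  have hy0 : lam K i y = 0 := by rw [hy, lam_add_smul, hx.1, hb0]; ring
  have hyp : ∀ j ≠ i, 0 < lam K j y := by
    intro j hj
    rw [hy, lam_add_smul]
    exact add_pos_of_nonneg_of_pos (mul_nonneg (by linarith) (hx.2 j)) (mul_pos hs0 (hb j hj))
  -- points beyond the face
  have hc' : Continuous fun r : ℝ => y + r • (K.points i - y) := by fun_prop
  have hev' : ∀ᶠ r in 𝓝[<] (0 : ℝ), ∃ t', y + r • (K.points i - y) ∈ body (𝒯.elt t') := by
    have := hc'.tendsto 0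
    simp only [zero_smul, add_zero] at this
    filter_upwards [(this.mono_left nhdsWithin_le_nhds).eventually (𝒯.isOpen.mem_nhds hs)]
      with r hr
    rw [𝒯.cover] at hr
    simpa using interior_subset hr
  have hfr : ∃ t', ∃ᶠ r in 𝓝[<] (0 : ℝ), y + r • (K.points i - y) ∈ body (𝒯.elt t') := by
    by_contra! hcon
    have h1 : ∀ᶠ r in 𝓝[<] (0 : ℝ), ∀ t', y + r • (K.points i - y) ∉ body (𝒯.elt t') :=
      eventually_all.2 fun t' => hcon t'
    obtain ⟨r, ⟨t', h2⟩, h3⟩ := (hev'.and h1).exists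
    exact h3 t' h2
  obtain ⟨t', ht'⟩ := hfr
  have hyt' : y ∈ body (𝒯.elt t') := by
    have h1 : Tendsto (fun r : ℝ => y + r • (K.points i - y)) (𝓝[<] 0) (𝓝 y) := by
      have := hc'.tendsto 0
      simp only [zero_smul, add_zero] at this
      exact this.mono_left nhdsWithin_le_nhds
    exact (isCompact_body _).isClosed.mem_of_frequently_of_tendsto ht' h1
  have hne : t ≠ t' := by
    rintro rfl
    obtain ⟨r, h1, h2⟩ := (ht'.and_eventually self_mem_nhdsWithin).exists
    have h3 := (mem_body_iff _ _).1 h1 i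
    have h2 : r < 0 := h2
    rw [← hK, lam_add_smul, hy0, lam_point_self] at h3
    linarith
  obtain ⟨i', hi'⟩ := (𝒯.conform hne).exists_face_eq hyt' hy0 hyp
  exact hne (congrArg Prod.fst (h t' i' hi')).symm

/-- Sums over all faces of all elements of terms that vanish on boundary faces and cancel on
interior faces. -/
theorem sum_faces_eq_zero (𝒯 : Triangulation Ω ι) (A : ι → Fin (d + 1) → ℝ)
    (hb : ∀ t i, face (𝒯.elt t) i ⊆ frontier Ω →
      (∀ t' i', face (𝒯.elt t) i = face (𝒯.elt t') i' → (t', i') = (t, i)) → A t i = 0)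
    (hi : ∀ t i t' i', (t, i) ≠ (t', i') → face (𝒯.elt t) i = face (𝒯.elt t') i' →
      A t i + A t' i' = 0) : ∑ t, ∑ i, A t i = 0 := by
  classical
  rw [← Fintype.sum_prod_type']
  let P : ι × Fin (d + 1) → ι × Fin (d + 1) → Prop := fun x y =>
    x ≠ y ∧ face (𝒯.elt x.1) x.2 = face (𝒯.elt y.1) y.2
  let g : ι × Fin (d + 1) → ι × Fin (d + 1) := fun x => if h : ∃ y, P x y then h.choose else x
  have hg : ∀ x, (∃ y, P x y) → P x (g x) := by
    intro x hx
    simp only [g, dif_pos hx]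
    exact hx.choose_spec
  have hz : ∀ x, (¬∃ y, P x y) → A x.1 x.2 = 0 := by
    intro x hx
    have : ∀ t' i', face (𝒯.elt x.1) x.2 = face (𝒯.elt t') i' → (t', i') = (x.1, x.2) := by
      intro t' i' he
      by_contra hcon
      exact hx ⟨(t', i'), fun e => hcon e.symm, he⟩
    exact hb x.1 x.2 (𝒯.face_subset_frontier this) this
  refine Finset.sum_involution (fun x _ => g x) ?_ ?_ (fun _ _ => Finset.mem_univ _) ?_
  · intro x _
    by_cases hx : ∃ y, P x y
    · exact hi _ _ _ _ (hg x hx).1 (hg x hx).2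
    · have : g x = x := dif_neg hx
      simp [this, hz x hx]
  · intro x _ hAx
    by_cases hx : ∃ y, P x y
    · exact (hg x hx).1.symm
    · exact absurd (hz x hx) hAx
  · intro x _
    by_cases hx : ∃ y, P x y
    · have h1 := hg x hx
      have hx' : ∃ y, P (g x) y := ⟨x, h1.1.symm, h1.2.symm⟩
      have h2 := hg (g x) hx'
      exact 𝒯.eq_of_face_eq h2.1 h1.1.symm h2.2 h1.2.symm
    · have : g x = x := dif_neg hx
      simp [this]

theorem restrict_eq_sum (𝒯 : Triangulation Ω ι) :
    volume.restrict Ω = ∑ t, volume.restrict (body (𝒯.elt t)) := by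
  have h1 : (Ω : Set (Pt d)) =ᵐ[volume] ⋃ t, body (𝒯.elt t) := by
    have hsub : Ω ⊆ ⋃ t, body (𝒯.elt t) := by
      conv_lhs => rw [𝒯.cover]
      exact interior_subset
    refine (hsub.eventuallyLE).antisymm ?_
    rw [ae_le_set]
    refine measure_mono_null (t := ⋃ t, body (𝒯.elt t) \ interior (body (𝒯.elt t))) ?_ ?_
    · rintro x ⟨hx, hx'⟩
      obtain ⟨t, ht⟩ := Set.mem_iUnion.1 hx
      exact Set.mem_iUnion.2 ⟨t, ht, fun h => hx' (𝒯.interior_body_subset t h)⟩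
    · rw [measure_iUnion_null_iff]
      intro t
      have := congrArg (fun μ => μ ((interior (body (𝒯.elt t)))ᶜ)) (restrict_interior_body (𝒯.elt t))
      rw [Measure.restrict_apply isOpen_interior.measurableSet.compl,
        Measure.restrict_apply isOpen_interior.measurableSet.compl, Set.compl_inter_self,
        measure_empty] at this
      rw [Set.diff_eq, Set.inter_comm]
      exact this.symm
  rw [Measure.restrict_congr_set h1, Measure.restrict_iUnion_ae, Measure.sum_fintype]
  · intro s t hst
    exact (𝒯.conform hst).volume_inter
  · exact fun t => (measurableSet_body _).nullMeasurableSet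

theorem restrict_body_le (𝒯 : Triangulation Ω ι) (t : ι) :
    volume.restrict (body (𝒯.elt t)) ≤ volume.restrict Ω := by
  rw [← restrict_interior_body]
  exact Measure.restrict_mono (𝒯.interior_body_subset t) le_rfl

theorem integral_eq_sum (𝒯 : Triangulation Ω ι) {f : Pt d → ℝ}
    (hf : ∀ t, IntegrableOn f (body (𝒯.elt t))) :
    ∫ x in Ω, f x = ∑ t, ∫ x in body (𝒯.elt t), f x := by
  rw [𝒯.restrict_eq_sum]
  exact integral_finset_sum_measure fun t _ => hf t

theorem memL2_body (𝒯 : Triangulation Ω ι) {f : Pt d → ℝ} (hf : MemL2 Ω f) (t : ι) :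
    MemLp f 2 (volume.restrict (body (𝒯.elt t))) := hf.mono_measure (𝒯.restrict_body_le t)

theorem glue_ae_eq (𝒯 : Triangulation Ω ι) (q : ι → Poly d) (t : ι) :
    𝒯.glue q =ᵐ[volume.restrict (body (𝒯.elt t))] val (q t) := by
  classical
  rw [← restrict_interior_body]
  filter_upwards [ae_restrict_mem isOpen_interior.measurableSet,
    ae_restrict_of_ae ((ae_all_iff (ι := ι)).2 fun s => (show ∀ᵐ x : Pt d, s ≠ t →
      x ∉ body (𝒯.elt s) ∩ body (𝒯.elt t) from by
        by_cases hst : s = t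
        · simp [hst]
        · simpa [hst, ae_iff] using (𝒯.conform hst).volume_inter))] with x hx hn
  rw [glue, Finset.sum_eq_single t]
  · simp [hx]
  · intro s _ hs
    rw [Set.indicator_of_notMem]
    exact fun h => hn s hs ⟨interior_subset h, interior_subset hx⟩
  · simp

end Triangulation

/-! ### Cutoff functions near a face -/

/-- A sequence of cutoff functions that vanish on all faces of `K` but the `i`-th one, tend to `1`
there, and whose gradients are controlled uniformly. -/
structure IsCutoff (K : Elt d) (i : Fin (d + 1)) (χ : ℕ → Pt d → ℝ) : Prop where
  smooth : ∀ n, Smooth (χ n)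
  nonneg : ∀ n x, 0 ≤ χ n x
  le_one : ∀ n x, χ n x ≤ 1
  zero : ∀ n, ∀ l ≠ i, ∀ x ∈ face K l, χ n x = 0
  tendsto : ∀ᵐ x ∂(surf (face K i)), Tendsto (fun n => χ n x) atTop (𝓝 1)
  bound : ∃ C : ℝ, 0 ≤ C ∧ ∀ n c x, (∀ l, 0 < lam K l x) →
    |pd c (χ n) x| ≤ C * ∑ l ∈ Finset.univ.erase i, (√(lam K i x * lam K l x))⁻¹

/-- The regularized distance to the hyperplane of the `i`-th face. -/
def rad (K : Elt d) (i : Fin (d + 1)) (M δ : ℝ) (x : Pt d) : ℝ :=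
  √((M * lam K i x) ^ 2 + δ ^ 2)

/-- One factor of the cutoff function. -/
def cutoffFactor (K : Elt d) (i : Fin (d + 1)) (M δ : ℝ) (j : Fin (d + 1)) (x : Pt d) : ℝ :=
  Real.smoothTransition (lam K j x * (rad K i M δ x)⁻¹ - 1)

/-- The cutoff function near the `i`-th face. -/
def cutoff (K : Elt d) (i : Fin (d + 1)) (M δ : ℝ) (x : Pt d) : ℝ :=
  ∏ j ∈ Finset.univ.erase i, cutoffFactor K i M δ j x

theorem rad_sq_pos (K : Elt d) (i : Fin (d + 1)) (M : ℝ) {δ : ℝ} (hδ : 0 < δ) (x : Pt d) :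
    0 < (M * lam K i x) ^ 2 + δ ^ 2 := add_pos_of_nonneg_of_pos (sq_nonneg _) (pow_pos hδ 2)

theorem rad_pos (K : Elt d) (i : Fin (d + 1)) (M : ℝ) {δ : ℝ} (hδ : 0 < δ) (x : Pt d) :
    0 < rad K i M δ x := Real.sqrt_pos.2 (rad_sq_pos K i M hδ x)

theorem abs_le_rad (K : Elt d) (i : Fin (d + 1)) (M δ : ℝ) (x : Pt d) :
    |M * lam K i x| ≤ rad K i M δ x :=
  Real.abs_le_sqrt (le_add_of_nonneg_right (sq_nonneg δ))

theorem smooth_rad (K : Elt d) (i : Fin (d + 1)) (M : ℝ) {δ : ℝ} (hδ : 0 < δ) :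
    Smooth (rad K i M δ) :=
  (((contDiff_const.mul (contDiff_lam K i)).pow 2).add contDiff_const).sqrt fun x =>
    (rad_sq_pos K i M hδ x).ne'

theorem smooth_rad_inv (K : Elt d) (i : Fin (d + 1)) (M : ℝ) {δ : ℝ} (hδ : 0 < δ) :
    Smooth fun x => (rad K i M δ x)⁻¹ :=
  (smooth_rad K i M hδ).inv fun x => (rad_pos K i M hδ x).ne'

theorem smooth_cutoffFactor (K : Elt d) (i : Fin (d + 1)) (M : ℝ) {δ : ℝ} (hδ : 0 < δ)
    (j : Fin (d + 1)) : Smooth (cutoffFactor K i M δ j) :=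
  Real.smoothTransition.contDiff.comp
    (((contDiff_lam K j).mul (smooth_rad_inv K i M hδ)).sub contDiff_const)

theorem smooth_finset_prod {κ : Type*} (s : Finset κ) {φ : κ → Pt d → ℝ} (h : ∀ j, Smooth (φ j)) :
    Smooth fun x => ∏ j ∈ s, φ j x := contDiff_prod fun j _ => h j

theorem smooth_cutoff (K : Elt d) (i : Fin (d + 1)) (M : ℝ) {δ : ℝ} (hδ : 0 < δ) :
    Smooth (cutoff K i M δ) := smooth_finset_prod _ fun j => smooth_cutoffFactor K i M hδ j

theorem pd_comp {f : ℝ → ℝ} {φ : Pt d → ℝ} {x : Pt d} (hf : DifferentiableAt ℝ f (φ x))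
    (hφ : Smooth φ) (c : Fin d) : pd c (fun y => f (φ y)) x = deriv f (φ x) * pd c φ x := by
  have h := hf.hasDerivAt.comp_hasFDerivAt x (hφ.hasFDerivAt x)
  have h' : HasFDerivAt (fun y => f (φ y)) (deriv f (φ x) • fderiv ℝ φ x) x := h
  rw [pd, h'.fderiv]
  simp [pd]

/-- The derivative of a product of functions with values in `[0, 1]`. -/
theorem abs_pd_prod_le {κ : Type*} (s : Finset κ) {φ : κ → Pt d → ℝ} (h : ∀ j, Smooth (φ j))
    (h0 : ∀ j x, 0 ≤ φ j x) (h1 : ∀ j x, φ j x ≤ 1) (c : Fin d) (x : Pt d) :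
    |pd c (fun y => ∏ j ∈ s, φ j y) x| ≤ ∑ j ∈ s, |pd c (φ j) x| := by
  classical
  induction s using Finset.induction_on with
  | empty => simp [pd]
  | insert a s ha ih =>
    simp only [Finset.prod_insert ha, Finset.sum_insert ha]
    rw [pd_mul (h a) (smooth_finset_prod s h)]
    refine (abs_add_le _ _).trans ?_
    rw [abs_mul, abs_mul, abs_of_nonneg (h0 a x),
      abs_of_nonneg (Finset.prod_nonneg fun j _ => h0 j x)]
    have hp : ∏ j ∈ s, φ j x ≤ 1 := Finset.prod_le_one (fun j _ => h0 j x) fun j _ => h1 j x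
    refine add_le_add ?_ (le_trans ?_ ih)
    · exact mul_le_of_le_one_right (abs_nonneg _) hp
    · exact mul_le_of_le_one_left (abs_nonneg _) (h1 a x)

theorem exists_deriv_smoothTransition_le : ∃ C : ℝ, 0 ≤ C ∧ ∀ y,
    |deriv Real.smoothTransition y| ≤ C := by
  have hc : Continuous (deriv Real.smoothTransition) :=
    (Real.smoothTransition.contDiff (n := 1)).continuous_deriv le_rfl
  obtain ⟨C, hC⟩ := isCompact_Icc.exists_bound_of_continuousOn (s := Set.Icc (0 : ℝ) 1)
    hc.continuousOn
  refine ⟨max C 0, le_max_right _ _, fun y => ?_⟩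
  by_cases hy : y ∈ Set.Icc (0 : ℝ) 1
  · exact (hC y hy).trans (le_max_left _ _)
  · have : deriv Real.smoothTransition y = 0 := by
      rcases lt_or_ge y 0 with h | h
      · have : Real.smoothTransition =ᶠ[𝓝 y] fun _ => 0 := by
          filter_upwards [gt_mem_nhds h] with z hz
          exact Real.smoothTransition.zero_of_nonpos (le_of_lt hz)
        rw [this.deriv_eq, deriv_const]
      · have h1 : 1 < y := by
          by_contra! hcon
          exact hy ⟨h, hcon⟩
        have : Real.smoothTransition =ᶠ[𝓝 y] fun _ => 1 := by
          filter_upwards [lt_mem_nhds h1] with z hz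
          exact Real.smoothTransition.one_of_one_le (le_of_lt hz)
        rw [this.deriv_eq, deriv_const]
    rw [this, abs_zero]
    exact le_max_right _ _

theorem pd_rad_inv (K : Elt d) (i : Fin (d + 1)) (M : ℝ) {δ : ℝ} (hδ : 0 < δ) (c : Fin d)
    (x : Pt d) : pd c (fun y => (rad K i M δ y)⁻¹) x =
      -((M * lam K i x) * (M * pd c (lam K i) x)) / rad K i M δ x ^ 3 := by
  have hs : Smooth fun y => (M * lam K i y) ^ 2 + δ ^ 2 :=
    ((contDiff_const.mul (contDiff_lam K i)).pow 2).add contDiff_const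
  have hQ := rad_sq_pos K i M hδ x
  have hR := rad_pos K i M hδ x
  have hder : HasDerivAt (fun y : ℝ => (√y)⁻¹)
      (-(1 / (2 * rad K i M δ x)) / rad K i M δ x ^ 2) ((M * lam K i x) ^ 2 + δ ^ 2) :=
    (Real.hasDerivAt_sqrt hQ.ne').inv hR.ne'
  have h1 := pd_comp (f := fun y : ℝ => (√y)⁻¹) (x := x) hder.differentiableAt hs c
  rw [hder.deriv] at h1
  have h2 : pd c (fun y => (M * lam K i y) ^ 2 + δ ^ 2) x =
      2 * (M * lam K i x) * (M * pd c (lam K i) x) := by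
    have hd : HasDerivAt (fun y : ℝ => (M * y) ^ 2 + δ ^ 2)
        (2 * (M * lam K i x) * M) (lam K i x) := by
      have := ((((hasDerivAt_id (lam K i x)).const_mul M).pow 2).add_const (δ ^ 2))
      simpa using this
    have := pd_comp (f := fun y : ℝ => (M * y) ^ 2 + δ ^ 2) hd.differentiableAt
      (contDiff_lam K i) c
    rw [hd.deriv] at this
    rw [this]
    ring
  rw [h2] at h1
  refine (h1 : pd c (fun y => (rad K i M δ y)⁻¹) x = _).trans ?_
  field_simp

/-- The gradient bound for one factor of the cutoff function. -/
theorem exists_pd_cutoffFactor_le (K : Elt d) (i : Fin (d + 1)) (M : ℝ) (j : Fin (d + 1)) :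
    ∃ C : ℝ, 0 ≤ C ∧ ∀ δ, 0 < δ → ∀ c x, 0 ≤ lam K j x →
      |pd c (cutoffFactor K i M δ j) x| ≤ C / rad K i M δ x ∧
      (2 * rad K i M δ x < lam K j x → pd c (cutoffFactor K i M δ j) x = 0) := by
  obtain ⟨S, hS0, hS⟩ := exists_deriv_smoothTransition_le
  set A : ℝ := ∑ l, ∑ c, |nrm K l c / K.height l| with hA
  have hA0 : 0 ≤ A := Finset.sum_nonneg fun l _ => Finset.sum_nonneg fun c _ => abs_nonneg _
  have hpd : ∀ l c x, |pd c (lam K l) x| ≤ A := by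
    intro l c x
    rw [pd_lam, neg_div, abs_neg]
    refine (Finset.single_le_sum (f := fun c => |nrm K l c / K.height l|)
      (fun c _ => abs_nonneg _) (Finset.mem_univ c)).trans ?_
    exact Finset.single_le_sum (f := fun l => ∑ c, |nrm K l c / K.height l|)
      (fun l _ => Finset.sum_nonneg fun c _ => abs_nonneg _) (Finset.mem_univ l)
  refine ⟨S * (A + 2 * |M| * A), by positivity, fun δ hδ c x hx => ?_⟩
  set R := rad K i M δ x with hR
  have hRpos : 0 < R := rad_pos K i M hδ x
  have hg : Smooth fun y => lam K j y * (rad K i M δ y)⁻¹ - 1 :=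
    ((contDiff_lam K j).mul (smooth_rad_inv K i M hδ)).sub contDiff_const
  have hzero : 2 * R < lam K j x → pd c (cutoffFactor K i M δ j) x = 0 := by
    intro h2
    have hgx : 1 < lam K j x * (rad K i M δ x)⁻¹ - 1 := by
      rw [← hR, lt_sub_iff_add_lt, ← div_eq_mul_inv, lt_div_iff₀ hRpos]
      linarith
    have : cutoffFactor K i M δ j =ᶠ[𝓝 x] fun _ => 1 := by
      filter_upwards [hg.continuous.continuousAt.eventually (lt_mem_nhds hgx)] with y hy
      exact Real.smoothTransition.one_of_one_le (le_of_lt hy)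
    rw [pd, this.fderiv_eq]
    simp
  refine ⟨?_, hzero⟩
  by_cases h2 : 2 * R < lam K j x
  · rw [hzero h2, abs_zero]
    positivity
  · push Not at h2
    have e1 : pd c (cutoffFactor K i M δ j) x =
        deriv Real.smoothTransition (lam K j x * R⁻¹ - 1) *
          (pd c (lam K j) x * R⁻¹ + lam K j x *
            (-((M * lam K i x) * (M * pd c (lam K i) x)) / R ^ 3)) := by
      have h3 := pd_comp (f := Real.smoothTransition) (x := x)
        ((Real.smoothTransition.contDiff (n := 1)).differentiable one_ne_zero _) hg c
      refine (h3 : pd c (cutoffFactor K i M δ j) x = _).trans ?_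
      congr 1
      rw [pd_sub ((contDiff_lam K j).mul (smooth_rad_inv K i M hδ)) contDiff_const,
        pd_mul (contDiff_lam K j) (smooth_rad_inv K i M hδ), pd_rad_inv K i M hδ]
      simp [pd, hR]
    rw [e1, abs_mul, mul_div_assoc]
    refine mul_le_mul (hS _) ?_ (abs_nonneg _) hS0
    refine (abs_add_le _ _).trans ?_
    rw [add_div]
    refine add_le_add ?_ ?_
    · rw [abs_mul, abs_inv, abs_of_pos hRpos, ← div_eq_mul_inv]
      exact div_le_div_of_nonneg_right (hpd j c x) hRpos.le
    · rw [abs_mul, abs_of_nonneg hx, abs_div, abs_neg, abs_mul, abs_mul M (pd c _ x),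
        abs_of_pos (pow_pos hRpos 3), mul_div_assoc', div_le_div_iff₀ (pow_pos hRpos 3) hRpos]
      have h4 := abs_le_rad K i M δ x
      rw [← hR] at h4
      have h5 := hpd i c x
      calc lam K j x * (|M * lam K i x| * (|M| * |pd c (lam K i) x|)) * R
          ≤ 2 * R * (R * (|M| * A)) * R := by
            gcongr
        _ = 2 * |M| * A * R ^ 3 := by ring

/-- Compatibility of the cutoff function of `(K, i)` with the face `i'` of `K'`. -/
structure CutoffAdapted (K : Elt d) (i : Fin (d + 1)) (M : ℝ) (K' : Elt d) (i' : Fin (d + 1))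
    (m : ℝ) : Prop where
  ne_zero : m ≠ 0
  lam_eq : ∀ x, M * lam K i x = m * lam K' i' x
  exists_left : ∀ l ≠ i', ∃ j ≠ i, ∃ c, |c| < |m| ∧ ∀ x, lam K j x = lam K' l x + c * lam K' i' x
  exists_right : ∀ j ≠ i, ∃ l ≠ i', ∃ c, |c| < |m| ∧ ∀ x, lam K j x = lam K' l x + c * lam K' i' x

theorem CutoffAdapted.refl (K : Elt d) (i : Fin (d + 1)) {M : ℝ} (hM : 0 < M) :
    CutoffAdapted K i M K i M where
  ne_zero := hM.ne'
  lam_eq _ := rfl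
  exists_left l hl := ⟨l, hl, 0, by simpa using hM.ne', fun x => by ring⟩
  exists_right l hl := ⟨l, hl, 0, by simpa using hM.ne', fun x => by ring⟩

theorem CutoffAdapted.isCutoff {K K' : Elt d} {i i' : Fin (d + 1)} {M m : ℝ}
    (h : CutoffAdapted K i M K' i' m) : IsCutoff K' i' fun n => cutoff K i M (sa n) := by
  have hnn : ∀ (n : ℕ) j x, 0 ≤ cutoffFactor K i M (sa n) j x := fun n j x =>
    Real.smoothTransition.nonneg _
  have hle : ∀ (n : ℕ) j x, cutoffFactor K i M (sa n) j x ≤ 1 := fun n j x =>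
    Real.smoothTransition.le_one _
  refine ⟨fun n => smooth_cutoff K i M (sa_pos n), fun n x => Finset.prod_nonneg fun j _ => hnn n j x,
    fun n x => Finset.prod_le_one (fun j _ => hnn n j x) fun j _ => hle n j x, ?_, ?_, ?_⟩
  · intro n l hl x hx
    rw [mem_face_iff] at hx
    obtain ⟨j, hj, c, hc, hjl⟩ := h.exists_left l hl
    refine Finset.prod_eq_zero (Finset.mem_erase.2 ⟨hj, Finset.mem_univ j⟩) ?_
    refine Real.smoothTransition.zero_of_nonpos ?_
    have hR := rad_pos K i M (sa_pos n) x
    rw [sub_nonpos, ← div_eq_mul_inv, div_le_one hR, hjl, hx.1, zero_add]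
    refine le_trans ?_ (abs_le_rad K i M (sa n) x)
    rw [h.lam_eq, abs_mul]
    refine (le_abs_self _).trans ?_
    rw [abs_mul]
    exact mul_le_mul_of_nonneg_right hc.le (abs_nonneg _)
  · have hae : ∀ᵐ x ∂(surf (face K' i')), ∀ l ≠ i', lam K' l x ≠ 0 := by
      rw [ae_all_iff]
      intro l
      by_cases hl : l = i'
      · simp [hl]
      · simpa [hl, ae_iff] using surf_lam_eq_zero K' hl
    filter_upwards [hae, ae_surf_mem K' i'] with x hx hxF
    rw [mem_face_iff] at hxF
    refine tendsto_const_nhds.congr' ?_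
    have hev : ∀ j ∈ Finset.univ.erase i, ∀ᶠ n in atTop, cutoffFactor K i M (sa n) j x = 1 := by
      intro j hj
      obtain ⟨l, hl, c, -, hjl⟩ := h.exists_right j (Finset.ne_of_mem_erase hj)
      have hpos : 0 < lam K' l x := lt_of_le_of_ne (hxF.2 l) (hx l hl).symm
      have hjx : lam K j x = lam K' l x := by rw [hjl, hxF.1, mul_zero, add_zero]
      have h0 : M * lam K i x = 0 := by rw [h.lam_eq, hxF.1, mul_zero]
      have hsa : Tendsto sa atTop (𝓝 0) := tendsto_sa.mono_right nhdsWithin_le_nhds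
      filter_upwards [hsa.eventually (gt_mem_nhds (half_pos hpos))] with n hn
      refine Real.smoothTransition.one_of_one_le ?_
      have hr : rad K i M (sa n) x = sa n := by
        rw [rad, h0]
        simp [Real.sqrt_sq (sa_pos n).le]
      rw [hr, hjx, le_sub_iff_add_le, ← div_eq_mul_inv, le_div_iff₀ (sa_pos n)]
      linarith
    filter_upwards [(Filter.eventually_all_finset _).2 hev] with n hn
    exact (Finset.prod_eq_one hn).symm
  · choose C hC0 hC using exists_pd_cutoffFactor_le K i M
    have hm : 0 < |m| := abs_pos.2 h.ne_zero
    refine ⟨∑ j, C j * √(3 / |m|), Finset.sum_nonneg fun j _ => mul_nonneg (hC0 j) (Real.sqrt_nonneg _),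
      fun n c x hx => ?_⟩
    have hW : ∀ l, 0 ≤ (√(lam K' i' x * lam K' l x))⁻¹ := fun l => inv_nonneg.2 (Real.sqrt_nonneg _)
    refine (abs_pd_prod_le _ (fun j => smooth_cutoffFactor K i M (sa_pos n) j) (hnn n) (hle n)
      c x).trans ?_
    rw [Finset.sum_mul]
    refine (Finset.sum_le_sum (g := fun j => C j * √(3 / |m|) *
      ∑ l ∈ Finset.univ.erase i', (√(lam K' i' x * lam K' l x))⁻¹) ?_).trans
      (Finset.sum_le_sum_of_subset_of_nonneg (Finset.erase_subset _ _) fun j _ _ =>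
        mul_nonneg (mul_nonneg (hC0 j) (Real.sqrt_nonneg _)) (Finset.sum_nonneg fun l _ => hW l))
    intro j hj
    obtain ⟨l, hl, b, hb, hjl⟩ := h.exists_right j (Finset.ne_of_mem_erase hj)
    set R := rad K i M (sa n) x with hR
    have hRpos : 0 < R := rad_pos K i M (sa_pos n) x
    have hMR : |m| * lam K' i' x ≤ R := by
      have := abs_le_rad K i M (sa n) x
      rwa [h.lam_eq, abs_mul, abs_of_pos (hx i')] at this
    have hbound : |pd c (cutoffFactor K i M (sa n) j) x| ≤
        C j * √(3 / |m|) * (√(lam K' i' x * lam K' l x))⁻¹ := by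
      by_cases h0 : pd c (cutoffFactor K i M (sa n) j) x = 0
      · rw [h0, abs_zero]
        exact mul_nonneg (mul_nonneg (hC0 j) (Real.sqrt_nonneg _)) (hW l)
      have hj0 : 0 ≤ lam K j x := by
        by_contra! hneg
        refine h0 ?_
        have : cutoffFactor K i M (sa n) j =ᶠ[𝓝 x] fun _ => 0 := by
          filter_upwards [(continuous_lam K j).continuousAt.eventually (gt_mem_nhds hneg)] with y hy
          refine Real.smoothTransition.zero_of_nonpos ?_
          have := mul_nonneg (neg_nonneg.2 (le_of_lt hy))
            (inv_nonneg.2 (rad_pos K i M (sa_pos n) y).le)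
          linarith
        rw [pd, this.fderiv_eq]
        simp
      obtain ⟨h1, h2⟩ := hC j (sa n) (sa_pos n) c x hj0
      have hj2 : lam K j x ≤ 2 * R := by
        by_contra! hcon
        exact h0 (h2 hcon)
      refine h1.trans ?_
      rw [mul_assoc, div_eq_mul_inv]
      refine mul_le_mul_of_nonneg_left ?_ (hC0 j)
      have hy : 0 < lam K' i' x * lam K' l x := mul_pos (hx i') (hx l)
      rw [← div_eq_mul_inv, inv_eq_one_div, div_le_div_iff₀ hRpos (Real.sqrt_pos.2 hy), one_mul]
      have hl3 : lam K' l x ≤ 3 * R := by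
        have hb' : -(b * lam K' i' x) ≤ R := by
          refine le_trans ?_ hMR
          rw [← neg_mul]
          exact mul_le_mul_of_nonneg_right ((neg_le_abs b).trans hb.le) (hx i').le
        have := hjl x
        linarith
      have hi3 : lam K' i' x ≤ R / |m| := by
        rw [le_div_iff₀ hm, mul_comm]
        exact hMR
      rw [Real.sqrt_le_left (mul_nonneg (Real.sqrt_nonneg _) hRpos.le), mul_pow,
        Real.sq_sqrt (by positivity)]
      calc lam K' i' x * lam K' l x ≤ R / |m| * (3 * R) :=
            mul_le_mul hi3 hl3 (hx l).le (div_nonneg hRpos.le hm.le)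
        _ = 3 / |m| * R ^ 2 := by ring
    refine hbound.trans (mul_le_mul_of_nonneg_left ?_ (mul_nonneg (hC0 j) (Real.sqrt_nonneg _)))
    exact Finset.single_le_sum (f := fun l => (√(lam K' i' x * lam K' l x))⁻¹) (fun l _ => hW l)
      (Finset.mem_erase.2 ⟨hl, Finset.mem_univ l⟩)

/-- The slope for which the cutoff functions of `(K, i)` are adapted to a neighbour. -/
theorem Adjacent.exists_adapted {K K' : Elt d} {i i' : Fin (d + 1)} {a : ℝ}
    (h : Adjacent K i K' i' a) : ∃ M m, 0 < M ∧ CutoffAdapted K i M K' i' m := by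
  set B : ℝ := ∑ j, |lam K j (K'.points i')| with hB
  have hB0 : 0 ≤ B := Finset.sum_nonneg fun j _ => abs_nonneg _
  have hBj : ∀ j, |lam K j (K'.points i')| < B + 1 := fun j =>
    lt_of_le_of_lt (Finset.single_le_sum (f := fun j => |lam K j (K'.points i')|)
      (fun j _ => abs_nonneg _) (Finset.mem_univ j)) (lt_add_one B)
  have ha := h.pos
  have habs : |-(B + 1)| = B + 1 := by rw [abs_neg, abs_of_pos (by linarith)]
  refine ⟨(B + 1) / a, -(B + 1), div_pos (by linarith) ha, by linarith, fun x => ?_,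
    fun l hl => ?_, fun j hj => ?_⟩
  · rw [h.lam_eq]
    field_simp
  · obtain ⟨j, hj, hjl⟩ := h.exists_left l hl
    exact ⟨j, hj, _, by rw [habs]; exact hBj j, hjl⟩
  · obtain ⟨l, hl, hjl⟩ := h.exists_right j hj
    exact ⟨l, hl, _, by rw [habs]; exact hBj j, hjl⟩

/-- The cutoff functions near a common face are test functions in every open set that contains the
interior of the union of the two simplices. -/
theorem isTest_mul_cutoff {K K' : Elt d} {i i' : Fin (d + 1)} {a M m : ℝ}
    (h : Adjacent K i K' i' a) (hc : CutoffAdapted K i M K' i' m) {Ω : Set (Pt d)}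
    (hΩ : interior (body K ∪ body K') ⊆ Ω) {ψ : Pt d → ℝ} (hψ : Smooth ψ) (n : ℕ) :
    IsTest Ω fun x => ψ x * cutoff K i M (sa n) x := by
  set Z : Set (Pt d) := {x | ∀ j ≠ i, rad K i M (sa n) x ≤ lam K j x} with hZ
  set W : Set (Pt d) := {x | (∀ j ≠ i, 0 < lam K j x) ∧ ∀ l ≠ i', 0 < lam K' l x} with hW
  have hZc : IsClosed Z := by
    simp only [hZ, Set.setOf_forall]
    exact isClosed_iInter fun j => isClosed_iInter fun _ =>
      isClosed_le (smooth_rad K i M (sa_pos n)).continuous (continuous_lam K j)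
  have hZW : Z ⊆ W := by
    intro x hx
    have hRpos := rad_pos K i M (sa_pos n) x
    refine ⟨fun j hj => lt_of_lt_of_le hRpos (hx j hj), fun l hl => ?_⟩
    obtain ⟨j, hj, c, hcm, hjl⟩ := hc.exists_left l hl
    have h1 := hx j hj
    have h2 := abs_le_rad K i M (sa n) x
    rw [hc.lam_eq, abs_mul] at h2
    rw [hjl] at h1
    have h3 : c * lam K' i' x ≤ |c| * |lam K' i' x| := by
      rw [← abs_mul]
      exact le_abs_self _
    rcases (abs_nonneg (lam K' i' x)).eq_or_lt with h0 | h0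
    · rw [← h0, mul_zero] at h3
      linarith
    · have := mul_lt_mul_of_pos_right hcm h0
      linarith
  have hWo : IsOpen W := by
    have e : W = (⋂ j, ⋂ _ : j ≠ i, {x | 0 < lam K j x}) ∩ ⋂ l, ⋂ _ : l ≠ i', {x | 0 < lam K' l x} := by
      ext x
      simp [hW]
    rw [e]
    exact (isOpen_iInter_of_finite fun j => isOpen_iInter_of_finite fun _ =>
      isOpen_lt continuous_const (continuous_lam K j)).inter
      (isOpen_iInter_of_finite fun j => isOpen_iInter_of_finite fun _ =>
      isOpen_lt continuous_const (continuous_lam K' j))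
  have hWU : W ⊆ body K ∪ body K' := by
    intro x hx
    rcases le_or_gt 0 (lam K i x) with h0 | h0
    · left
      rw [mem_body_iff]
      intro j
      by_cases hj : j = i
      · exact hj ▸ h0
      · exact (hx.1 j hj).le
    · right
      rw [mem_body_iff]
      intro l
      by_cases hl : l = i'
      · subst hl
        have h1 := h.lam_eq x
        by_contra! hneg
        have := mul_pos h.pos (neg_pos.2 hneg)
        linarith
      · exact (hx.2 l hl).le
  have hsupp : Function.support (fun x => ψ x * cutoff K i M (sa n) x) ⊆ Z := by
    intro x hx j hj
    by_contra! hcon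
    refine hx ?_
    have : cutoff K i M (sa n) x = 0 := by
      refine Finset.prod_eq_zero (Finset.mem_erase.2 ⟨hj, Finset.mem_univ j⟩) ?_
      refine Real.smoothTransition.zero_of_nonpos ?_
      rw [sub_nonpos, ← div_eq_mul_inv, div_le_one (rad_pos K i M (sa_pos n) x)]
      exact hcon.le
    simp [this]
  have htsupp : tsupport (fun x => ψ x * cutoff K i M (sa n) x) ⊆ Z := closure_minimal hsupp hZc
  refine ⟨hψ.mul (smooth_cutoff K i M (sa_pos n)), ?_, ?_⟩
  · exact ((isCompact_body K).union (isCompact_body K')).of_isClosed_subset (isClosed_tsupport _)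
      (htsupp.trans (hZW.trans hWU))
  · exact (htsupp.trans (hZW.trans (interior_maximal hWU hWo))).trans hΩ

/-! ### Continuity across interior faces -/

theorem IsCutoff.tendsto_integral {K : Elt d} {i : Fin (d + 1)} {χ : ℕ → Pt d → ℝ}
    (h : IsCutoff K i χ) {g : Pt d → ℝ} (hg : Integrable g (surf (face K i))) :
    Tendsto (fun n => ∫ x, g x * χ n x ∂(surf (face K i))) atTop
      (𝓝 (∫ x, g x ∂(surf (face K i)))) := by
  refine tendsto_integral_of_dominated_convergence (fun x => ‖g x‖) (fun n => ?_) hg.norm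
    (fun n => ?_) ?_
  · exact hg.aestronglyMeasurable.mul (h.smooth n).continuous.aestronglyMeasurable
  · refine Eventually.of_forall fun x => ?_
    rw [norm_mul, Real.norm_of_nonneg (h.nonneg n x)]
    exact mul_le_of_le_one_right (norm_nonneg _) (h.le_one n x)
  · filter_upwards [h.tendsto] with x hx
    simpa using hx.const_mul (g x)

theorem IsCutoff.integral_eq_zero {K : Elt d} {i l : Fin (d + 1)} {χ : ℕ → Pt d → ℝ}
    (h : IsCutoff K i χ) (hl : l ≠ i) (g : Pt d → ℝ) (n : ℕ) :
    ∫ x, g x * χ n x ∂(surf (face K l)) = 0 := by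
  refine integral_eq_zero_of_ae ?_
  filter_upwards [ae_surf_mem K l] with x hx
  simp [h.zero n l hl x hx]

theorem notMem_interior_of_mem_face (K : Elt d) {i : Fin (d + 1)} {x : Pt d} (hx : x ∈ face K i) :
    x ∉ interior (body K) := by
  intro hi
  have hc : Continuous fun r : ℝ => x + r • (K.points i - x) := by fun_prop
  have ht := hc.tendsto 0
  simp only [zero_smul, add_zero] at ht
  have hev := (ht.mono_left (nhdsWithin_le_nhds (s := Set.Iio 0))).eventually
    (isOpen_interior.mem_nhds hi)
  obtain ⟨r, h1, h2⟩ := (hev.and self_mem_nhdsWithin).exists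
  have h3 := (mem_body_iff _ _).1 (interior_subset h1) i
  have h2 : r < 0 := h2
  rw [lam_add_smul, ((mem_face_iff _ _ _).1 hx).1, lam_point_self] at h3
  linarith

theorem hasWeakDiv_of_smooth (K : Elt d) {V : Fin d → Pt d → ℝ} (hV : ∀ j, Smooth (V j)) :
    HasWeakDiv (interior (body K)) V fun x => ∑ j, pd j (V j) x := by
  intro φ hφ
  rw [restrict_interior_body]
  have hφL := Continuous.memLp_body hφ.1.continuous K
  have hVL := fun j => Continuous.memLp_body (hV j).continuous K
  have hpφ := fun j => Continuous.memLp_body (Smooth.continuous_pd hφ.1 j) K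
  have hpV := fun j => Continuous.memLp_body ((hV j).continuous_pd j) K
  have h1 : ∀ j, ∫ x in body K, V j x * pd j φ x = -∫ x in body K, pd j (V j) x * φ x := by
    intro j
    have h := integral_by_parts K j (hV j) hφ.1
    rw [integral_add (integrable_fun_mul (hpV j) hφL) (integrable_fun_mul (hVL j) (hpφ j))] at h
    have h0 : ∀ i, ∫ y, V j y * φ y ∂(surf (face K i)) = 0 := by
      intro i
      refine integral_eq_zero_of_ae ?_
      filter_upwards [ae_surf_mem K i] with x hx
      simp [hφ.eq_zero (notMem_interior_of_mem_face K hx)]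
    simp only [h0, mul_zero, Finset.sum_const_zero] at h
    linarith
  simp only [Finset.sum_mul]
  rw [integral_finset_sum _ fun j _ => integrable_fun_mul (hVL j) (hpφ j),
    integral_finset_sum _ fun j _ => integrable_fun_mul (hpV j) hφL, ← Finset.sum_neg_distrib]
  exact Finset.sum_congr rfl fun j _ => h1 j

theorem IsTest.memLp_pd {Ω : Set (Pt d)} {φ : Pt d → ℝ} (h : IsTest Ω φ) (j : Fin d)
    (μ : Measure (Pt d)) [IsFiniteMeasureOnCompacts μ] : MemLp (HDG.pd j φ) 2 μ :=
  (Smooth.continuous_pd h.1 j).memLp_of_hasCompactSupport (h.2.1.fderiv_apply ℝ _)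

/-- `∫_K (D φ + V · ∇φ)`, the boundary pairing of the normal component of `V` with `φ`. -/
def rowPairing (K : Elt d) (V : Fin d → Pt d → ℝ) (D φ : Pt d → ℝ) : ℝ :=
  ∫ x in body K, (D x * φ x + ∑ c, V c x * pd c φ x)

/-- The divergence theorem for a product. -/
theorem rowPairing_smooth (K : Elt d) {V : Fin d → Pt d → ℝ} (hV : ∀ c, Smooth (V c))
    {φ : Pt d → ℝ} (hφ : Smooth φ) :
    rowPairing K V (fun x => ∑ c, pd c (V c) x) φ =
      ∑ i, ∫ y, (∑ c, V c y * nrm K i c) * φ y ∂(surf (face K i)) := by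
  have hφL := Continuous.memLp_body hφ.continuous K
  have hpφ := fun j => Continuous.memLp_body (Smooth.continuous_pd hφ j) K
  have hVL := fun j => Continuous.memLp_body (hV j).continuous K
  have hpV := fun j => Continuous.memLp_body ((hV j).continuous_pd j) K
  have h1 : ∀ x, (∑ c, pd c (V c) x) * φ x + ∑ j, V j x * pd j φ x =
      ∑ j, (pd j (V j) x * φ x + V j x * pd j φ x) := by
    intro x
    rw [Finset.sum_add_distrib, ← Finset.sum_mul]
  simp only [rowPairing, h1]
  have hint : ∀ j ∈ Finset.univ, Integrable (fun x => pd j (V j) x * φ x + V j x * pd j φ x)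
      (volume.restrict (body K)) := fun j _ =>
    (integrable_fun_mul (hpV j) hφL).add (integrable_fun_mul (hVL j) (hpφ j))
  rw [integral_finset_sum _ hint]
  simp only [fun j => integral_by_parts K j (hV j) hφ]
  rw [Finset.sum_comm]
  refine Finset.sum_congr rfl fun i _ => ?_
  simp only [Finset.sum_mul]
  rw [integral_finset_sum]
  · refine Finset.sum_congr rfl fun j _ => ?_
    rw [← integral_const_mul]
    refine integral_congr_ae (Eventually.of_forall fun x => ?_)
    simp only
    ring
  · intro j _
    exact integrable_fun_mul ((Continuous.memLp_face (hV j).continuous K i).mul_const _)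
      (Continuous.memLp_face hφ.continuous K i)

theorem IsCutoff.rowPairing_smooth {K : Elt d} {i : Fin (d + 1)} {χ : ℕ → Pt d → ℝ}
    (hχ : IsCutoff K i χ) {V : Fin d → Pt d → ℝ} (hV : ∀ c, Smooth (V c)) {ψ : Pt d → ℝ}
    (hψ : Smooth ψ) (n : ℕ) :
    rowPairing K V (fun x => ∑ c, pd c (V c) x) (fun y => ψ y * χ n y) =
      ∫ y, (∑ c, V c y * nrm K i c) * ψ y * χ n y ∂(surf (face K i)) := by
  rw [HDG.rowPairing_smooth K hV (hψ.mul (hχ.smooth n)), Finset.sum_eq_single i]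
  · simp only [mul_assoc]
  · intro l _ hl
    simp only [← mul_assoc]
    exact hχ.integral_eq_zero hl _ n
  · simp

theorem rowPairing_congr {K : Elt d} {V V' : Fin d → Pt d → ℝ} {D D' φ : Pt d → ℝ}
    (hV : ∀ c, V c =ᵐ[volume.restrict (body K)] V' c) (hD : D =ᵐ[volume.restrict (body K)] D') :
    rowPairing K V D φ = rowPairing K V' D' φ := by
  refine integral_congr_ae ?_
  filter_upwards [ae_all_iff.2 hV, hD] with x hx hx'
  simp only [hx, hx']

theorem sum_pd_val (v : Fin d → Poly d) :
    (fun x => ∑ j, pd j (val (v j)) x) = val (pdiv v) := by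
  ext x
  simp only [pd_val, pdiv, val_sum]

namespace Triangulation

variable {Ω : Set (Pt d)} {ι : Type*} [Fintype ι]

theorem integral_eq_add (𝒯 : Triangulation Ω ι) {t t' : ι} (hne : t ≠ t') {F : Pt d → ℝ}
    (hF : IntegrableOn F Ω) (h0 : ∀ x, x ∉ body (𝒯.elt t) ∪ body (𝒯.elt t') → F x = 0) :
    ∫ x in Ω, F x = (∫ x in body (𝒯.elt t), F x) + ∫ x in body (𝒯.elt t'), F x := by
  classical
  rw [𝒯.integral_eq_sum fun s => Integrable.mono_measure hF (𝒯.restrict_body_le s),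
    Finset.sum_eq_add t t' hne]
  · intro s _ hs
    refine integral_eq_zero_of_ae ?_
    have h1 : ∀ᵐ x : Pt d, x ∉ body (𝒯.elt s) ∩ body (𝒯.elt t) := by
      simpa [ae_iff] using (𝒯.conform hs.1).volume_inter
    have h2 : ∀ᵐ x : Pt d, x ∉ body (𝒯.elt s) ∩ body (𝒯.elt t') := by
      simpa [ae_iff] using (𝒯.conform hs.2).volume_inter
    filter_upwards [ae_restrict_mem (measurableSet_body (𝒯.elt s)), ae_restrict_of_ae h1,
      ae_restrict_of_ae h2] with x hx hx1 hx2
    refine h0 x ?_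
    rintro (h | h)
    · exact hx1 ⟨hx, h⟩
    · exact hx2 ⟨hx, h⟩
  · simp
  · simp

/-- A common cutoff sequence of the two elements at an interior face, whose members are admissible
in the weak divergence theorem. -/
theorem exists_common_cutoff (𝒯 : Triangulation Ω ι) {t t' : ι} {i i' : Fin (d + 1)}
    (hne : (t, i) ≠ (t', i')) (hF : face (𝒯.elt t) i = face (𝒯.elt t') i') :
    ∃ χ, IsCutoff (𝒯.elt t) i χ ∧ IsCutoff (𝒯.elt t') i' χ ∧
      ∀ (V : Fin d → Pt d → ℝ) (D : Pt d → ℝ), (∀ j, MemL2 Ω (V j)) → MemL2 Ω D →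
        HasWeakDiv Ω V D → ∀ ψ, Smooth ψ → ∀ n,
        rowPairing (𝒯.elt t) V D (fun y => ψ y * χ n y) +
          rowPairing (𝒯.elt t') V D (fun y => ψ y * χ n y) = 0 := by
  obtain ⟨a, ha⟩ := 𝒯.adjacent hne hF
  obtain ⟨M, m, hM, hm⟩ := ha.exists_adapted
  have htt : t ≠ t' := by
    rintro rfl
    exact hne (by rw [face_injective _ hF])
  refine ⟨fun n => cutoff (𝒯.elt t) i M (sa n), (CutoffAdapted.refl _ i hM).isCutoff, hm.isCutoff,
    fun V D hV hD hVD ψ hψ n => ?_⟩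
  have hsub : interior (body (𝒯.elt t) ∪ body (𝒯.elt t')) ⊆ Ω := by
    conv_rhs => rw [𝒯.cover]
    exact interior_mono (Set.union_subset (Set.subset_iUnion (fun t => body (𝒯.elt t)) t)
      (Set.subset_iUnion (fun t => body (𝒯.elt t)) t'))
  have hT := isTest_mul_cutoff ha hm le_rfl hψ n
  have hTΩ := isTest_mul_cutoff ha hm hsub hψ n
  have hint1 : IntegrableOn (fun x => D x * (ψ x * cutoff (𝒯.elt t) i M (sa n) x)) Ω :=
    integrable_fun_mul hD (hTΩ.memLp _)
  have hint2 : IntegrableOn (fun x => ∑ j, V j x *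
      pd j (fun y => ψ y * cutoff (𝒯.elt t) i M (sa n) y) x) Ω :=
    integrable_finset_sum _ fun j _ => integrable_fun_mul (hV j) (hTΩ.memLp_pd j _)
  have hint : IntegrableOn (fun x => D x * (ψ x * cutoff (𝒯.elt t) i M (sa n) x) +
      ∑ j, V j x * pd j (fun y => ψ y * cutoff (𝒯.elt t) i M (sa n) y) x) Ω := hint1.add hint2
  simp only [rowPairing]
  rw [← 𝒯.integral_eq_add htt hint, integral_add hint1 hint2, hVD _ hTΩ]
  · ring
  · intro x hx
    have hx' : x ∉ interior (body (𝒯.elt t) ∪ body (𝒯.elt t')) := fun h => hx (interior_subset h)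
    have h0 : ψ x * cutoff (𝒯.elt t) i M (sa n) x = 0 := hT.eq_zero hx'
    have h1 : ∀ j, pd j (fun y => ψ y * cutoff (𝒯.elt t) i M (sa n) y) x = 0 :=
      fun j => hT.pd_eq_zero hx' j
    simp only [h0, h1, mul_zero, Finset.sum_const_zero, add_zero]

end Triangulation

/-- Green's formula with a function cut off near a face. -/
theorem green_cutoff {K : Elt d} {i : Fin (d + 1)} {χ : ℕ → Pt d → ℝ} (hχ : IsCutoff K i χ)
    {f γ : Pt d → ℝ} (h : IsTrace K (face K i) f γ) {Df : Fin d → Pt d → ℝ}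
    (hf : MemL2 (interior (body K)) f)
    (hDf : ∀ j, MemL2 (interior (body K)) (Df j) ∧ HasWeakPartial (interior (body K)) j f (Df j))
    {ψ : Pt d → ℝ} (hψ : Smooth ψ) (n : ℕ) (j : Fin d) :
    ∫ x in body K, (Df j x * (ψ x * χ n x) + f x * pd j (fun y => ψ y * χ n y) x) =
      nrm K i j * ∫ y, γ y * ψ y * χ n y ∂(surf (face K i)) := by
  classical
  choose γ' hγ' using fun l => exists_isTrace K l hf hDf
  have hall : ∀ l, IsTrace K (face K l) f (Function.update γ' i γ l) := by
    intro l
    by_cases hl : l = i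
    · subst hl
      simpa using h
    · simpa [hl] using hγ' l
  have hφ : Smooth fun y => ψ y * χ n y := hψ.mul (hχ.smooth n)
  rw [green_trace hall hf hDf hφ j, Finset.sum_eq_single i]
  · simp [mul_assoc]
  · intro l _ hl
    simp only [← mul_assoc]
    rw [hχ.integral_eq_zero hl, mul_zero]
  · simp

theorem IsTrace.congr {K : Elt d} {F : Set (Pt d)} {f γ γ' : Pt d → ℝ} (h : IsTrace K F f γ)
    (hγ : γ =ᵐ[surf F] γ') : IsTrace K F f γ' := by
  obtain ⟨h1, Df, h2, φ, h3, h4, h5, h6⟩ := h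
  exact ⟨(memLp_congr_ae hγ).1 h1, Df, h2, φ, h3, h4, h5, h6.congr_right hγ⟩

theorem exists_nrm_ne_zero (K : Elt d) (i : Fin (d + 1)) : ∃ j, nrm K i j ≠ 0 := by
  by_contra! hcon
  have : nrm K i = 0 := by
    ext j
    exact hcon j
  have h := norm_nrm K i
  rw [this, norm_zero] at h
  exact zero_ne_one h

namespace Triangulation

variable {Ω : Set (Pt d)} {ι : Type*} [Fintype ι]

/-- The traces of an `H¹` function from both sides of an interior face agree. -/
theorem trace_unique (𝒯 : Triangulation Ω ι) {t t' : ι} {i i' : Fin (d + 1)}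
    (hne : (t, i) ≠ (t', i')) (hF : face (𝒯.elt t) i = face (𝒯.elt t') i') {f γ γ' : Pt d → ℝ}
    {Df : Fin d → Pt d → ℝ} (hf : MemL2 Ω f)
    (hDf : ∀ j, MemL2 Ω (Df j) ∧ HasWeakPartial Ω j f (Df j))
    (h : IsTrace (𝒯.elt t) (face (𝒯.elt t) i) f γ)
    (h' : IsTrace (𝒯.elt t') (face (𝒯.elt t') i') f γ') :
    γ =ᵐ[surf (face (𝒯.elt t) i)] γ' := by
  obtain ⟨χ, hχ, hχ', hweak⟩ := 𝒯.exists_common_cutoff hne hF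
  obtain ⟨a, ha⟩ := 𝒯.adjacent hne hF
  obtain ⟨j, hj⟩ := exists_nrm_ne_zero (𝒯.elt t) i
  have hloc : ∀ s, MemL2 (interior (body (𝒯.elt s))) f ∧ ∀ j,
      MemL2 (interior (body (𝒯.elt s))) (Df j) ∧
        HasWeakPartial (interior (body (𝒯.elt s))) j f (Df j) := fun s =>
    ⟨hf.mono_measure (Measure.restrict_mono (𝒯.interior_body_subset s) le_rfl), fun j =>
      ⟨(hDf j).1.mono_measure (Measure.restrict_mono (𝒯.interior_body_subset s) le_rfl),
        (hDf j).2.mono (𝒯.interior_body_subset s)⟩⟩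
  have hγ : MemLp γ 2 (surf (face (𝒯.elt t) i)) := h.1
  have hγ' : MemLp γ' 2 (surf (face (𝒯.elt t) i)) := hF ▸ h'.1
  have key : (fun x => γ x - γ' x) =ᵐ[surf (face (𝒯.elt t) i)] 0 := by
    refine ae_eq_zero_of_integral_smooth (hγ.sub hγ') fun ψ hψ => ?_
    have hψL := Continuous.memLp_face hψ.continuous (𝒯.elt t) i
    have hint : Integrable (fun x => (γ x - γ' x) * ψ x) (surf (face (𝒯.elt t) i)) :=
      integrable_fun_mul (hγ.sub hγ') hψL
    have hlim := hχ.tendsto_integral hint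
    refine tendsto_nhds_unique hlim (tendsto_const_nhds.congr fun n => ?_)
    have hw := hweak _ _ (fun c => by
      by_cases hc : c = j
      · simpa [hc] using hf
      · simp [hc, MemL2]) (hDf j).1 (hDf j).2.hasWeakDiv ψ hψ n
    have hsum : ∀ x, ∑ c, (if c = j then f else 0) x * pd c (fun y => ψ y * χ n y) x =
        f x * pd j (fun y => ψ y * χ n y) x := by
      intro x
      rw [Finset.sum_eq_single j]
      · simp
      · intro c _ hc
        simp [hc]
      · simp
    simp only [rowPairing, hsum] at hw
    rw [green_cutoff hχ h (hloc t).1 (hloc t).2 hψ n j,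
      green_cutoff hχ' h' (hloc t').1 (hloc t').2 hψ n j, ← hF] at hw
    have hn : nrm (𝒯.elt t) i j = -nrm (𝒯.elt t') i' j := by rw [ha.nrm_eq]; rfl
    have hn' : nrm (𝒯.elt t') i' j = -nrm (𝒯.elt t) i j := by linarith
    rw [hn', neg_mul, ← sub_eq_add_neg, ← mul_sub, mul_eq_zero, or_iff_right hj] at hw
    have hχL : MemLp (fun x => ψ x * χ n x) 2 (surf (face (𝒯.elt t) i)) :=
      Continuous.memLp_face (hψ.continuous.mul (hχ.smooth n).continuous) _ _
    rw [← hw]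
    simp only [mul_assoc]
    rw [← integral_sub (integrable_fun_mul hγ hχL) (integrable_fun_mul hγ' hχL)]
    refine integral_congr_ae (Eventually.of_forall fun x => ?_)
    simp only
    ring
  filter_upwards [key] with x hx
  exact sub_eq_zero.1 hx

theorem MemL2.interior_body (𝒯 : Triangulation Ω ι) {f : Pt d → ℝ} (hf : MemL2 Ω f) (t : ι) :
    MemL2 (interior (body (𝒯.elt t))) f :=
  hf.mono_measure (Measure.restrict_mono (𝒯.interior_body_subset t) le_rfl)

/-- The single-valued trace of an `H¹` function is the trace from each adjacent element. -/
theorem isTrace_trace (𝒯 : Triangulation Ω ι) {f : Pt d → ℝ} (hf : MemH1 Ω f) (t : ι)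
    (i : Fin (d + 1)) :
    IsTrace (𝒯.elt t) (face (𝒯.elt t) i) f (𝒯.trace f (face (𝒯.elt t) i)) := by
  choose Df hDf using hf.2
  have hex : ∃ γ, ∀ t' i', face (𝒯.elt t') i' = face (𝒯.elt t) i →
      IsTrace (𝒯.elt t') (face (𝒯.elt t) i) f γ := by
    have hloc : ∀ s j, MemL2 (interior (body (𝒯.elt s))) (Df j) ∧
        HasWeakPartial (interior (body (𝒯.elt s))) j f (Df j) := fun s j =>
      ⟨MemL2.interior_body 𝒯 (hDf j).1 s, (hDf j).2.mono (𝒯.interior_body_subset s)⟩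
    obtain ⟨γ, hγ⟩ := exists_isTrace (𝒯.elt t) i (MemL2.interior_body 𝒯 hf.1 t) (hloc t)
    refine ⟨γ, fun t' i' h' => ?_⟩
    by_cases hne : (t, i) = (t', i')
    · obtain ⟨rfl, rfl⟩ := Prod.mk.inj hne
      exact hγ
    · obtain ⟨γ', hγ'⟩ := exists_isTrace (𝒯.elt t') i' (MemL2.interior_body 𝒯 hf.1 t') (hloc t')
      have := 𝒯.trace_unique hne h'.symm hf.1 hDf hγ hγ'
      rw [h'] at hγ'
      exact hγ'.congr this.symm
  exact Classical.epsilon_spec (p := fun γ => ∀ t' i', face (𝒯.elt t') i' = face (𝒯.elt t) i →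
      IsTrace (𝒯.elt t') (face (𝒯.elt t) i) f γ) hex t i rfl

/-- On the elements, the weak divergence of a discrete field is its classical divergence. -/
theorem weakDiv_glue_ae_eq (𝒯 : Triangulation Ω ι) {v : ι → Fin d → Poly d} {D : Pt d → ℝ}
    (hD : MemL2 Ω D) (h : HasWeakDiv Ω (fun r => 𝒯.glue fun t => v t r) D) (t : ι) :
    D =ᵐ[volume.restrict (body (𝒯.elt t))] val (pdiv (v t)) := by
  rw [← restrict_interior_body]
  have h1 := hasWeakDiv_of_smooth (𝒯.elt t) fun j => smooth_val (v t j)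
  rw [sum_pd_val] at h1
  have h2 : HasWeakDiv (interior (body (𝒯.elt t))) (fun r => val (v t r)) D := by
    intro φ hφ
    rw [← h.mono (𝒯.interior_body_subset t) φ hφ, restrict_interior_body]
    have hae : ∀ᵐ x ∂(volume.restrict (body (𝒯.elt t))), ∀ r,
        𝒯.glue (fun t => v t r) x = val (v t r) x :=
      ae_all_iff.2 fun r => 𝒯.glue_ae_eq (fun t => v t r) t
    refine integral_congr_ae ?_
    filter_upwards [hae] with x hx
    simp [hx]
  exact HasWeakDiv.ae_unique isOpen_interior (MemL2.interior_body 𝒯 hD t)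
    ((memL2_interior_body _).2 (memLp_val_body _ _)) h2 h1

/-- The normal component of a discrete `H(div)` field is continuous across interior faces. -/
theorem normal_continuous (𝒯 : Triangulation Ω ι) {v : ι → Fin d → Poly d}
    (hv : MemHdiv Ω fun r => 𝒯.glue fun t => v t r) {t t' : ι} {i i' : Fin (d + 1)}
    (hne : (t, i) ≠ (t', i')) (hF : face (𝒯.elt t) i = face (𝒯.elt t') i') :
    ∀ᵐ x ∂(surf (face (𝒯.elt t) i)), (∑ r, val (v t r) x * nrm (𝒯.elt t) i r) +
      ∑ r, val (v t' r) x * nrm (𝒯.elt t') i' r = 0 := by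
  obtain ⟨χ, hχ, hχ', hweak⟩ := 𝒯.exists_common_cutoff hne hF
  obtain ⟨hV, D, hD, hVD⟩ := hv
  have hL : MemLp (fun x => ∑ r, val (v t r) x * nrm (𝒯.elt t) i r) 2 (surf (face (𝒯.elt t) i)) :=
    memLp_normal _ _ fun r => memLp_val_face _ _ _
  have hL' : MemLp (fun x => ∑ r, val (v t' r) x * nrm (𝒯.elt t') i' r) 2
      (surf (face (𝒯.elt t) i)) := memLp_normal _ _ fun r => memLp_val_face _ _ _
  refine ae_eq_zero_of_integral_smooth (hL.add hL') fun ψ hψ => ?_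
  have hψL := Continuous.memLp_face hψ.continuous (𝒯.elt t) i
  have hlim := hχ.tendsto_integral (integrable_fun_mul (hL.add hL') hψL)
  refine tendsto_nhds_unique hlim (tendsto_const_nhds.congr fun n => ?_)
  have hw := hweak _ _ hV hD hVD ψ hψ n
  have hloc : ∀ s, rowPairing (𝒯.elt s) (fun r => 𝒯.glue fun t => v t r) D (fun y => ψ y * χ n y) =
      rowPairing (𝒯.elt s) (fun r => val (v s r)) (fun x => ∑ c, pd c (val (v s c)) x)
        (fun y => ψ y * χ n y) := fun s => by
    rw [sum_pd_val]
    exact rowPairing_congr (fun r => 𝒯.glue_ae_eq (fun t => v t r) s)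
      (𝒯.weakDiv_glue_ae_eq hD hVD s)
  rw [hloc, hloc, hχ.rowPairing_smooth (fun c => smooth_val _) hψ,
    hχ'.rowPairing_smooth (fun c => smooth_val _) hψ, ← hF] at hw
  have hχL : MemLp (fun x => ψ x * χ n x) 2 (surf (face (𝒯.elt t) i)) :=
    Continuous.memLp_face (hψ.continuous.mul (hχ.smooth n).continuous) _ _
  rw [← hw]
  simp only [mul_assoc]
  rw [← integral_add (integrable_fun_mul hL hχL) (integrable_fun_mul hL' hχL)]
  refine integral_congr_ae (Eventually.of_forall fun x => ?_)
  simp only [Pi.add_apply]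
  ring

end Triangulation

/-! ### A weighted inequality for fractional Sobolev functions -/

theorem lintegral_body_eq (K : Elt d) (i : Fin (d + 1)) {H : Pt d → ℝ≥0∞} (hH : Measurable H) :
    ∫⁻ x in body K, H x = ∫⁻ s in Set.Ioc (0 : ℝ) 1, ENNReal.ofReal (K.height i * s ^ (d - 1)) *
      ∫⁻ y, H (cone K i s y) ∂(surf (face K i)) := by
  rw [restrict_body_eq_map_cone K i, lintegral_map hH (measurable_cone K i),
    lintegral_prod (fun z : ℝ × Pt d => H (cone K i z.1 z.2))
      (hH.comp (measurable_cone K i)).aemeasurable, coneWeight,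
    lintegral_withDensity_eq_lintegral_mul _ (by fun_prop)]
  · rfl
  · exact (hH.comp (measurable_cone K i)).lintegral_prod_right'

theorem lintegral_one_sub_rpow_lt_top {α : ℝ} (hα : α < 1) :
    ∫⁻ s in Set.Ioc (0 : ℝ) 1, ENNReal.ofReal ((1 - s) ^ (-α)) < ⊤ := by
  have h1 : IntervalIntegrable (fun s : ℝ => s ^ (-α)) volume 0 1 :=
    intervalIntegral.intervalIntegrable_rpow' (by linarith)
  have h2 := (h1.comp_sub_left 1).symm
  simp only [sub_zero, sub_self] at h2
  rw [intervalIntegrable_iff_integrableOn_Ioc_of_le zero_le_one] at h2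
  exact h2.lintegral_lt_top

theorem lintegral_lam_rpow_lt_top (K : Elt d) (j : Fin (d + 1)) {α : ℝ} (hα : α < 1) :
    ∫⁻ x in body K, ENNReal.ofReal (lam K j x ^ (-α)) < ⊤ := by
  have hm : Measurable fun x => ENNReal.ofReal (lam K j x ^ (-α)) :=
    ((continuous_lam K j).measurable.pow_const _).ennreal_ofReal
  have hh := K.height_pos j
  rw [lintegral_body_eq K j hm]
  refine lt_of_le_of_lt (b := ∫⁻ s in Set.Ioc (0 : ℝ) 1, ENNReal.ofReal (K.height j) *
    surf (face K j) Set.univ * ENNReal.ofReal ((1 - s) ^ (-α))) ?_ ?_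
  · refine setLIntegral_mono' measurableSet_Ioc fun s hs => ?_
    have e : ∫⁻ y, ENNReal.ofReal (lam K j (cone K j s y) ^ (-α)) ∂(surf (face K j)) =
        surf (face K j) Set.univ * ENNReal.ofReal ((1 - s) ^ (-α)) := by
      rw [lintegral_congr_ae (g := fun _ => ENNReal.ofReal ((1 - s) ^ (-α))), lintegral_const,
        mul_comm]
      filter_upwards [ae_surf_mem K j] with y hy
      rw [lam_cone_self, ((mem_face_iff _ _ _).1 hy).1, mul_zero, add_zero]
    rw [e, ← mul_assoc]
    gcongr
    exact mul_le_of_le_one_right hh.le (pow_le_one₀ hs.1.le hs.2)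
  · rw [lintegral_const_mul' _ _ (ENNReal.mul_ne_top ENNReal.ofReal_ne_top (measure_ne_top _ _))]
    exact ENNReal.mul_lt_top (ENNReal.mul_lt_top ENNReal.ofReal_lt_top (measure_lt_top _ _))
      (lintegral_one_sub_rpow_lt_top hα)

theorem lintegral_face_lam_rpow_lt_top (K : Elt d) {i j : Fin (d + 1)} (hij : j ≠ i) {α : ℝ}
    (hα0 : 0 < α) (hα : α < 1) :
    ∫⁻ y, ENNReal.ofReal (lam K j y ^ (-α)) ∂(surf (face K i)) < ⊤ := by
  have hm : Measurable fun x => ENNReal.ofReal (lam K j x ^ (-α)) :=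
    ((continuous_lam K j).measurable.pow_const _).ennreal_ofReal
  have hh := K.height_pos i
  have h1 := lintegral_lam_rpow_lt_top K j hα
  rw [lintegral_body_eq K i hm] at h1
  have h2 : ENNReal.ofReal (K.height i) *
      (∫⁻ s in Set.Ioc (0 : ℝ) 1, ENNReal.ofReal (s ^ (d - 1))) *
      ∫⁻ y, ENNReal.ofReal (lam K j y ^ (-α)) ∂(surf (face K i)) < ⊤ := by
    refine lt_of_le_of_lt ?_ h1
    rw [← lintegral_const_mul' (ENNReal.ofReal (K.height i))
      (fun s : ℝ => ENNReal.ofReal (s ^ (d - 1))) ENNReal.ofReal_ne_top,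
      ← lintegral_mul_const (∫⁻ y, ENNReal.ofReal (lam K j y ^ (-α)) ∂(surf (face K i)))
      (f := fun s : ℝ => ENNReal.ofReal (K.height i) * ENNReal.ofReal (s ^ (d - 1))) (by fun_prop)]
    refine setLIntegral_mono' measurableSet_Ioc fun s hs => ?_
    rw [← ENNReal.ofReal_mul hh.le]
    refine mul_le_mul_right (lintegral_mono_ae ?_) _
    filter_upwards [ae_surf_mem K i] with y hy
    rw [lam_cone_of_ne K hij]
    have hy0 := ((mem_face_iff _ _ _).1 hy).2 j
    rw [Real.mul_rpow hs.1.le hy0]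
    refine ENNReal.ofReal_le_ofReal (le_mul_of_one_le_left (Real.rpow_nonneg hy0 _) ?_)
    exact Real.one_le_rpow_of_pos_of_le_one_of_nonpos hs.1 hs.2 (by linarith)
  refine (ENNReal.mul_lt_top_iff.1 h2).elim (fun h => h.2) fun h => h.elim (fun h => ?_) fun h => ?_
  · exact absurd h (mul_ne_zero (by simp [hh]) (lintegral_pow_Ioc_pos _).ne')
  · rw [h]
    exact ENNReal.zero_lt_top

theorem lintegral_lam_mul_lam_rpow_lt_top (hd : 2 ≤ d) (K : Elt d) {i j : Fin (d + 1)}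
    (hij : j ≠ i) {α : ℝ} (hα0 : 0 < α) (hα : α < 1) :
    ∫⁻ x in body K, ENNReal.ofReal ((lam K i x * lam K j x) ^ (-α)) < ⊤ := by
  have hm : Measurable fun x => ENNReal.ofReal ((lam K i x * lam K j x) ^ (-α)) :=
    (((continuous_lam K i).mul (continuous_lam K j)).measurable.pow_const _).ennreal_ofReal
  have hh := K.height_pos i
  set B := ∫⁻ y, ENNReal.ofReal (lam K j y ^ (-α)) ∂(surf (face K i)) with hB
  have hBt : B < ⊤ := lintegral_face_lam_rpow_lt_top K hij hα0 hα
  rw [lintegral_body_eq K i hm]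
  refine lt_of_le_of_lt (b := ∫⁻ s in Set.Ioc (0 : ℝ) 1, ENNReal.ofReal (K.height i) * B *
    ENNReal.ofReal ((1 - s) ^ (-α))) ?_ ?_
  · refine setLIntegral_mono' measurableSet_Ioc fun s hs => ?_
    have hs1 : 0 ≤ 1 - s := by linarith [hs.2]
    have e : ∫⁻ y, ENNReal.ofReal ((lam K i (cone K i s y) * lam K j (cone K i s y)) ^ (-α))
        ∂(surf (face K i)) = ENNReal.ofReal ((1 - s) ^ (-α) * s ^ (-α)) * B := by
      rw [hB, ← lintegral_const_mul' _ _ ENNReal.ofReal_ne_top]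
      refine lintegral_congr_ae ?_
      filter_upwards [ae_surf_mem K i] with y hy
      have hy' := (mem_face_iff _ _ _).1 hy
      rw [lam_cone_self, hy'.1, mul_zero, add_zero, lam_cone_of_ne K hij,
        Real.mul_rpow hs1 (mul_nonneg hs.1.le (hy'.2 j)), Real.mul_rpow hs.1.le (hy'.2 j),
        ← mul_assoc, ENNReal.ofReal_mul (mul_nonneg (Real.rpow_nonneg hs1 _)
          (Real.rpow_nonneg hs.1.le _))]
    have hreal : K.height i * s ^ (d - 1) * ((1 - s) ^ (-α) * s ^ (-α)) ≤
        K.height i * (1 - s) ^ (-α) := by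
      have h3 : s ^ (d - 1) * s ^ (-α) ≤ 1 := by
        rw [← Real.rpow_natCast, ← Real.rpow_add hs.1]
        refine Real.rpow_le_one hs.1.le hs.2 ?_
        have : (1 : ℝ) ≤ ((d - 1 : ℕ) : ℝ) := by exact_mod_cast (by omega : 1 ≤ d - 1)
        linarith
      calc K.height i * s ^ (d - 1) * ((1 - s) ^ (-α) * s ^ (-α))
          = K.height i * (1 - s) ^ (-α) * (s ^ (d - 1) * s ^ (-α)) := by ring
        _ ≤ _ := mul_le_of_le_one_right (mul_nonneg hh.le (Real.rpow_nonneg hs1 _)) h3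
    rw [e, ← mul_assoc, ← ENNReal.ofReal_mul (mul_nonneg hh.le (pow_nonneg hs.1.le _)),
      mul_right_comm (ENNReal.ofReal (K.height i)), ← ENNReal.ofReal_mul hh.le]
    gcongr
  · rw [lintegral_const_mul' _ _ (ENNReal.mul_ne_top ENNReal.ofReal_ne_top hBt.ne)]
    exact ENNReal.mul_lt_top (ENNReal.mul_lt_top ENNReal.ofReal_lt_top hBt)
      (lintegral_one_sub_rpow_lt_top hα)

theorem lintegral_contract_le (K : Elt d) {r : ℝ} (hr : 0 < r) (hr1 : r ≤ 1) {x : Pt d}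
    (hx : x ∈ body K) {H : Pt d → ℝ≥0∞} (hH : Measurable H) :
    ∫⁻ y in body K, H (contract r y x) ≤ ENNReal.ofReal ((r ^ d)⁻¹) * ∫⁻ z in body K, H z := by
  have h := map_contract_restrict_le volume (convex_body K) (measurableSet_body K)
    (a := 1 - r) (by linarith) (by linarith) hx
  have e : ∀ y : Pt d, contract r y x = contract (1 - r) x y := by
    intro y
    simp only [contract]
    module
  simp only [e]
  rw [← lintegral_map hH (measurable_contract _ _)]
  refine (lintegral_mono' h le_rfl).trans ?_
  rw [lintegral_smul_measure]
  simp

/-- The radius attached to the value `a` of the weight. -/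
def weightRadius (d : ℕ) (a : ℝ) : ℝ := a ^ (-(1 / (d : ℝ)))

theorem weightRadius_spec {a : ℝ} (ha : 1 ≤ a) : 0 < weightRadius d a ∧ weightRadius d a ≤ 1 ∧
    weightRadius d a ^ d = a⁻¹ := by
  have hd0 : (d : ℝ) ≠ 0 := by exact_mod_cast NeZero.ne d
  have ha0 : 0 < a := by linarith
  refine ⟨Real.rpow_pos_of_pos ha0 _, Real.rpow_le_one_of_one_le_of_nonpos ha (by simp), ?_⟩
  rw [weightRadius, ← Real.rpow_natCast, ← Real.rpow_mul ha0.le]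
  have : -(1 / (d : ℝ)) * (d : ℝ) = -1 := by field_simp
  rw [this, Real.rpow_neg_one]

theorem weight_mul_average_le (K : Elt d) {a : ℝ} (ha : 1 ≤ a) {x : Pt d} (hx : x ∈ body K)
    {f : Pt d → ℝ} (hf : Measurable f) :
    ENNReal.ofReal a * ∫⁻ y in body K, ‖f (contract (weightRadius d a) y x)‖ₑ ≤
      ENNReal.ofReal (a ^ (3 / 2 : ℝ)) *
        (eLpNorm (fun _ : Pt d => (1 : ℝ)) 2 (volume.restrict (body K)) *
          eLpNorm f 2 (volume.restrict (body K))) := by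
  obtain ⟨hr0, hr1, hrd⟩ := weightRadius_spec (d := d) ha
  have ha0 : 0 < a := by linarith
  have hfx : Measurable fun y => f (contract (weightRadius d a) y x) := by
    unfold contract
    fun_prop
  have hcs := lintegral_enorm_mul_le (μ := volume.restrict (body K)) hfx.aestronglyMeasurable
    (aestronglyMeasurable_const (b := (1 : ℝ)))
  have hsq : eLpNorm (fun y => f (contract (weightRadius d a) y x)) 2 (volume.restrict (body K)) ≤
      ENNReal.ofReal (a ^ (1 / 2 : ℝ)) * eLpNorm f 2 (volume.restrict (body K)) := by
    rw [← ENNReal.pow_le_pow_left_iff two_ne_zero, mul_pow, eLpNorm_two_sq, eLpNorm_two_sq]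
    refine (lintegral_contract_le K hr0 hr1 hx (H := fun z => ‖f z‖ₑ ^ 2)
      (hf.enorm.pow_const 2)).trans (le_of_eq ?_)
    congr 1
    rw [hrd, inv_inv, ← ENNReal.ofReal_pow (Real.rpow_nonneg ha0.le _), ← Real.rpow_natCast,
      ← Real.rpow_mul ha0.le]
    norm_num
  simp only [enorm_one, mul_one] at hcs
  calc ENNReal.ofReal a * ∫⁻ y in body K, ‖f (contract (weightRadius d a) y x)‖ₑ
      ≤ ENNReal.ofReal a * (ENNReal.ofReal (a ^ (1 / 2 : ℝ)) *
          eLpNorm f 2 (volume.restrict (body K)) *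
          eLpNorm (fun _ : Pt d => (1 : ℝ)) 2 (volume.restrict (body K))) :=
        mul_le_mul_right (hcs.trans (mul_le_mul_left hsq _)) _
    _ = ENNReal.ofReal (a * a ^ (1 / 2 : ℝ)) *
          (eLpNorm (fun _ : Pt d => (1 : ℝ)) 2 (volume.restrict (body K)) *
            eLpNorm f 2 (volume.restrict (body K))) := by
        rw [ENNReal.ofReal_mul ha0.le]
        ring
    _ = _ := by
        have : a * a ^ (1 / 2 : ℝ) = a ^ (3 / 2 : ℝ) := by
          nth_rw 1 [← Real.rpow_one a]
          rw [← Real.rpow_add ha0]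
          norm_num
        rw [this]

theorem measurable_quot (s : ℝ) {f : Pt d → ℝ} (hf : Measurable f) : Measurable (quot s f) := by
  unfold quot
  exact ((hf.comp measurable_fst).sub (hf.comp measurable_snd)).div
    ((measurable_fst.sub measurable_snd).norm.pow_const _)

/-- The difference quotient along the contraction, in the scaling of the weight. -/
def weightQuot (s : ℝ) (f g : Pt d → ℝ) (z : Pt d × Pt d) : ℝ :=
  quot s f (z.1, contract (weightRadius d (g z.1)) z.2 z.1) * √((g z.1)⁻¹)

/-- The factor complementary to `weightQuot`. -/
def weightDist (s : ℝ) (g : Pt d → ℝ) (z : Pt d × Pt d) : ℝ :=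
  g z.1 * (√((g z.1)⁻¹))⁻¹ *
    ‖z.1 - contract (weightRadius d (g z.1)) z.2 z.1‖ ^ (((d : ℝ) + 2 * s) / 2)

theorem measurable_weight_contract {g : Pt d → ℝ} (hg : Measurable g) :
    Measurable fun z : Pt d × Pt d => contract (weightRadius d (g z.1)) z.2 z.1 := by
  unfold contract weightRadius
  fun_prop

theorem measurable_weightQuot (s : ℝ) {f g : Pt d → ℝ} (hf : Measurable f) (hg : Measurable g) :
    Measurable (weightQuot s f g) :=
  ((measurable_quot s hf).comp (measurable_fst.prodMk (measurable_weight_contract hg))).mul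
    (hg.comp measurable_fst).inv.sqrt

theorem measurable_weightDist (s : ℝ) {g : Pt d → ℝ} (hg : Measurable g) :
    Measurable (weightDist s g) :=
  ((hg.comp measurable_fst).mul (hg.comp measurable_fst).inv.sqrt.inv).mul
    ((measurable_fst.sub (measurable_weight_contract hg)).norm.pow_const _)

theorem weightQuot_mul_weightDist (s : ℝ) (f : Pt d → ℝ) {g : Pt d → ℝ} {x : Pt d}
    (hx : 1 ≤ g x) (y : Pt d) : weightQuot s f g (x, y) * weightDist s g (x, y) =
      g x * (f x - f (contract (weightRadius d (g x)) y x)) := by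
  have hgx : 0 < g x := by linarith
  simp only [weightQuot, weightDist, quot]
  by_cases hxc : x - contract (weightRadius d (g x)) y x = 0
  · rw [← sub_eq_zero.1 hxc]
    simp
  · have hne : ‖x - contract (weightRadius d (g x)) y x‖ ^ (((d : ℝ) + 2 * s) / 2) ≠ 0 :=
      (Real.rpow_pos_of_pos (norm_pos_iff.2 hxc) _).ne'
    have hsq : √((g x)⁻¹) ≠ 0 := (Real.sqrt_pos.2 (inv_pos.2 hgx)).ne'
    generalize √((g x)⁻¹) = b at hsq ⊢
    generalize ‖x - contract (weightRadius d (g x)) y x‖ ^ (((d : ℝ) + 2 * s) / 2) = c at hne ⊢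
    field_simp

theorem lintegral_weightQuot_le (K : Elt d) (s : ℝ) {f g : Pt d → ℝ} (hf : Measurable f)
    {x : Pt d} (hx : 1 ≤ g x) (hxK : x ∈ body K) :
    ∫⁻ y in body K, ‖weightQuot s f g (x, y)‖ₑ ^ 2 ≤
      ∫⁻ z in body K, ENNReal.ofReal ((f x - f z) ^ 2 / ‖x - z‖ ^ ((d : ℝ) + 2 * s)) := by
  obtain ⟨hr0, hr1, hrd⟩ := weightRadius_spec (d := d) hx
  have hgx : 0 < g x := by linarith
  have e3 : ∀ y, ‖weightQuot s f g (x, y)‖ₑ ^ 2 = ENNReal.ofReal ((g x)⁻¹) *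
      ‖quot s f (x, contract (weightRadius d (g x)) y x)‖ₑ ^ 2 := by
    intro y
    simp only [weightQuot]
    rw [enorm_mul, mul_pow, mul_comm, Real.enorm_of_nonneg (Real.sqrt_nonneg _),
      ← ENNReal.ofReal_pow (Real.sqrt_nonneg _), Real.sq_sqrt (inv_nonneg.2 hgx.le)]
  simp only [e3]
  rw [lintegral_const_mul' _ _ ENNReal.ofReal_ne_top]
  have e4 := lintegral_contract_le K hr0 hr1 hxK (H := fun z => ‖quot s f (x, z)‖ₑ ^ 2)
    (((measurable_quot s hf).comp measurable_prodMk_left).enorm.pow_const 2)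
  refine (mul_le_mul_right e4 _).trans (le_of_eq ?_)
  rw [hrd, ← mul_assoc, ← ENNReal.ofReal_mul (inv_nonneg.2 hgx.le), inv_inv,
    inv_mul_cancel₀ hgx.ne', ENNReal.ofReal_one, one_mul]
  simp only [enorm_quot_sq]

theorem lintegral_weightDist_le (K : Elt d) {s : ℝ} (hs : 0 < s) {g : Pt d → ℝ} {x : Pt d}
    (hx : 1 ≤ g x) (hxK : x ∈ body K) :
    ∫⁻ y in body K, ‖weightDist s g (x, y)‖ₑ ^ 2 ≤
      ENNReal.ofReal (Metric.diam (body K) ^ ((d : ℝ) + 2 * s)) * volume (body K) *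
        ENNReal.ofReal (g x ^ (2 - 2 * s / d)) := by
  obtain ⟨hr0, hr1, hrd⟩ := weightRadius_spec (d := d) hx
  have hd0 : (d : ℝ) ≠ 0 := by exact_mod_cast NeZero.ne d
  have hgx : 0 < g x := by linarith
  set D := Metric.diam (body K) with hD
  have hD0 : 0 ≤ D := Metric.diam_nonneg
  have hp : (0 : ℝ) ≤ (d : ℝ) + 2 * s := by positivity
  set r := weightRadius d (g x) with hr
  have e4 : ∀ y ∈ body K, ‖weightDist s g (x, y)‖ₑ ^ 2 ≤
      ENNReal.ofReal (D ^ ((d : ℝ) + 2 * s) * g x ^ (2 - 2 * s / d)) := by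
    intro y hy
    have hn : ‖x - contract r y x‖ ≤ r * D := by
      have : x - contract r y x = r • (x - y) := by
        simp only [contract]
        module
      rw [this, norm_smul, Real.norm_of_nonneg hr0.le, ← dist_eq_norm]
      exact mul_le_mul_of_nonneg_left
        (Metric.dist_le_diam_of_mem (isCompact_body K).isBounded hxK hy) hr0.le
    rw [← ofReal_norm_eq_enorm, ← ENNReal.ofReal_pow (norm_nonneg _)]
    refine ENNReal.ofReal_le_ofReal ?_
    have e5 : ‖weightDist s g (x, y)‖ ^ 2 =
        g x ^ 3 * ‖x - contract r y x‖ ^ ((d : ℝ) + 2 * s) := by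
      rw [Real.norm_eq_abs, sq_abs]
      simp only [weightDist, ← hr]
      rw [mul_pow, mul_pow, inv_pow, Real.sq_sqrt (inv_nonneg.2 hgx.le), inv_inv,
        ← Real.rpow_natCast (_ ^ _) 2, ← Real.rpow_mul (norm_nonneg _)]
      push_cast
      rw [div_mul_cancel₀ _ (two_ne_zero)]
      ring
    rw [e5]
    calc g x ^ 3 * ‖x - contract r y x‖ ^ ((d : ℝ) + 2 * s)
        ≤ g x ^ 3 * (r * D) ^ ((d : ℝ) + 2 * s) :=
          mul_le_mul_of_nonneg_left (Real.rpow_le_rpow (norm_nonneg _) hn hp) (pow_nonneg hgx.le 3)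
      _ = D ^ ((d : ℝ) + 2 * s) * (g x ^ (3 : ℝ) * r ^ ((d : ℝ) + 2 * s)) := by
        have h3 : g x ^ 3 = g x ^ (3 : ℝ) := by
          rw [← Real.rpow_natCast (g x) 3]
          norm_num
        rw [Real.mul_rpow hr0.le hD0, h3]
        ring
      _ = D ^ ((d : ℝ) + 2 * s) * g x ^ (2 - 2 * s / d) := by
        rw [hr, weightRadius, ← Real.rpow_mul hgx.le, ← Real.rpow_add hgx]
        congr 2
        field_simp
        ring
  calc ∫⁻ y in body K, ‖weightDist s g (x, y)‖ₑ ^ 2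
      ≤ ∫⁻ _ in body K, ENNReal.ofReal (D ^ ((d : ℝ) + 2 * s) * g x ^ (2 - 2 * s / d)) :=
        setLIntegral_mono' (measurableSet_body K) e4
    _ = _ := by
        rw [setLIntegral_const, ENNReal.ofReal_mul (Real.rpow_nonneg hD0 _)]
        ring

theorem eLpNorm_le_rpow_half {X : Type*} [MeasurableSpace X] {μ : Measure X} {F : X → ℝ}
    {I : ℝ≥0∞} (h : ∫⁻ x, ‖F x‖ₑ ^ 2 ∂μ ≤ I) : eLpNorm F 2 μ ≤ I ^ (1 / 2 : ℝ) := by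
  rw [← eLpNorm_two_sq] at h
  have := ENNReal.rpow_le_rpow h (by norm_num : (0 : ℝ) ≤ 1 / 2)
  rwa [← ENNReal.rpow_natCast, ← ENNReal.rpow_mul, show ((2 : ℕ) : ℝ) * (1 / 2) = 1 by norm_num,
    ENNReal.rpow_one] at this

theorem lintegral_weight_mul_oscillation_le (K : Elt d) {s : ℝ} (hs : 0 < s) {f g : Pt d → ℝ}
    (hf : Measurable f) (hg : Measurable g)
    (hg1 : ∀ᵐ x ∂(volume.restrict (body K)), 1 ≤ g x) :
    ∫⁻ x in body K, ENNReal.ofReal (g x) *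
      ∫⁻ y in body K, ‖f x - f (contract (weightRadius d (g x)) y x)‖ₑ ≤
        slobodeckijSq s (body K) f ^ (1 / 2 : ℝ) *
        (∫⁻ x in body K, ENNReal.ofReal (Metric.diam (body K) ^ ((d : ℝ) + 2 * s)) *
          volume (body K) * ENNReal.ofReal (g x ^ (2 - 2 * s / d))) ^ (1 / 2 : ℝ) := by
  have hm1 := measurable_weightQuot s hf hg
  have hm2 := measurable_weightDist s hg
  have hxK := ae_restrict_mem (μ := (volume : Measure (Pt d))) (measurableSet_body K)
  have e1 : ∫⁻ x in body K, ENNReal.ofReal (g x) *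
      ∫⁻ y in body K, ‖f x - f (contract (weightRadius d (g x)) y x)‖ₑ ≤
      ∫⁻ z, ‖weightQuot s f g z‖ₑ * ‖weightDist s g z‖ₑ
        ∂((volume.restrict (body K)).prod (volume.restrict (body K))) := by
    rw [lintegral_prod (fun z => ‖weightQuot s f g z‖ₑ * ‖weightDist s g z‖ₑ)
      (hm1.enorm.mul hm2.enorm).aemeasurable]
    refine lintegral_mono_ae ?_
    filter_upwards [hg1] with x hx
    have hgx : 0 < g x := by linarith
    rw [← lintegral_const_mul' _ _ ENNReal.ofReal_ne_top]
    refine lintegral_mono fun y => ?_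
    rw [← enorm_mul, weightQuot_mul_weightDist s f hx, enorm_mul, Real.enorm_of_nonneg hgx.le]
  refine e1.trans ((lintegral_enorm_mul_le hm1.aestronglyMeasurable
    hm2.aestronglyMeasurable).trans (mul_le_mul' ?_ ?_))
  · refine eLpNorm_le_rpow_half ?_
    rw [lintegral_prod (fun z => ‖weightQuot s f g z‖ₑ ^ 2) (hm1.enorm.pow_const 2).aemeasurable]
    refine lintegral_mono_ae ?_
    filter_upwards [hg1, hxK] with x hx hxK
    exact lintegral_weightQuot_le K s hf hx hxK
  · refine eLpNorm_le_rpow_half ?_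
    rw [lintegral_prod (fun z => ‖weightDist s g z‖ₑ ^ 2) (hm2.enorm.pow_const 2).aemeasurable]
    refine lintegral_mono_ae ?_
    filter_upwards [hg1, hxK] with x hx hxK
    exact lintegral_weightDist_le K hs hx hxK

/-- The weighted inequality, for measurable functions and general weights. -/
theorem exists_lintegral_mul_weight_le (K : Elt d) {s : ℝ} (hs : 0 < s) {g : Pt d → ℝ}
    (hg : Measurable g) (hg1 : ∀ᵐ x ∂(volume.restrict (body K)), 1 ≤ g x)
    (h1 : ∫⁻ x in body K, ENNReal.ofReal (g x ^ (3 / 2 : ℝ)) < ⊤)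
    (h2 : ∫⁻ x in body K, ENNReal.ofReal (g x ^ (2 - 2 * s / d)) < ⊤) :
    ∃ C : ℝ≥0∞, C ≠ ⊤ ∧ ∀ f : Pt d → ℝ, Measurable f →
      ∫⁻ x in body K, ‖f x‖ₑ * ENNReal.ofReal (g x) ≤
        C * (eLpNorm f 2 (volume.restrict (body K)) + slobodeckijSq s (body K) f ^ (1 / 2 : ℝ)) := by
  set κ := volume (body K) with hκ
  have hκ0 : κ ≠ 0 := by
    have : 0 < volume (interior (body K)) :=
      isOpen_interior.measure_pos _ (exists_mem_interior_body K)
    exact (lt_of_lt_of_le this (measure_mono interior_subset)).ne'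
  have hκt : κ ≠ ⊤ := (volume_body_lt_top K).ne
  set I1 := ∫⁻ x in body K, ENNReal.ofReal (g x ^ (3 / 2 : ℝ)) with hI1
  set I2 := ∫⁻ x in body K, ENNReal.ofReal (Metric.diam (body K) ^ ((d : ℝ) + 2 * s)) * κ *
    ENNReal.ofReal (g x ^ (2 - 2 * s / d)) with hI2
  have hI2t : I2 ≠ ⊤ := by
    rw [hI2, lintegral_const_mul' _ _ (ENNReal.mul_ne_top ENNReal.ofReal_ne_top hκt)]
    exact ENNReal.mul_ne_top (ENNReal.mul_ne_top ENNReal.ofReal_ne_top hκt) h2.ne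
  set E := eLpNorm (fun _ : Pt d => (1 : ℝ)) 2 (volume.restrict (body K)) with hE
  have hone : E ≠ ⊤ := (Continuous.memLp_body (continuous_const (y := (1 : ℝ))) K).2.ne
  refine ⟨κ⁻¹ * (I1 * E + I2 ^ (1 / 2 : ℝ)),
    ENNReal.mul_ne_top (ENNReal.inv_ne_top.2 hκ0) (ENNReal.add_ne_top.2
      ⟨ENNReal.mul_ne_top h1.ne hone, ENNReal.rpow_ne_top_of_nonneg (by norm_num) hI2t⟩),
    fun f hf => ?_⟩
  set N := eLpNorm f 2 (volume.restrict (body K)) with hN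
  have hfc : Measurable fun z : Pt d × Pt d => f (contract (weightRadius d (g z.1)) z.2 z.1) :=
    hf.comp (measurable_weight_contract hg)
  have e1 : ∀ x, κ * (‖f x‖ₑ * ENNReal.ofReal (g x)) ≤
      ENNReal.ofReal (g x) * (∫⁻ y in body K, ‖f (contract (weightRadius d (g x)) y x)‖ₑ) +
        ENNReal.ofReal (g x) *
          ∫⁻ y in body K, ‖f x - f (contract (weightRadius d (g x)) y x)‖ₑ := by
    intro x
    have hfx : Measurable fun y => f (contract (weightRadius d (g x)) y x) := by
      unfold contract
      fun_prop
    have hc : ‖f x‖ₑ * κ = ∫⁻ _ in body K, ‖f x‖ₑ := by rw [setLIntegral_const]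
    have hc' : κ * (‖f x‖ₑ * ENNReal.ofReal (g x)) = ENNReal.ofReal (g x) * (‖f x‖ₑ * κ) := by
      rw [mul_comm, mul_comm ‖f x‖ₑ, mul_assoc]
    have htri : ∀ y, ‖f x‖ₑ ≤ ‖f (contract (weightRadius d (g x)) y x)‖ₑ +
        ‖f x - f (contract (weightRadius d (g x)) y x)‖ₑ := by
      intro y
      have := enorm_add_le (f (contract (weightRadius d (g x)) y x))
        (f x - f (contract (weightRadius d (g x)) y x))
      rwa [add_sub_cancel] at this
    rw [hc', hc, ← mul_add, ← lintegral_add_left hfx.enorm]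
    exact mul_le_mul_right (lintegral_mono htri) _
  have hmeas : Measurable fun x => ENNReal.ofReal (g x) *
      (∫⁻ y in body K, ‖f (contract (weightRadius d (g x)) y x)‖ₑ) :=
    hg.ennreal_ofReal.mul hfc.enorm.lintegral_prod_right'
  have hA : ∫⁻ x in body K, ENNReal.ofReal (g x) *
      (∫⁻ y in body K, ‖f (contract (weightRadius d (g x)) y x)‖ₑ) ≤ I1 * (E * N) := by
    rw [hI1, ← lintegral_mul_const (E * N) (hg.pow_const _).ennreal_ofReal]
    refine lintegral_mono_ae ?_
    filter_upwards [hg1, ae_restrict_mem (measurableSet_body K)] with x hx hxK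
    exact weight_mul_average_le K hx hxK hf
  have hfin : κ * ∫⁻ x in body K, ‖f x‖ₑ * ENNReal.ofReal (g x) ≤
      (I1 * E + I2 ^ (1 / 2 : ℝ)) * (N + slobodeckijSq s (body K) f ^ (1 / 2 : ℝ)) := by
    rw [← lintegral_const_mul' _ _ hκt]
    refine (lintegral_mono e1).trans ?_
    rw [lintegral_add_left hmeas]
    refine (add_le_add hA (lintegral_weight_mul_oscillation_le K hs hf hg hg1)).trans ?_
    rw [← mul_assoc, mul_comm (_ ^ _) (_ ^ _), mul_add, add_mul, add_mul]
    exact add_le_add le_self_add le_add_self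
  calc ∫⁻ x in body K, ‖f x‖ₑ * ENNReal.ofReal (g x)
      = κ⁻¹ * (κ * ∫⁻ x in body K, ‖f x‖ₑ * ENNReal.ofReal (g x)) := by
        rw [← mul_assoc, ENNReal.inv_mul_cancel hκ0 hκt, one_mul]
    _ ≤ κ⁻¹ * ((I1 * E + I2 ^ (1 / 2 : ℝ)) *
          (N + slobodeckijSq s (body K) f ^ (1 / 2 : ℝ))) := mul_le_mul_right hfin _
    _ = _ := by rw [mul_assoc]

/-- The weighted inequality that makes the normal traces of `H^s` tensor fields well defined. -/
theorem exists_lintegral_cutoff_weight_le (hd : 2 ≤ d) (K : Elt d) {i j : Fin (d + 1)}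
    (hij : j ≠ i) {s : ℝ} (hs : 0 < s) (hs1 : s < 1) :
    ∃ C : ℝ≥0∞, C ≠ ⊤ ∧ ∀ f : Pt d → ℝ, AEStronglyMeasurable f (volume.restrict (body K)) →
      ∫⁻ x in body K, ‖f x‖ₑ * ENNReal.ofReal ((√(lam K i x * lam K j x))⁻¹) ≤
        C * (eLpNorm f 2 (volume.restrict (body K)) + slobodeckijSq s (body K) f ^ (1 / 2 : ℝ)) := by
  have hd2 : (2 : ℝ) ≤ d := by exact_mod_cast hd
  have hpow : ∀ᵐ x ∂(volume.restrict (body K)), ∀ β : ℝ,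
      (√(lam K i x * lam K j x))⁻¹ ^ β = (lam K i x * lam K j x) ^ (-(β / 2)) := by
    filter_upwards [ae_lam_pos K] with x hx β
    have hp := mul_pos (hx i) (hx j)
    rw [Real.sqrt_eq_rpow, ← Real.rpow_neg hp.le, ← Real.rpow_mul hp.le]
    congr 1
    ring
  have hfin : ∀ β : ℝ, 0 < β → β < 2 →
      ∫⁻ x in body K, ENNReal.ofReal ((√(lam K i x * lam K j x))⁻¹ ^ β) < ⊤ := by
    intro β h0 h2
    refine lt_of_le_of_lt (le_of_eq ?_) (lintegral_lam_mul_lam_rpow_lt_top hd K hij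
      (α := β / 2) (by linarith) (by linarith))
    refine lintegral_congr_ae ?_
    filter_upwards [hpow] with x hx
    rw [hx]
  have hsd : 0 < 2 * s / d := by positivity
  have hsd1 : 2 * s / d < 2 := by
    rw [div_lt_iff₀ (by linarith)]
    nlinarith
  obtain ⟨C, hC, h⟩ := exists_lintegral_mul_weight_le K hs
    (g := fun x => (√(lam K i x * lam K j x))⁻¹)
    ((continuous_lam K i).mul (continuous_lam K j)).measurable.sqrt.inv (by
      filter_upwards [ae_lam_pos K, ae_restrict_mem (measurableSet_body K)] with x hx hxK
      have hp := mul_pos (hx i) (hx j)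
      refine (one_le_inv₀ (Real.sqrt_pos.2 hp)).2 ?_
      refine Real.sqrt_le_one.2 ?_
      exact mul_le_one₀ (lam_mem_Icc K hxK i).2 (hx j).le (lam_mem_Icc K hxK j).2)
    (hfin _ (by norm_num) (by norm_num)) (hfin _ (by linarith) (by linarith))
  refine ⟨C, hC, fun f hf => ?_⟩
  have hae := hf.ae_eq_mk
  rw [eLpNorm_congr_ae hae, slobodeckijSq_congr s hae]
  refine le_trans (le_of_eq ?_) (h _ hf.stronglyMeasurable_mk.measurable)
  refine lintegral_congr_ae ?_
  filter_upwards [hae] with x hx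
  rw [← hx]

/-! ### Normal pairings -/

theorem lintegral_enorm_le_eLpNorm (K : Elt d) {f : Pt d → ℝ}
    (hf : AEStronglyMeasurable f (volume.restrict (body K))) :
    ∫⁻ x in body K, ‖f x‖ₑ ≤ eLpNorm f 2 (volume.restrict (body K)) *
      eLpNorm (fun _ : Pt d => (1 : ℝ)) 2 (volume.restrict (body K)) := by
  have := lintegral_enorm_mul_le hf (aestronglyMeasurable_const (b := (1 : ℝ)))
  simpa only [enorm_one, mul_one] using this

theorem exists_bound_body (K : Elt d) {g : Pt d → ℝ} (hg : Continuous g) :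
    ∃ B : ℝ, 0 ≤ B ∧ ∀ x ∈ body K, |g x| ≤ B := by
  obtain ⟨B, hB⟩ := (isCompact_body K).exists_bound_of_continuousOn hg.continuousOn
  exact ⟨max B 0, le_max_right _ _, fun x hx => (hB x hx).trans (le_max_left _ _)⟩

/-- The norm in which the boundary pairings are continuous. -/
def rowNorm (s : ℝ) (K : Elt d) (V : Fin d → Pt d → ℝ) (D : Pt d → ℝ) : ℝ≥0∞ :=
  eLpNorm D 2 (volume.restrict (body K)) +
    ∑ c, (eLpNorm (V c) 2 (volume.restrict (body K)) + slobodeckijSq s (body K) (V c) ^ (1 / 2 : ℝ))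

/-- The cut off boundary pairings are bounded uniformly. -/
theorem IsCutoff.exists_rowPairing_le (hd : 2 ≤ d) {K : Elt d} {i : Fin (d + 1)}
    {χ : ℕ → Pt d → ℝ} (hχ : IsCutoff K i χ) {ψ : Pt d → ℝ} (hψ : Smooth ψ) {s : ℝ} (hs : 0 < s)
    (hs1 : s < 1) : ∃ C : ℝ≥0∞, C ≠ ⊤ ∧ ∀ (V : Fin d → Pt d → ℝ) (D : Pt d → ℝ),
      (∀ c, MemLp (V c) 2 (volume.restrict (body K))) →
      MemLp D 2 (volume.restrict (body K)) → ∀ n,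
      ‖rowPairing K V D fun y => ψ y * χ n y‖ₑ ≤ C * rowNorm s K V D := by
  have hW : ∀ l, ∃ C : ℝ≥0∞, C ≠ ⊤ ∧ (l ≠ i → ∀ f : Pt d → ℝ,
      AEStronglyMeasurable f (volume.restrict (body K)) →
      ∫⁻ x in body K, ‖f x‖ₑ * ENNReal.ofReal ((√(lam K i x * lam K l x))⁻¹) ≤
        C * (eLpNorm f 2 (volume.restrict (body K)) +
          slobodeckijSq s (body K) f ^ (1 / 2 : ℝ))) := by
    intro l
    by_cases hl : l = i
    · exact ⟨0, ENNReal.zero_ne_top, fun h => absurd hl h⟩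
    · obtain ⟨C, h1, h2⟩ := exists_lintegral_cutoff_weight_le hd K hl hs hs1
      exact ⟨C, h1, fun _ => h2⟩
  choose Cw hCw hW using hW
  obtain ⟨Cχ, hCχ, hbd⟩ := hχ.bound
  obtain ⟨B, hB0, hB⟩ := exists_bound_body K hψ.continuous
  choose Bc hBc0 hBc using fun c => exists_bound_body K (hψ.continuous_pd c)
  set E := eLpNorm (fun _ : Pt d => (1 : ℝ)) 2 (volume.restrict (body K)) with hE
  have hEt : E ≠ ⊤ := (Continuous.memLp_body (continuous_const (y := (1 : ℝ))) K).2.ne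
  set Cc : Fin d → ℝ≥0∞ := fun c => ENNReal.ofReal (Bc c) * E +
    ENNReal.ofReal (B * Cχ) * ∑ l ∈ Finset.univ.erase i, Cw l with hCc
  have hCct : ∀ c, Cc c ≠ ⊤ := fun c => ENNReal.add_ne_top.2
    ⟨ENNReal.mul_ne_top ENNReal.ofReal_ne_top hEt, ENNReal.mul_ne_top ENNReal.ofReal_ne_top
      (ENNReal.sum_ne_top.2 fun l _ => hCw l)⟩
  refine ⟨ENNReal.ofReal B * E + ∑ c, Cc c, ENNReal.add_ne_top.2
    ⟨ENNReal.mul_ne_top ENNReal.ofReal_ne_top hEt, ENNReal.sum_ne_top.2 fun c _ => hCct c⟩,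
    fun V D hV hD n => ?_⟩
  have hφ : Smooth fun y => ψ y * χ n y := hψ.mul (hχ.smooth n)
  have hD1 : ∫⁻ x in body K, ‖D x * (ψ x * χ n x)‖ₑ ≤
      ENNReal.ofReal B * E * eLpNorm D 2 (volume.restrict (body K)) := by
    calc ∫⁻ x in body K, ‖D x * (ψ x * χ n x)‖ₑ
        ≤ ∫⁻ x in body K, ENNReal.ofReal B * ‖D x‖ₑ := by
          refine setLIntegral_mono' (measurableSet_body K) fun x hx => ?_
          rw [enorm_mul, mul_comm]
          refine mul_le_mul_left ?_ _
          rw [← ofReal_norm_eq_enorm]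
          refine ENNReal.ofReal_le_ofReal ?_
          rw [norm_mul, Real.norm_of_nonneg (hχ.nonneg n x)]
          exact (mul_le_of_le_one_right (norm_nonneg _) (hχ.le_one n x)).trans (hB x hx)
      _ = ENNReal.ofReal B * ∫⁻ x in body K, ‖D x‖ₑ :=
          lintegral_const_mul' _ _ ENNReal.ofReal_ne_top
      _ ≤ ENNReal.ofReal B * (eLpNorm D 2 (volume.restrict (body K)) * E) :=
          mul_le_mul_right (lintegral_enorm_le_eLpNorm K hD.1) _
      _ = _ := by ring
  have hV1 : ∀ c, ∫⁻ x in body K, ‖V c x * pd c (fun y => ψ y * χ n y) x‖ₑ ≤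
      Cc c * (eLpNorm (V c) 2 (volume.restrict (body K)) +
        slobodeckijSq s (body K) (V c) ^ (1 / 2 : ℝ)) := by
    intro c
    set N := eLpNorm (V c) 2 (volume.restrict (body K)) +
      slobodeckijSq s (body K) (V c) ^ (1 / 2 : ℝ) with hN
    calc ∫⁻ x in body K, ‖V c x * pd c (fun y => ψ y * χ n y) x‖ₑ
        ≤ ∫⁻ x in body K, (ENNReal.ofReal (Bc c) * ‖V c x‖ₑ + ∑ l ∈ Finset.univ.erase i,
            ENNReal.ofReal (B * Cχ) *
              (‖V c x‖ₑ * ENNReal.ofReal ((√(lam K i x * lam K l x))⁻¹))) := by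
          refine lintegral_mono_ae ?_
          filter_upwards [ae_lam_pos K, ae_restrict_mem (measurableSet_body K)] with x hx hxK
          have h1 : |pd c (fun y => ψ y * χ n y) x| ≤ Bc c + B * Cχ *
              ∑ l ∈ Finset.univ.erase i, (√(lam K i x * lam K l x))⁻¹ := by
            rw [pd_mul hψ (hχ.smooth n)]
            refine (abs_add_le _ _).trans (add_le_add ?_ ?_)
            · rw [abs_mul, abs_of_nonneg (hχ.nonneg n x)]
              exact (mul_le_of_le_one_right (abs_nonneg _) (hχ.le_one n x)).trans (hBc c x hxK)
            · rw [abs_mul, mul_assoc]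
              exact mul_le_mul (hB x hxK) (hbd n c x hx) (abs_nonneg _) hB0
          have h2 : ∀ l, 0 ≤ (√(lam K i x * lam K l x))⁻¹ := fun l =>
            inv_nonneg.2 (Real.sqrt_nonneg _)
          have h3 : ‖pd c (fun y => ψ y * χ n y) x‖ₑ ≤ ENNReal.ofReal (Bc c) +
              ENNReal.ofReal (B * Cχ) * ∑ l ∈ Finset.univ.erase i,
                ENNReal.ofReal ((√(lam K i x * lam K l x))⁻¹) := by
            rw [← ENNReal.ofReal_sum_of_nonneg fun l _ => h2 l,
              ← ENNReal.ofReal_mul (mul_nonneg hB0 hCχ), ← ENNReal.ofReal_add (hBc0 c)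
                (mul_nonneg (mul_nonneg hB0 hCχ) (Finset.sum_nonneg fun l _ => h2 l)),
              ← ofReal_norm_eq_enorm]
            exact ENNReal.ofReal_le_ofReal h1
          rw [enorm_mul]
          refine (mul_le_mul_right h3 _).trans (le_of_eq ?_)
          rw [mul_add, Finset.mul_sum, Finset.mul_sum, mul_comm]
          congr 1
          exact Finset.sum_congr rfl fun l _ => by ring
      _ = ENNReal.ofReal (Bc c) * (∫⁻ x in body K, ‖V c x‖ₑ) + ∑ l ∈ Finset.univ.erase i,
            ENNReal.ofReal (B * Cχ) * ∫⁻ x in body K,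
              ‖V c x‖ₑ * ENNReal.ofReal ((√(lam K i x * lam K l x))⁻¹) := by
          have hm : ∀ l, AEMeasurable (fun x => ‖V c x‖ₑ *
              ENNReal.ofReal ((√(lam K i x * lam K l x))⁻¹)) (volume.restrict (body K)) := fun l =>
            (hV c).1.enorm.mul ((((continuous_lam K i).mul
              (continuous_lam K l)).measurable.sqrt.inv).ennreal_ofReal.aemeasurable)
          rw [lintegral_add_left' ((hV c).1.enorm.const_mul _),
            lintegral_finset_sum' _ fun l _ => (hm l).const_mul _,
            lintegral_const_mul' _ _ ENNReal.ofReal_ne_top]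
          simp only [lintegral_const_mul' _ _ ENNReal.ofReal_ne_top]
      _ ≤ ENNReal.ofReal (Bc c) * (N * E) + ∑ l ∈ Finset.univ.erase i,
            ENNReal.ofReal (B * Cχ) * (Cw l * N) := by
          refine add_le_add (mul_le_mul_right ((lintegral_enorm_le_eLpNorm K (hV c).1).trans
            (mul_le_mul_left le_self_add _)) _) (Finset.sum_le_sum fun l hl => ?_)
          exact mul_le_mul_right (hW l (Finset.ne_of_mem_erase hl) _ (hV c).1) _
      _ = Cc c * N := by
          rw [hCc, ← Finset.mul_sum, ← Finset.sum_mul]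
          ring
  calc ‖rowPairing K V D fun y => ψ y * χ n y‖ₑ
      ≤ ∫⁻ x in body K, ‖D x * (ψ x * χ n x) +
          ∑ c, V c x * pd c (fun y => ψ y * χ n y) x‖ₑ := enorm_integral_le_lintegral_enorm _
    _ ≤ ∫⁻ x in body K, (‖D x * (ψ x * χ n x)‖ₑ +
          ∑ c, ‖V c x * pd c (fun y => ψ y * χ n y) x‖ₑ) :=
        lintegral_mono fun x => (enorm_add_le _ _).trans
          (add_le_add le_rfl (enorm_sum_le _ _))
    _ = (∫⁻ x in body K, ‖D x * (ψ x * χ n x)‖ₑ) +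
          ∑ c, ∫⁻ x in body K, ‖V c x * pd c (fun y => ψ y * χ n y) x‖ₑ := by
        have hmD : AEMeasurable (fun x => ‖D x * (ψ x * χ n x)‖ₑ) (volume.restrict (body K)) :=
          (hD.1.mul hφ.continuous.aestronglyMeasurable).enorm
        have hmV : ∀ c ∈ Finset.univ, AEMeasurable
            (fun x => ‖V c x * pd c (fun y => ψ y * χ n y) x‖ₑ) (volume.restrict (body K)) :=
          fun c _ => ((hV c).1.mul (hφ.continuous_pd c).aestronglyMeasurable).enorm
        rw [lintegral_add_left' hmD, lintegral_finset_sum' _ hmV]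
    _ ≤ ENNReal.ofReal B * E * rowNorm s K V D + ∑ c, Cc c * rowNorm s K V D := by
        refine add_le_add (hD1.trans (mul_le_mul_right le_self_add _))
          (Finset.sum_le_sum fun c _ => (hV1 c).trans (mul_le_mul_right ?_ _))
        refine le_trans ?_ le_add_self
        exact Finset.single_le_sum (f := fun c => eLpNorm (V c) 2 (volume.restrict (body K)) +
          slobodeckijSq s (body K) (V c) ^ (1 / 2 : ℝ)) (fun _ _ => zero_le) (Finset.mem_univ c)
    _ = _ := by rw [← Finset.sum_mul, ← add_mul]

theorem rowPairing_sub {K : Elt d} {V V' : Fin d → Pt d → ℝ} {D D' φ : Pt d → ℝ}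
    (hV : ∀ c, MemLp (V c) 2 (volume.restrict (body K)))
    (hV' : ∀ c, MemLp (V' c) 2 (volume.restrict (body K)))
    (hD : MemLp D 2 (volume.restrict (body K))) (hD' : MemLp D' 2 (volume.restrict (body K)))
    (hφ : Smooth φ) :
    rowPairing K (fun c x => V c x - V' c x) (fun x => D x - D' x) φ =
      rowPairing K V D φ - rowPairing K V' D' φ := by
  have hφL := Continuous.memLp_body hφ.continuous K
  have hpφ := fun j => Continuous.memLp_body (Smooth.continuous_pd hφ j) K
  have hint : ∀ {V : Fin d → Pt d → ℝ} {D : Pt d → ℝ},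
      (∀ c, MemLp (V c) 2 (volume.restrict (body K))) → MemLp D 2 (volume.restrict (body K)) →
      Integrable (fun x => D x * φ x + ∑ c, V c x * pd c φ x) (volume.restrict (body K)) :=
    fun hV hD => (integrable_fun_mul hD hφL).add
      (integrable_finset_sum _ fun c _ => integrable_fun_mul (hV c) (hpφ c))
  simp only [rowPairing]
  rw [← integral_sub (hint hV hD) (hint hV' hD')]
  refine integral_congr_ae (Eventually.of_forall fun x => ?_)
  simp only [sub_mul, Finset.sum_sub_distrib]
  ring

theorem rowPairing_test_sub {K : Elt d} {V : Fin d → Pt d → ℝ} {D φ φ' : Pt d → ℝ}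
    (hV : ∀ c, MemLp (V c) 2 (volume.restrict (body K)))
    (hD : MemLp D 2 (volume.restrict (body K))) (hφ : Smooth φ) (hφ' : Smooth φ') :
    rowPairing K V D (fun x => φ x - φ' x) = rowPairing K V D φ - rowPairing K V D φ' := by
  have hint : ∀ {φ : Pt d → ℝ}, Smooth φ →
      Integrable (fun x => D x * φ x + ∑ c, V c x * pd c φ x) (volume.restrict (body K)) :=
    fun hφ => (integrable_fun_mul hD (Continuous.memLp_body hφ.continuous K)).add
      (integrable_finset_sum _ fun c _ => integrable_fun_mul (hV c)
        (Continuous.memLp_body (Smooth.continuous_pd hφ c) K))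
  simp only [rowPairing]
  rw [← integral_sub (hint hφ) (hint hφ')]
  refine integral_congr_ae (Eventually.of_forall fun x => ?_)
  simp only [pd_sub hφ hφ', mul_sub, Finset.sum_sub_distrib]
  ring

/-- Interchange of limits. -/
theorem exists_limit_of_uniform_approx {T : ℕ → ℝ} {A : ℕ → ℕ → ℝ} {a e : ℕ → ℝ}
    (he : Tendsto e atTop (𝓝 0)) (hT : ∀ m n, |A m n - T n| ≤ e m)
    (hA : ∀ m, Tendsto (A m) atTop (𝓝 (a m))) :
    ∃ ℓ, Tendsto a atTop (𝓝 ℓ) ∧ Tendsto T atTop (𝓝 ℓ) := by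
  have hc : CauchySeq T := by
    rw [Metric.cauchySeq_iff']
    intro ε hε
    obtain ⟨m, hm⟩ := (he.eventually (gt_mem_nhds (by positivity : (0 : ℝ) < ε / 4))).exists
    obtain ⟨N, hN⟩ := Metric.cauchySeq_iff'.1 (hA m).cauchySeq (ε / 4) (by positivity)
    refine ⟨N, fun n hn => ?_⟩
    have h1 := hT m n
    have h2 := hT m N
    have h3 := hN n hn
    rw [Real.dist_eq] at h3 ⊢
    rw [abs_le] at h1 h2
    rw [abs_lt] at h3 ⊢
    constructor <;> linarith
  obtain ⟨ℓ, hℓ⟩ := cauchySeq_tendsto_of_complete hc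
  refine ⟨ℓ, ?_, hℓ⟩
  have hle : ∀ m, |a m - ℓ| ≤ e m := fun m =>
    le_of_tendsto ((hA m).sub hℓ).abs (Eventually.of_forall fun n => hT m n)
  rw [tendsto_iff_norm_sub_tendsto_zero]
  exact squeeze_zero (fun _ => norm_nonneg _) hle he

/-- The boundary integrals of smooth approximations and the cut off pairings have the same limit. -/
theorem IsCutoff.exists_limit (hd : 2 ≤ d) {K : Elt d} {i : Fin (d + 1)}
    {χ : ℕ → Pt d → ℝ} (hχ : IsCutoff K i χ) {W : Fin d → Pt d → ℝ} (hW : ∀ r, Smooth (W r))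
    {s : ℝ} (hs : 0 < s) (hs1 : s < 1) {σ : Fin d → Fin d → Pt d → ℝ} {D : Fin d → Pt d → ℝ}
    (hσ : ∀ r c, MemLp (σ r c) 2 (volume.restrict (body K)))
    (hD : ∀ r, MemLp (D r) 2 (volume.restrict (body K)))
    {τ : ℕ → Fin d → Fin d → Pt d → ℝ} (hτ : ∀ n r c, Smooth (τ n r c))
    (h1 : ∀ r c, TendstoL2 (volume.restrict (body K)) (fun n => τ n r c) (σ r c))
    (h2 : ∀ r c, Tendsto (fun n => slobodeckijSq s (body K) (fun x => τ n r c x - σ r c x))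
        atTop (𝓝 0))
    (h3 : ∀ r, TendstoL2 (volume.restrict (body K)) (fun n x => ∑ c, pd c (τ n r c) x) (D r)) :
    ∃ ℓ, Tendsto (fun n => ∫ x, ∑ r, (∑ c, τ n r c x * nrm K i c) * W r x ∂(surf (face K i)))
        atTop (𝓝 ℓ) ∧
      Tendsto (fun n => ∑ r, rowPairing K (σ r) (D r) fun y => W r y * χ n y) atTop (𝓝 ℓ) := by
  choose C hC hbd using fun r => hχ.exists_rowPairing_le hd (hW r) hs hs1
  set e : ℕ → ℝ≥0∞ := fun m => ∑ r, C r * rowNorm s K (fun c x => τ m r c x - σ r c x)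
    (fun x => (∑ c, pd c (τ m r c) x) - D r x) with he
  have he0 : Tendsto e atTop (𝓝 0) := by
    have hrow : ∀ r, Tendsto (fun m => rowNorm s K (fun c x => τ m r c x - σ r c x)
        (fun x => (∑ c, pd c (τ m r c) x) - D r x)) atTop (𝓝 0) := by
      intro r
      have h4 : ∀ c, Tendsto (fun m => eLpNorm (fun x => τ m r c x - σ r c x) 2
          (volume.restrict (body K)) + slobodeckijSq s (body K)
            (fun x => τ m r c x - σ r c x) ^ (1 / 2 : ℝ)) atTop (𝓝 0) := by
        intro c
        have h5 := (ENNReal.continuous_rpow_const (y := 1 / 2)).continuousAt.tendsto.comp (h2 r c)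
        rw [ENNReal.zero_rpow_of_pos (by norm_num)] at h5
        simpa using (h1 r c).add h5
      have h5 := (h3 r).add (tendsto_finset_sum Finset.univ fun c _ => h4 c)
      simpa [rowNorm] using h5
    have := tendsto_finset_sum Finset.univ fun r _ =>
      ENNReal.Tendsto.const_mul (hrow r) (Or.inr (hC r))
    simpa [he] using this
  have hdivL : ∀ m r, MemLp (fun x => ∑ c, pd c (τ m r c) x) 2 (volume.restrict (body K)) :=
    fun m r => memLp_finset_sum _ fun c _ => Continuous.memLp_body ((hτ m r c).continuous_pd c) K
  have hτL : ∀ m r c, MemLp (τ m r c) 2 (volume.restrict (body K)) := fun m r c =>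
    Continuous.memLp_body (hτ m r c).continuous K
  have hbound : ∀ m n, ‖(∑ r, rowPairing K (τ m r) (fun x => ∑ c, pd c (τ m r c) x)
      fun y => W r y * χ n y) - ∑ r, rowPairing K (σ r) (D r) fun y => W r y * χ n y‖ₑ ≤ e m := by
    intro m n
    rw [← Finset.sum_sub_distrib]
    refine (enorm_sum_le _ _).trans (Finset.sum_le_sum fun r _ => ?_)
    rw [← rowPairing_sub (hτL m r) (hσ r) (hdivL m r) (hD r) ((hW r).mul (hχ.smooth n))]
    exact hbd r _ _ (fun c => (hτL m r c).sub (hσ r c)) ((hdivL m r).sub (hD r)) n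
  have hfin : ∀ᶠ m in atTop, e m ≠ ⊤ := by
    filter_upwards [he0.eventually (gt_mem_nhds ENNReal.zero_lt_top)] with m hm using hm.ne
  obtain ⟨m₀, hm₀⟩ := eventually_atTop.1 hfin
  obtain ⟨ℓ, hℓ1, hℓ2⟩ := exists_limit_of_uniform_approx
    (T := fun n => ∑ r, rowPairing K (σ r) (D r) fun y => W r y * χ n y)
    (A := fun m n => ∑ r, rowPairing K (τ (m + m₀) r) (fun x => ∑ c, pd c (τ (m + m₀) r c) x)
      fun y => W r y * χ n y)
    (a := fun m => ∫ x, ∑ r, (∑ c, τ (m + m₀) r c x * nrm K i c) * W r x ∂(surf (face K i)))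
    (e := fun m => (e (m + m₀)).toReal)
    ((ENNReal.tendsto_toReal ENNReal.zero_ne_top).comp
      (he0.comp (tendsto_add_atTop_nat m₀)))
    (fun m n => by
      rw [← Real.norm_eq_abs, ← toReal_enorm]
      exact ENNReal.toReal_mono (hm₀ _ (by omega)) (hbound (m + m₀) n))
    (fun m => by
      have hint : ∀ r, Integrable (fun x => (∑ c, τ (m + m₀) r c x * nrm K i c) * W r x)
          (surf (face K i)) := fun r =>
        integrable_fun_mul (memLp_normal K i fun c =>
          Continuous.memLp_face (hτ _ r c).continuous K i)
          (Continuous.memLp_face (hW r).continuous K i)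
      simp only [fun n r => hχ.rowPairing_smooth (hτ (m + m₀) r) (hW r) n]
      rw [integral_finset_sum _ fun r _ => hint r]
      exact tendsto_finset_sum _ fun r _ => hχ.tendsto_integral (hint r))
  exact ⟨ℓ, (tendsto_add_atTop_iff_nat m₀).1 hℓ1, hℓ2⟩

theorem exists_isCutoff (K : Elt d) (i : Fin (d + 1)) : ∃ χ, IsCutoff K i χ :=
  ⟨_, (CutoffAdapted.refl K i one_pos).isCutoff⟩

/-- A tensor field in `H^s(K)` with row-wise divergence `D` in `L²(K)`. -/
structure DivTensor (s : ℝ) (K : Elt d) (σ : Fin d → Fin d → Pt d → ℝ) (D : Fin d → Pt d → ℝ) :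
    Prop where
  memLp : ∀ r c, MemLp (σ r c) 2 (volume.restrict (body K))
  slobodeckij : ∀ r c, slobodeckijSq s (body K) (σ r c) < ⊤
  memLp_div : ∀ r, MemLp (D r) 2 (volume.restrict (body K))
  hasWeakDiv : ∀ r, HasWeakDiv (interior (body K)) (σ r) (D r)

theorem DivTensor.tendsto_div_smoothing {s : ℝ} {K : Elt d} {σ : Fin d → Fin d → Pt d → ℝ}
    {D : Fin d → Pt d → ℝ} (h : DivTensor s K σ D) (r : Fin d) :
    TendstoL2 (volume.restrict (body K))
      (fun n x => ∑ c, pd c (smoothing K (sa n) (σ r c)) x) (D r) := by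
  have h1 := tendstoL2_const_mul_smoothing K (h.memLp_div r)
  refine h1.congr fun n => ?_
  refine eLpNorm_congr_ae ?_
  filter_upwards [ae_restrict_mem (measurableSet_body K)] with x hx
  rw [sum_pd_smoothing K (sa_pos n) (sa_lt_one n) (h.memLp r) (h.hasWeakDiv r) hx]

/-- The normal pairing is the limit of the cut off pairings, and of the boundary integrals of the
smoothed fields. -/
theorem DivTensor.normalPairing_spec (hd : 2 ≤ d) {s : ℝ} (hs : 0 < s) (hs1 : s < 1) {K : Elt d}
    {σ : Fin d → Fin d → Pt d → ℝ} {D : Fin d → Pt d → ℝ} (h : DivTensor s K σ D)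
    (i : Fin (d + 1)) {W : Fin d → Pt d → ℝ} (hW : ∀ r, Smooth (W r)) :
    (∀ χ, IsCutoff K i χ →
      Tendsto (fun n => ∑ r, rowPairing K (σ r) (D r) fun y => W r y * χ n y) atTop
        (𝓝 (normalPairing s K i σ W))) ∧
    Tendsto (fun n => ∫ x, ∑ r, (∑ c, smoothing K (sa n) (σ r c) x * nrm K i c) * W r x
      ∂(surf (face K i))) atTop (𝓝 (normalPairing s K i σ W)) := by
  have hτ : ∀ n r c, Smooth (smoothing K (sa n) (σ r c)) := fun n r c =>
    smoothing_smooth K (sa_pos n).ne' (h.memLp r c)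
  have h1 : ∀ r c, TendstoL2 (volume.restrict (body K))
      (fun n => smoothing K (sa n) (σ r c)) (σ r c) := fun r c => tendstoL2_smoothing K (h.memLp r c)
  have h2 : ∀ r c, Tendsto (fun n => slobodeckijSq s (body K)
      (fun x => smoothing K (sa n) (σ r c) x - σ r c x)) atTop (𝓝 0) := fun r c =>
    (tendsto_slobodeckijSq_smoothing hs K (h.memLp r c) (h.slobodeckij r c)).comp tendsto_sa
  have h3 := h.tendsto_div_smoothing
  obtain ⟨χ₀, hχ₀⟩ := exists_isCutoff K i
  obtain ⟨ℓ₀, ha₀, hT₀⟩ := hχ₀.exists_limit hd hW hs hs1 h.memLp h.memLp_div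
    (τ := fun n r c => smoothing K (sa n) (σ r c)) hτ h1 h2 h3
  have hex : IsNormalPairing s K i σ W ℓ₀ :=
    ⟨D, fun r => ⟨(memL2_interior_body K).2 (h.memLp_div r), h.hasWeakDiv r⟩, _, hτ, h1, h2, h3, ha₀⟩
  have hspec : IsNormalPairing s K i σ W (normalPairing s K i σ W) :=
    Classical.epsilon_spec ⟨ℓ₀, hex⟩
  have hcut : ∀ χ, IsCutoff K i χ →
      Tendsto (fun n => ∑ r, rowPairing K (σ r) (D r) fun y => W r y * χ n y) atTop
        (𝓝 (normalPairing s K i σ W)) := by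
    intro χ hχ
    obtain ⟨D', hD', τ, hτ', h1', h2', h3', hlim⟩ := hspec
    have hDL : ∀ r, MemLp (D' r) 2 (volume.restrict (body K)) := fun r =>
      (memL2_interior_body K).1 (hD' r).1
    obtain ⟨ℓ, ha, hT⟩ := hχ.exists_limit hd hW hs hs1 h.memLp hDL hτ' h1' h2' h3'
    rw [tendsto_nhds_unique hlim ha]
    refine hT.congr fun n => Finset.sum_congr rfl fun r _ => rowPairing_congr (fun _ => ae_eq_rfl) ?_
    rw [← restrict_interior_body]
    exact HasWeakDiv.ae_unique isOpen_interior (hD' r).1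
      ((memL2_interior_body K).2 (h.memLp_div r)) (hD' r).2 (h.hasWeakDiv r)
  refine ⟨hcut, ?_⟩
  rwa [tendsto_nhds_unique (hcut χ₀ hχ₀) hT₀]

theorem normalPairing_congr {s : ℝ} {K : Elt d} {i : Fin (d + 1)} {σ : Fin d → Fin d → Pt d → ℝ}
    {w w' : Fin d → Pt d → ℝ} (h : ∀ r, ∀ x ∈ face K i, w r x = w' r x) :
    normalPairing s K i σ w = normalPairing s K i σ w' := by
  have e : ∀ τ : Fin d → Fin d → Pt d → ℝ,
      ∫ x, ∑ r, (∑ c, τ r c x * nrm K i c) * w r x ∂(surf (face K i)) =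
      ∫ x, ∑ r, (∑ c, τ r c x * nrm K i c) * w' r x ∂(surf (face K i)) := by
    intro τ
    refine integral_congr_ae ?_
    filter_upwards [ae_surf_mem K i] with x hx
    exact Finset.sum_congr rfl fun r _ => by rw [h r x hx]
  have : IsNormalPairing s K i σ w = IsNormalPairing s K i σ w' := by
    ext ℓ
    simp only [IsNormalPairing, e]
  rw [normalPairing, normalPairing, this]

theorem DivTensor.normalPairing_sub (hd : 2 ≤ d) {s : ℝ} (hs : 0 < s) (hs1 : s < 1) {K : Elt d}
    {σ : Fin d → Fin d → Pt d → ℝ} {D : Fin d → Pt d → ℝ} (h : DivTensor s K σ D)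
    (i : Fin (d + 1)) {W W' : Fin d → Pt d → ℝ} (hW : ∀ r, Smooth (W r))
    (hW' : ∀ r, Smooth (W' r)) : normalPairing s K i σ (fun r x => W r x - W' r x) =
      normalPairing s K i σ W - normalPairing s K i σ W' := by
  obtain ⟨χ, hχ⟩ := exists_isCutoff K i
  have h1 := (h.normalPairing_spec hd hs hs1 i hW).1 χ hχ
  have h2 := (h.normalPairing_spec hd hs hs1 i hW').1 χ hχ
  have h3 := (h.normalPairing_spec hd hs hs1 i fun r => (hW r).sub (hW' r)).1 χ hχ
  refine tendsto_nhds_unique h3 ((h1.sub h2).congr fun n => ?_)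
  rw [← Finset.sum_sub_distrib]
  refine Finset.sum_congr rfl fun r _ => ?_
  rw [← rowPairing_test_sub (h.memLp r) (h.memLp_div r) ((hW r).mul (hχ.smooth n))
    ((hW' r).mul (hχ.smooth n))]
  simp only [sub_mul]

theorem DivTensor.normalPairing_zero (hd : 2 ≤ d) {s : ℝ} (hs : 0 < s) (hs1 : s < 1) {K : Elt d}
    {σ : Fin d → Fin d → Pt d → ℝ} {D : Fin d → Pt d → ℝ} (h : DivTensor s K σ D)
    (i : Fin (d + 1)) : normalPairing s K i σ (fun _ _ => 0) = 0 := by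
  have h1 := (h.normalPairing_spec hd hs hs1 i (W := fun _ _ => 0) fun r => contDiff_const).2
  simp only [mul_zero, Finset.sum_const_zero, integral_zero] at h1
  exact tendsto_nhds_unique h1 tendsto_const_nhds

/-- The normal pairings with a smooth field add up to its boundary pairing. -/
theorem DivTensor.sum_normalPairing (hd : 2 ≤ d) {s : ℝ} (hs : 0 < s) (hs1 : s < 1) {K : Elt d}
    {σ : Fin d → Fin d → Pt d → ℝ} {D : Fin d → Pt d → ℝ} (h : DivTensor s K σ D)
    {W : Fin d → Pt d → ℝ} (hW : ∀ r, Smooth (W r)) :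
    ∑ i, normalPairing s K i σ W = ∑ r, rowPairing K (σ r) (D r) (W r) := by
  have hτ : ∀ n r c, Smooth (smoothing K (sa n) (σ r c)) := fun n r c =>
    smoothing_smooth K (sa_pos n).ne' (h.memLp r c)
  have h1 := tendsto_finset_sum Finset.univ fun i _ => (h.normalPairing_spec hd hs hs1 i hW).2
  refine tendsto_nhds_unique h1 ?_
  have hdivL : ∀ n r, MemLp (fun x => ∑ c, pd c (smoothing K (sa n) (σ r c)) x) 2
      (volume.restrict (body K)) := fun n r =>
    memLp_finset_sum _ fun c _ => Continuous.memLp_body ((hτ n r c).continuous_pd c) K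
  have hrow : ∀ r, Tendsto (fun n => rowPairing K (fun c => smoothing K (sa n) (σ r c))
      (fun x => ∑ c, pd c (smoothing K (sa n) (σ r c)) x) (W r)) atTop
      (𝓝 (rowPairing K (σ r) (D r) (W r))) := by
    intro r
    have hWL := Continuous.memLp_body (hW r).continuous K
    have hpW := fun c => Continuous.memLp_body ((hW r).continuous_pd c) K
    have hsplit : ∀ {V : Fin d → Pt d → ℝ} {D : Pt d → ℝ},
        (∀ c, MemLp (V c) 2 (volume.restrict (body K))) → MemLp D 2 (volume.restrict (body K)) →
        rowPairing K V D (W r) = (∫ x in body K, D x * W r x) +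
          ∑ c, ∫ x in body K, V c x * pd c (W r) x := by
      intro V D hV hD
      rw [rowPairing, integral_add (integrable_fun_mul hD hWL)
        (integrable_finset_sum _ fun c _ => integrable_fun_mul (hV c) (hpW c)),
        integral_finset_sum _ fun c _ => integrable_fun_mul (hV c) (hpW c)]
    rw [hsplit (h.memLp r) (h.memLp_div r)]
    refine Tendsto.congr (fun n => (hsplit (fun c =>
      Continuous.memLp_body (hτ n r c).continuous K) (hdivL n r)).symm) ?_
    refine (tendsto_integral_mul (fun n => hdivL n r) (h.memLp_div r) hWL
      (h.tendsto_div_smoothing r)).add (tendsto_finset_sum _ fun c _ => ?_)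
    exact tendsto_integral_mul (fun n => Continuous.memLp_body (hτ n r c).continuous K)
      (h.memLp r c) (hpW c) (tendstoL2_smoothing K (h.memLp r c))
  refine (tendsto_finset_sum Finset.univ fun r _ => hrow r).congr fun n => ?_
  simp only [fun r => rowPairing_smooth K (hτ n r) (hW r)]
  rw [Finset.sum_comm]
  refine Finset.sum_congr rfl fun i _ => ?_
  rw [integral_finset_sum]
  exact fun r _ => integrable_fun_mul (memLp_normal K i fun c =>
    Continuous.memLp_face (hτ n r c).continuous K i) (Continuous.memLp_face (hW r).continuous K i)

namespace Triangulation

variable {Ω : Set (Pt d)} {ι : Type*} [Fintype ι]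

theorem divTensor (𝒯 : Triangulation Ω ι) {s : ℝ} {σ : Fin d → Fin d → Pt d → ℝ}
    {D : Fin d → Pt d → ℝ} (hσ : ∀ r c, MemHs s Ω (σ r c)) (hD : ∀ r, MemL2 Ω (D r))
    (hdiv : ∀ r, HasWeakDiv Ω (σ r) (D r)) (t : ι) : DivTensor s (𝒯.elt t) σ D where
  memLp r c := 𝒯.memL2_body (hσ r c).1 t
  slobodeckij r c := by
    rw [← slobodeckijSq_interior_body]
    exact (slobodeckijSq_mono s (𝒯.interior_body_subset t) _).trans_lt (hσ r c).2
  memLp_div r := 𝒯.memL2_body (hD r) t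
  hasWeakDiv r := (hdiv r).mono (𝒯.interior_body_subset t)

/-- The normal pairings with a single-valued field on the skeleton that vanishes on the boundary
cancel. -/
theorem sum_normalPairing_vhat (𝒯 : Triangulation Ω ι) (hd : 2 ≤ d) {s : ℝ} (hs : 0 < s)
    (hs1 : s < 1) {σ : Fin d → Fin d → Pt d → ℝ}
    {D : Fin d → Pt d → ℝ} (hσ : ∀ r c, MemHs s Ω (σ r c)) (hD : ∀ r, MemL2 Ω (D r))
    (hdiv : ∀ r, HasWeakDiv Ω (σ r) (D r)) {k : ℕ} {vhat : Set (Pt d) → Fin d → Pt d → ℝ}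
    (hv : 𝒯.MemVhat0 k vhat) :
    ∑ t, ∑ i, normalPairing s (𝒯.elt t) i σ (vhat (face (𝒯.elt t) i)) = 0 := by
  refine 𝒯.sum_faces_eq_zero _ (fun t i hF _ => ?_) fun t i t' i' hne hF => ?_
  · rw [normalPairing_congr (w' := fun _ _ => 0)]
    · exact (𝒯.divTensor hσ hD hdiv t).normalPairing_zero hd hs hs1 i
    · exact (hv _ ⟨t, i, rfl⟩).2 hF
  · choose q _ hq using (hv _ ⟨t, i, rfl⟩).1
    rw [normalPairing_congr (w' := fun r => val (q r)) hq,
      normalPairing_congr (K := 𝒯.elt t') (w' := fun r => val (q r)) (by rw [← hF]; exact hq)]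
    obtain ⟨χ, hχ, hχ', hweak⟩ := 𝒯.exists_common_cutoff hne hF
    have h1 := ((𝒯.divTensor hσ hD hdiv t).normalPairing_spec hd hs hs1 i
      (W := fun r => val (q r)) fun r => smooth_val _).1 χ hχ
    have h2 := ((𝒯.divTensor hσ hD hdiv t').normalPairing_spec hd hs hs1 i'
      (W := fun r => val (q r)) fun r => smooth_val _).1 χ hχ'
    refine tendsto_nhds_unique (h1.add h2) (tendsto_const_nhds.congr fun n => ?_)
    rw [← Finset.sum_add_distrib]
    exact (Finset.sum_eq_zero fun r _ => hweak _ _ (fun c => (hσ r c).1) (hD r) (hdiv r) _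
      (smooth_val _) n).symm

theorem sum_normalPairing (𝒯 : Triangulation Ω ι) (hd : 2 ≤ d) {s : ℝ} (hs : 0 < s)
    (hs1 : s < 1) {σ : Fin d → Fin d → Pt d → ℝ}
    {D : Fin d → Pt d → ℝ} (hσ : ∀ r c, MemHs s Ω (σ r c)) (hD : ∀ r, MemL2 Ω (D r))
    (hdiv : ∀ r, HasWeakDiv Ω (σ r) (D r)) {k : ℕ} {vhat : Set (Pt d) → Fin d → Pt d → ℝ}
    (hv : 𝒯.MemVhat0 k vhat) (v : ι → Fin d → Poly d) :
    ∑ t, ∑ i, normalPairing s (𝒯.elt t) i σ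
        (fun r x => vhat (face (𝒯.elt t) i) r x - val (v t r) x) =
      -∑ t, ∑ r, rowPairing (𝒯.elt t) (σ r) (D r) (val (v t r)) := by
  have h0 := 𝒯.sum_normalPairing_vhat hd hs hs1 hσ hD hdiv hv
  have h1 : ∀ t i, normalPairing s (𝒯.elt t) i σ
      (fun r x => vhat (face (𝒯.elt t) i) r x - val (v t r) x) =
      normalPairing s (𝒯.elt t) i σ (vhat (face (𝒯.elt t) i)) -
        normalPairing s (𝒯.elt t) i σ fun r => val (v t r) := by
    intro t i
    choose q _ hq using (hv _ ⟨t, i, rfl⟩).1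
    rw [normalPairing_congr (w' := fun r x => val (q r) x - val (v t r) x)
      (fun r x hx => by rw [hq r x hx]), normalPairing_congr (w' := fun r => val (q r)) hq]
    exact (𝒯.divTensor hσ hD hdiv t).normalPairing_sub hd hs hs1 i (fun r => smooth_val _)
      fun r => smooth_val _
  simp only [h1, Finset.sum_sub_distrib, h0, zero_sub]
  congr 1
  exact Finset.sum_congr rfl fun t _ =>
    (𝒯.divTensor hσ hD hdiv t).sum_normalPairing hd hs hs1 fun r => smooth_val _

end Triangulation

/-! ### Consistency -/

/-- Green's formula for a function and a polynomial field. -/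
theorem green_trace_field {K : Elt d} {f : Pt d → ℝ} {γ : Fin (d + 1) → Pt d → ℝ}
    (h : ∀ i, IsTrace K (face K i) f (γ i)) {Df : Fin d → Pt d → ℝ}
    (hf : MemL2 (interior (body K)) f)
    (hDf : ∀ j, MemL2 (interior (body K)) (Df j) ∧ HasWeakPartial (interior (body K)) j f (Df j))
    (G : Fin d → Poly d) :
    (∑ c, ∫ x in body K, Df c x * val (G c) x) + ∫ x in body K, f x * val (pdiv G) x =
      ∑ i, ∫ y, γ i y * ∑ c, val (G c) y * nrm K i c ∂(surf (face K i)) := by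
  have hfL := (memL2_interior_body K).1 hf
  have hDL := fun c => (memL2_interior_body K).1 (hDf c).1
  have h1 : ∀ c, (∫ x in body K, Df c x * val (G c) x) +
      ∫ x in body K, f x * val (MvPolynomial.pderiv c (G c)) x =
      ∑ i, nrm K i c * ∫ y, γ i y * val (G c) y ∂(surf (face K i)) := by
    intro c
    have := green_trace h hf hDf (smooth_val (G c)) c
    simp only [pd_val] at this
    rwa [integral_add (integrable_fun_mul (hDL c) (memLp_val_body K _))
      (integrable_fun_mul hfL (memLp_val_body K _))] at this
  have h2 : ∫ x in body K, f x * val (pdiv G) x =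
      ∑ c, ∫ x in body K, f x * val (MvPolynomial.pderiv c (G c)) x := by
    simp only [pdiv, val_sum, Finset.mul_sum]
    exact integral_finset_sum _ fun c _ => integrable_fun_mul hfL (memLp_val_body K _)
  rw [h2, ← Finset.sum_add_distrib, Finset.sum_congr rfl fun c _ => h1 c, Finset.sum_comm]
  refine Finset.sum_congr rfl fun i _ => ?_
  simp only [Finset.mul_sum]
  rw [integral_finset_sum]
  · refine Finset.sum_congr rfl fun c _ => ?_
    rw [← integral_const_mul]
    refine integral_congr_ae (Eventually.of_forall fun x => ?_)
    simp only
    ring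
  · intro c _
    exact integrable_fun_mul (h i).1 ((memLp_val_face K i _).mul_const _)

/-- The normal component of a polynomial tensor row, as a polynomial. -/
def normalPoly (K : Elt d) (i : Fin (d + 1)) (G : Fin d → Poly d) : Poly d :=
  ∑ c, G c * MvPolynomial.C (nrm K i c)

theorem val_normalPoly (K : Elt d) (i : Fin (d + 1)) (G : Fin d → Poly d) (x : Pt d) :
    val (normalPoly K i G) x = ∑ c, val (G c) x * nrm K i c := by
  simp [normalPoly]

theorem normalPoly_mem (K : Elt d) (i : Fin (d + 1)) {m : ℕ} {G : Fin d → Poly d}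
    (hG : ∀ c, G c ∈ PolyLE d m) : normalPoly K i G ∈ PolyLE d m :=
  Submodule.sum_mem _ fun c _ => mul_C_mem_polyLE (hG c) _

theorem pdiv_mem_polyLE {m : ℕ} {v : Fin d → Poly d} (hv : ∀ c, v c ∈ PolyLE d m) :
    pdiv v ∈ PolyLE d (m - 1) := Submodule.sum_mem _ fun c _ => pderiv_mem_polyLE (hv c) c

theorem integral_faceProj_mul (m : ℕ) (K : Elt d) (i : Fin (d + 1)) {f : Pt d → ℝ}
    (hf : MemLp f 2 (surf (face K i))) {w : Poly d} (hw : w ∈ PolyLE d m) :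
    ∫ x, faceProj m (face K i) f x * val w x ∂(surf (face K i)) =
      ∫ x, f x * val w x ∂(surf (face K i)) := by
  obtain ⟨q, -, h1, h2⟩ := faceProj_spec m K i hf
  rw [h1]
  exact h2 w hw

theorem memLp_faceProj (m : ℕ) (K : Elt d) (i : Fin (d + 1)) {f : Pt d → ℝ}
    (hf : MemLp f 2 (surf (face K i))) : MemLp (faceProj m (face K i) f) 2 (surf (face K i)) := by
  obtain ⟨q, -, h1, -⟩ := faceProj_spec m K i hf
  rw [h1]
  exact memLp_val_face K i q

namespace Triangulation

variable {Ω : Set (Pt d)} {ι : Type*} [Fintype ι]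

/-- The first equation: gradient consistency. -/
theorem gradient_consistency (𝒯 : Triangulation Ω ι) {k : ℕ} {ν : ℝ}
    {L : Fin d → Fin d → Pt d → ℝ} {u : Fin d → Pt d → ℝ} (hL : ∀ r c, MemL2 Ω (L r c))
    (hu : ∀ r, MemH1 Ω (u r)) (hgrad : ∀ r c, HasWeakPartial Ω c (u r) fun x => ν⁻¹ * L r c x)
    {G : ι → Fin d → Fin d → Poly d} (hG : 𝒯.MemSigma k G) (U : ι → Fin d → Poly d) :
    ν⁻¹ * 𝒯.sumT (fun t x => ∑ r, ∑ c, val (𝒯.projS (k - 1) L t r c) x * val (G t r c) x)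
      + 𝒯.sumT (fun t x => ∑ r, val (U t r) x * val (pdiv (G t r)) x)
      - 𝒯.sumB (fun t i x => ∑ r, 𝒯.projTrace (k - 1) u (face (𝒯.elt t) i) r x *
          ∑ c, val (G t r c) x * nrm (𝒯.elt t) i c) =
      𝒯.sumT (fun t x => ∑ r, (val (U t r) x - u r x) * val (pdiv (G t r)) x) := by
  simp only [sumT, sumB]
  rw [Finset.mul_sum, ← Finset.sum_add_distrib, ← Finset.sum_sub_distrib]
  refine Finset.sum_congr rfl fun t _ => ?_
  have hLt := fun r c => 𝒯.memL2_body (hL r c) t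
  have hut := fun r => 𝒯.memL2_body (hu r).1 t
  have hγ := fun i r => (𝒯.isTrace_trace (hu r) t i).1
  have hgreen : ∀ r, (∑ c, ∫ x in body (𝒯.elt t), ν⁻¹ * L r c x * val (G t r c) x) +
      ∫ x in body (𝒯.elt t), u r x * val (pdiv (G t r)) x =
      ∑ i, ∫ y, 𝒯.trace (u r) (face (𝒯.elt t) i) y *
        ∑ c, val (G t r c) y * nrm (𝒯.elt t) i c ∂(surf (face (𝒯.elt t) i)) := fun r =>
    green_trace_field (fun i => 𝒯.isTrace_trace (hu r) t i) (MemL2.interior_body 𝒯 (hu r).1 t)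
      (fun c => ⟨MemL2.interior_body 𝒯 ((hL r c).const_mul _) t,
        (hgrad r c).mono (𝒯.interior_body_subset t)⟩) (G t r)
  have h1 : ν⁻¹ * ∫ x in body (𝒯.elt t),
      ∑ r, ∑ c, val (𝒯.projS (k - 1) L t r c) x * val (G t r c) x =
      ∑ r, ∑ c, ∫ x in body (𝒯.elt t), ν⁻¹ * L r c x * val (G t r c) x := by
    have hint : ∀ r c, Integrable (fun x => val (𝒯.projS (k - 1) L t r c) x * val (G t r c) x)
        (volume.restrict (body (𝒯.elt t))) := fun r c =>
      integrable_fun_mul (memLp_val_body _ _) (memLp_val_body _ _)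
    rw [integral_finset_sum _ fun r _ => integrable_finset_sum _ fun c _ => hint r c,
      Finset.mul_sum]
    refine Finset.sum_congr rfl fun r _ => ?_
    rw [integral_finset_sum _ fun c _ => hint r c, Finset.mul_sum]
    refine Finset.sum_congr rfl fun c _ => ?_
    simp only [mul_assoc]
    rw [integral_const_mul]
    congr 1
    exact (elemProj_spec (k - 1) (𝒯.elt t) (hLt r c)).2 _ (hG t r c)
  have h2 : ∀ i, ∫ x, ∑ r, 𝒯.projTrace (k - 1) u (face (𝒯.elt t) i) r x *
      ∑ c, val (G t r c) x * nrm (𝒯.elt t) i c ∂(surf (face (𝒯.elt t) i)) =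
      ∑ r, ∫ y, 𝒯.trace (u r) (face (𝒯.elt t) i) y *
        ∑ c, val (G t r c) y * nrm (𝒯.elt t) i c ∂(surf (face (𝒯.elt t) i)) := by
    intro i
    simp only [← val_normalPoly, projTrace]
    rw [integral_finset_sum _ fun r _ => integrable_fun_mul
      (memLp_faceProj (k - 1) (𝒯.elt t) i (hγ i r)) (memLp_val_face _ _ _)]
    exact Finset.sum_congr rfl fun r _ =>
      integral_faceProj_mul (k - 1) (𝒯.elt t) i (hγ i r) (normalPoly_mem _ _ (hG t r))
  have h3 : ∫ x in body (𝒯.elt t), ∑ r, val (U t r) x * val (pdiv (G t r)) x =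
      ∑ r, ∫ x in body (𝒯.elt t), val (U t r) x * val (pdiv (G t r)) x :=
    integral_finset_sum _ fun r _ => integrable_fun_mul (memLp_val_body _ _) (memLp_val_body _ _)
  have h4 : ∫ x in body (𝒯.elt t), ∑ r, (val (U t r) x - u r x) * val (pdiv (G t r)) x =
      ∑ r, ((∫ x in body (𝒯.elt t), val (U t r) x * val (pdiv (G t r)) x) -
        ∫ x in body (𝒯.elt t), u r x * val (pdiv (G t r)) x) := by
    have hint : ∀ r ∈ Finset.univ, Integrable
        (fun x => (val (U t r) x - u r x) * val (pdiv (G t r)) x)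
        (volume.restrict (body (𝒯.elt t))) := fun r _ =>
      integrable_fun_mul ((memLp_val_body (𝒯.elt t) (U t r)).sub (hut r)) (memLp_val_body _ _)
    rw [integral_finset_sum _ hint]
    refine Finset.sum_congr rfl fun r _ => ?_
    rw [← integral_sub (integrable_fun_mul (memLp_val_body _ _) (memLp_val_body _ _))
      (integrable_fun_mul (hut r) (memLp_val_body _ _))]
    refine integral_congr_ae (Eventually.of_forall fun x => ?_)
    ring
  rw [h1, h3, h4, Finset.sum_congr rfl fun i _ => h2 i, Finset.sum_comm (s := Finset.univ (α := Fin (d+1))),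
    ← Finset.sum_congr rfl fun r _ => hgreen r, Finset.sum_add_distrib, Finset.sum_sub_distrib]
  ring

/-- Consistency of the stabilization term. -/
theorem stabilization_consistency (𝒯 : Triangulation Ω ι) {k : ℕ}
    {u : Fin d → Pt d → ℝ} (hu : ∀ r, MemH1 Ω (u r)) (U v : ι → Fin d → Poly d)
    {vhat : Set (Pt d) → Fin d → Pt d → ℝ} (hvhat : 𝒯.MemVhat0 k vhat) :
    𝒯.sumB (fun t i x => (𝒯.diam t)⁻¹ *
      ∑ r, 𝒯.jump k U (𝒯.projTrace (k - 1) u) t i r x * 𝒯.jump k v vhat t i r x) =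
    𝒯.sumB (fun t i x => (𝒯.diam t)⁻¹ *
      ∑ r, (val (U t r) x - 𝒯.trace (u r) (face (𝒯.elt t) i) x) * 𝒯.jump k v vhat t i r x) := by
  simp only [sumB]
  refine Finset.sum_congr rfl fun t _ => Finset.sum_congr rfl fun i _ => ?_
  rw [integral_const_mul, integral_const_mul]
  congr 1
  have hγ := fun r => (𝒯.isTrace_trace (hu r) t i).1
  have hj : ∀ r, ∃ w ∈ PolyLE d (k - 1), ∀ x ∈ face (𝒯.elt t) i, 𝒯.jump k v vhat t i r x = val w x := by
    intro r
    obtain ⟨q, hq, hqv⟩ := (hvhat _ ⟨t, i, rfl⟩).1 r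
    obtain ⟨p, hp, hpv, -⟩ := faceProj_spec (k - 1) (𝒯.elt t) i (memLp_val_face _ i (v t r))
    refine ⟨p - q, Submodule.sub_mem _ hp hq, fun x hx => ?_⟩
    rw [jump, hpv, hqv x hx, val_sub]
  choose w hw hwv using hj
  have e1 : ∫ x, ∑ r, 𝒯.jump k U (𝒯.projTrace (k - 1) u) t i r x * 𝒯.jump k v vhat t i r x
      ∂(surf (face (𝒯.elt t) i)) =
      ∫ x, ∑ r, 𝒯.jump k U (𝒯.projTrace (k - 1) u) t i r x * val (w r) x
      ∂(surf (face (𝒯.elt t) i)) := by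
    refine integral_congr_ae ?_
    filter_upwards [ae_surf_mem _ i] with x hx
    exact Finset.sum_congr rfl fun r _ => by rw [hwv r x hx]
  have e2 : ∫ x, ∑ r, (val (U t r) x - 𝒯.trace (u r) (face (𝒯.elt t) i) x) *
      𝒯.jump k v vhat t i r x ∂(surf (face (𝒯.elt t) i)) =
      ∫ x, ∑ r, (val (U t r) x - 𝒯.trace (u r) (face (𝒯.elt t) i) x) * val (w r) x
      ∂(surf (face (𝒯.elt t) i)) := by
    refine integral_congr_ae ?_
    filter_upwards [ae_surf_mem _ i] with x hx
    exact Finset.sum_congr rfl fun r _ => by rw [hwv r x hx]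
  have hUL := fun r => memLp_val_face (𝒯.elt t) i (U t r)
  have hPU := fun r => memLp_faceProj (k - 1) (𝒯.elt t) i (hUL r)
  have hPγ := fun r => memLp_faceProj (k - 1) (𝒯.elt t) i (hγ r)
  have hint₁ : ∀ r ∈ Finset.univ, Integrable
      (fun x => 𝒯.jump k U (𝒯.projTrace (k - 1) u) t i r x * val (w r) x)
      (surf (face (𝒯.elt t) i)) := fun r _ =>
    integrable_fun_mul ((hPU r).sub (hPγ r)) (memLp_val_face _ _ _)
  have hint₂ : ∀ r ∈ Finset.univ, Integrable
      (fun x => (val (U t r) x - 𝒯.trace (u r) (face (𝒯.elt t) i) x) * val (w r) x)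
      (surf (face (𝒯.elt t) i)) := fun r _ =>
    integrable_fun_mul ((hUL r).sub (hγ r)) (memLp_val_face _ _ _)
  rw [e1, e2, integral_finset_sum _ hint₁, integral_finset_sum _ hint₂]
  refine Finset.sum_congr rfl fun r _ => ?_
  simp only [jump, projTrace, sub_mul]
  rw [integral_sub (integrable_fun_mul (hPU r) (memLp_val_face _ _ _))
      (integrable_fun_mul (hPγ r) (memLp_val_face _ _ _)),
    integral_sub (integrable_fun_mul (hUL r) (memLp_val_face _ _ _))
      (integrable_fun_mul (hγ r) (memLp_val_face _ _ _)),
    integral_faceProj_mul _ _ _ (hUL r) (hw r), integral_faceProj_mul _ _ _ (hγ r) (hw r)]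

theorem isBDM_projBDM (𝒯 : Triangulation Ω ι) {k : ℕ} (hk : 1 ≤ k) {u : Fin d → Pt d → ℝ}
    (hu : ∀ r, MemH1 Ω (u r)) (t : ι) :
    IsBDM k (𝒯.elt t) u (fun i j => 𝒯.trace (u j) (face (𝒯.elt t) i)) (𝒯.projBDM k u t) :=
  Classical.epsilon_spec (p := IsBDM k (𝒯.elt t) u fun i j => 𝒯.trace (u j) (face (𝒯.elt t) i))
    (exists_isBDM hk _ (fun j => 𝒯.memL2_body (hu j).1 t)
      fun i j => (𝒯.isTrace_trace (hu j) t i).1)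

/-- The Brezzi–Douglas–Marini projection of a solenoidal field is solenoidal. -/
theorem divergence_consistency (𝒯 : Triangulation Ω ι) {k : ℕ} (hk : 1 ≤ k)
    {D : Fin d → Fin d → Pt d → ℝ} {u : Fin d → Pt d → ℝ} (hD : ∀ r c, MemL2 Ω (D r c))
    (hu : ∀ r, MemH1 Ω (u r)) (hgrad : ∀ r c, HasWeakPartial Ω c (u r) (D r c))
    (hdiv : HasWeakDiv Ω u 0) {q : ι → Poly d} (hq : ∀ t, q t ∈ PolyLE d (k - 1)) :
    𝒯.sumT (fun t x => val (pdiv (𝒯.projBDM k u t)) x * val (q t) x) = 0 := by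
  have htr : (fun x => ∑ j, D j j x) =ᵐ[volume.restrict Ω] 0 := by
    have h1 : HasWeakDiv Ω u fun x => ∑ j, D j j x := by
      intro φ hφ
      have e1 : ∫ x in Ω, ∑ j, u j x * pd j φ x = ∑ j, ∫ x in Ω, u j x * pd j φ x :=
        integral_finset_sum _ fun j _ => integrable_fun_mul (hu j).1 (hφ.memLp_pd j _)
      have e2 : ∫ x in Ω, (∑ j, D j j x) * φ x = ∑ j, ∫ x in Ω, D j j x * φ x := by
        simp only [Finset.sum_mul]
        exact integral_finset_sum _ fun j _ => integrable_fun_mul (hD j j) (hφ.memLp _)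
      rw [e1, e2, ← Finset.sum_neg_distrib]
      exact Finset.sum_congr rfl fun j _ => hgrad j j φ hφ
    exact HasWeakDiv.ae_unique 𝒯.isOpen (memLp_finset_sum _ fun j _ => hD j j) MemLp.zero h1 hdiv
  refine Finset.sum_eq_zero fun t _ => ?_
  obtain ⟨hmem, hface, hgrd, -, -⟩ := 𝒯.isBDM_projBDM hk hu t
  set U := 𝒯.projBDM k u t with hU
  set K := 𝒯.elt t with hK
  have hut := fun j => 𝒯.memL2_body (hu j).1 t
  have hDt := fun j => 𝒯.memL2_body (hD j j) t
  have hγ := fun i j => (𝒯.isTrace_trace (hu j) t i).1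
  have hq' : q t ∈ PolyLE d k := polyLE_mono (Nat.sub_le k 1) (hq t)
  -- Green's formula for the projection
  have g1 : ∫ x in body K, val (pdiv U) x * val (q t) x =
      (∑ i, ∫ x, (∑ j, val (U j) x * nrm K i j) * val (q t) x ∂(surf (face K i))) -
        ∫ x in body K, ∑ j, val (U j) x * val (MvPolynomial.pderiv j (q t)) x := by
    have := rowPairing_smooth K (fun c => smooth_val (U c)) (smooth_val (q t))
    rw [sum_pd_val, rowPairing] at this
    simp only [pd_val] at this
    rw [integral_add (integrable_fun_mul (memLp_val_body _ _) (memLp_val_body _ _))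
      (integrable_finset_sum _ fun j _ =>
        integrable_fun_mul (memLp_val_body _ _) (memLp_val_body _ _))] at this
    linarith
  -- Green's formula for the solution
  have g2 : (∑ i, ∫ x, (∑ j, 𝒯.trace (u j) (face K i) x * nrm K i j) * val (q t) x
      ∂(surf (face K i))) =
      (∑ j, ∫ x in body K, D j j x * val (q t) x) +
        ∑ j, ∫ x in body K, u j x * val (MvPolynomial.pderiv j (q t)) x := by
    have h1 : ∀ j, (∫ x in body K, D j j x * val (q t) x) +
        ∫ x in body K, u j x * val (MvPolynomial.pderiv j (q t)) x =
        ∑ i, nrm K i j * ∫ y, 𝒯.trace (u j) (face K i) y * val (q t) y ∂(surf (face K i)) := by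
      intro j
      have := green_trace (fun i => 𝒯.isTrace_trace (hu j) t i) (MemL2.interior_body 𝒯 (hu j).1 t)
        (fun c => ⟨MemL2.interior_body 𝒯 (hD j c) t, (hgrad j c).mono (𝒯.interior_body_subset t)⟩)
        (smooth_val (q t)) j
      simp only [pd_val] at this
      rwa [integral_add (integrable_fun_mul (hDt j) (memLp_val_body _ _))
        (integrable_fun_mul (hut j) (memLp_val_body _ _))] at this
    rw [← Finset.sum_add_distrib, Finset.sum_congr rfl fun j _ => h1 j, Finset.sum_comm]
    refine Finset.sum_congr rfl fun i _ => ?_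
    simp only [Finset.sum_mul]
    rw [integral_finset_sum]
    · refine Finset.sum_congr rfl fun j _ => ?_
      rw [← integral_const_mul]
      refine integral_congr_ae (Eventually.of_forall fun x => ?_)
      simp only
      ring
    · exact fun j _ => integrable_fun_mul ((hγ i j).mul_const _) (memLp_val_face _ _ _)
  have g3 : ∑ j, ∫ x in body K, D j j x * val (q t) x = 0 := by
    rw [← integral_finset_sum _ fun j _ => integrable_fun_mul (hDt j) (memLp_val_body K _)]
    refine integral_eq_zero_of_ae ?_
    filter_upwards [(Measure.absolutelyContinuous_of_le (𝒯.restrict_body_le t)).ae_le htr] with x hx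
    simp only [← Finset.sum_mul]
    rw [hx]
    simp
  rw [g1, Finset.sum_congr rfl fun i _ => hface i (q t) hq', hgrd (q t) (hq t), g2, g3, zero_add,
    integral_finset_sum _ fun j _ => integrable_fun_mul (hut j) (memLp_val_body K _), sub_self]

/-- A function of class `H¹` is orthogonal, on the skeleton, to the normal components of discrete
`H(div)` fields without normal trace on the boundary. -/
theorem integral_grad_mul_add (𝒯 : Triangulation Ω ι) {k : ℕ} {θ : Pt d → ℝ}
    {Dθ : Fin d → Pt d → ℝ} (hθ : MemL2 Ω θ)
    (hDθ : ∀ r, MemL2 Ω (Dθ r) ∧ HasWeakPartial Ω r θ (Dθ r))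
    {v : ι → Fin d → Poly d} (hv : 𝒯.MemV0 k v) :
    ∑ t, ((∑ r, ∫ x in body (𝒯.elt t), Dθ r x * val (v t r) x) +
      ∫ x in body (𝒯.elt t), θ x * val (pdiv (v t)) x) = 0 := by
  have hH1 : MemH1 Ω θ := ⟨hθ, fun r => ⟨_, hDθ r⟩⟩
  have h1 : ∀ t, (∑ r, ∫ x in body (𝒯.elt t), Dθ r x * val (v t r) x) +
      ∫ x in body (𝒯.elt t), θ x * val (pdiv (v t)) x =
      ∑ i, ∫ y, 𝒯.trace θ (face (𝒯.elt t) i) y * ∑ c, val (v t c) y * nrm (𝒯.elt t) i c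
        ∂(surf (face (𝒯.elt t) i)) := fun t =>
    green_trace_field (fun i => 𝒯.isTrace_trace hH1 t i) (MemL2.interior_body 𝒯 hθ t)
      (fun c => ⟨MemL2.interior_body 𝒯 (hDθ c).1 t, (hDθ c).2.mono (𝒯.interior_body_subset t)⟩)
      (v t)
  rw [Finset.sum_congr rfl fun t _ => h1 t]
  refine 𝒯.sum_faces_eq_zero _ (fun t i hF _ => ?_) fun t i t' i' hne hF => ?_
  · refine integral_eq_zero_of_ae ?_
    filter_upwards [ae_surf_mem _ i] with x hx
    simp [hv.2.2 t i hF x hx]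
  · have hγ := (𝒯.isTrace_trace hH1 t i).1
    rw [← hF, ← integral_add (integrable_fun_mul hγ (memLp_normal _ _ fun r => memLp_val_face _ _ _))
      (integrable_fun_mul hγ (memLp_normal _ _ fun r => memLp_val_face _ _ _))]
    refine integral_eq_zero_of_ae ?_
    filter_upwards [𝒯.normal_continuous hv.2.1 hne hF] with x hx
    rw [← mul_add, hx]
    simp

theorem memHs_subId {s : ℝ} {L : Fin d → Fin d → Pt d → ℝ} {π : Pt d → ℝ}
    (hL : ∀ r c, MemHs s Ω (L r c)) (hπ : MemHs s Ω π) (r c : Fin d) :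
    MemHs s Ω (subId L π r c) := by
  by_cases h : r = c
  · have e : subId L π r c = fun x => L r c x - π x := by
      ext x
      simp [subId, h]
    rw [e]
    refine ⟨(hL r c).1.sub hπ.1, ?_⟩
    have h1 := slobodeckijSq_sub_le s (hL r c).1.1 hπ.1.1
    have h2 : slobodeckijSq s Ω (L r c) ^ (1 / 2 : ℝ) + slobodeckijSq s Ω π ^ (1 / 2 : ℝ) < ⊤ :=
      ENNReal.add_lt_top.2 ⟨ENNReal.rpow_lt_top_of_nonneg (by norm_num) (hL r c).2.ne,
        ENNReal.rpow_lt_top_of_nonneg (by norm_num) hπ.2.ne⟩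
    exact (ENNReal.rpow_lt_top_iff_of_pos (by norm_num)).1 (h1.trans_lt h2)
  · have e : subId L π r c = L r c := by
      ext x
      simp [subId, h]
    rw [e]
    exact hL r c

theorem integral_subId (L : Fin d → Fin d → Pt d → ℝ) (π : Pt d → ℝ) (hL : ∀ r c, MemL2 Ω (L r c))
    (hπ : MemL2 Ω π) {φ : Pt d → ℝ} (hφ : IsTest Ω φ) (r : Fin d) :
    ∫ x in Ω, ∑ c, subId L π r c x * pd c φ x =
      (∫ x in Ω, ∑ c, L r c x * pd c φ x) - ∫ x in Ω, π x * pd r φ x := by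
  rw [← integral_sub (integrable_finset_sum _ fun c _ =>
    integrable_fun_mul (hL r c) (hφ.memLp_pd c _)) (integrable_fun_mul hπ (hφ.memLp_pd r _))]
  refine integral_congr_ae (Eventually.of_forall fun x => ?_)
  simp [subId, sub_mul, Finset.sum_sub_distrib, ite_mul]

/-- The value of the pairing `⟨L n, v̂ - v⟩`. -/
theorem tensorPairing_eq (𝒯 : Triangulation Ω ι) (hd : 2 ≤ d) {s : ℝ} (hs : 0 < s) (hs1 : s < 1)
    {L : Fin d → Fin d → Pt d → ℝ} {p : Pt d → ℝ} {f : Fin d → Pt d → ℝ}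
    (hL : ∀ r c, MemHs s Ω (L r c)) (hp : MemHs s Ω p) (hf : ∀ r, MemL2 Ω (f r))
    (hmom : ∀ r φ, IsTest Ω φ →
      (∫ x in Ω, ∑ c, L r c x * pd c φ x) - ∫ x in Ω, p x * pd r φ x = ∫ x in Ω, f r x * φ x)
    {k : ℕ} {v : ι → Fin d → Poly d} (hv : 𝒯.MemV0 k v)
    {vhat : Set (Pt d) → Fin d → Pt d → ℝ} (hvhat : 𝒯.MemVhat0 k vhat) :
    𝒯.tensorPairing s L (fun t i r x => vhat (face (𝒯.elt t) i) r x - val (v t r) x) =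
      ∑ t, ((∑ r, ∫ x in body (𝒯.elt t), f r x * val (v t r) x) -
        (∑ r, ∑ c, ∫ x in body (𝒯.elt t), L r c x * val (MvPolynomial.pderiv c (v t r)) x) +
        ∫ x in body (𝒯.elt t), p x * val (pdiv (v t)) x) := by
  have hdivp : ∀ r, HasWeakDiv Ω (subId L p r) fun x => -f r x := by
    intro r φ hφ
    rw [integral_subId L p (fun r c => (hL r c).1) hp.1 hφ, hmom r φ hφ]
    simp only [neg_mul, integral_neg, neg_neg]
  have hex : ∃ ℓ : ℝ, ∃ π : Pt d → ℝ, MemHs s Ω π ∧ (∀ r, MemHdiv Ω (subId L π r)) ∧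
      ℓ = ∑ t, ∑ i, normalPairing s (𝒯.elt t) i (subId L π)
        (fun r x => vhat (face (𝒯.elt t) i) r x - val (v t r) x) :=
    ⟨_, p, hp, fun r => ⟨fun c => (memHs_subId hL hp r c).1, _, (hf r).neg, hdivp r⟩, rfl⟩
  obtain ⟨π, hπ, hdiv, hval⟩ := Classical.epsilon_spec hex
  choose hσ D hD hDw using hdiv
  refine (hval : 𝒯.tensorPairing s L _ = _).trans ?_
  rw [𝒯.sum_normalPairing hd hs hs1 (memHs_subId hL hπ) hD hDw hvhat v, ← Finset.sum_neg_distrib]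
  -- the difference of the two pressures
  have hθ : ∀ r, HasWeakPartial Ω r (fun x => p x - π x) fun x => D r x + f r x := by
    intro r φ hφ
    have h1 := hmom r φ hφ
    have h2 := hDw r φ hφ
    rw [integral_subId L π (fun r c => (hL r c).1) hπ.1 hφ] at h2
    simp only [sub_mul, add_mul]
    rw [integral_sub (integrable_fun_mul hp.1 (hφ.memLp_pd r _))
      (integrable_fun_mul hπ.1 (hφ.memLp_pd r _)),
      integral_add (integrable_fun_mul (hD r) (hφ.memLp _)) (integrable_fun_mul (hf r) (hφ.memLp _))]
    linarith
  have hzero := 𝒯.integral_grad_mul_add (hp.1.sub hπ.1)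
    (fun r => ⟨(hD r).add (hf r), hθ r⟩) hv
  rw [← sub_eq_zero, ← Finset.sum_sub_distrib, ← neg_eq_zero, ← Finset.sum_neg_distrib, ← hzero]
  refine Finset.sum_congr rfl fun t _ => ?_
  have hLt := fun r c => 𝒯.memL2_body (hL r c).1 t
  have hDt := fun r => 𝒯.memL2_body (hD r) t
  have hft := fun r => 𝒯.memL2_body (hf r) t
  have hpt := 𝒯.memL2_body hp.1 t
  have hπt := 𝒯.memL2_body hπ.1 t
  have hval := fun q => memLp_val_body (𝒯.elt t) q
  have hrow : ∀ r, rowPairing (𝒯.elt t) (subId L π r) (D r) (val (v t r)) =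
      (∫ x in body (𝒯.elt t), D r x * val (v t r) x) +
      (∑ c, ∫ x in body (𝒯.elt t), L r c x * val (MvPolynomial.pderiv c (v t r)) x) -
      ∫ x in body (𝒯.elt t), π x * val (MvPolynomial.pderiv r (v t r)) x := by
    intro r
    rw [rowPairing, ← integral_finset_sum _ fun c _ => integrable_fun_mul (hLt r c) (hval _),
      ← integral_add (integrable_fun_mul (hDt r) (hval _))
        (integrable_finset_sum _ fun c _ => integrable_fun_mul (hLt r c) (hval _)),
      ← integral_sub _ (integrable_fun_mul hπt (hval _))]
    · refine integral_congr_ae (Eventually.of_forall fun x => ?_)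
      simp only [pd_val]
      simp [subId, sub_mul, Finset.sum_sub_distrib, ite_mul]
      ring
    · exact (integrable_fun_mul (hDt r) (hval _)).add
        (integrable_finset_sum _ fun c _ => integrable_fun_mul (hLt r c) (hval _))
  have hsplit : ∀ r, ∫ x in body (𝒯.elt t), (D r x + f r x) * val (v t r) x =
      (∫ x in body (𝒯.elt t), D r x * val (v t r) x) +
        ∫ x in body (𝒯.elt t), f r x * val (v t r) x := by
    intro r
    simp only [add_mul]
    exact integral_add (integrable_fun_mul (hDt r) (hval _)) (integrable_fun_mul (hft r) (hval _))
  have hθs : ∫ x in body (𝒯.elt t), (p x - π x) * val (pdiv (v t)) x =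
      (∫ x in body (𝒯.elt t), p x * val (pdiv (v t)) x) -
        ∫ x in body (𝒯.elt t), π x * val (pdiv (v t)) x := by
    simp only [sub_mul]
    exact integral_sub (integrable_fun_mul hpt (hval _)) (integrable_fun_mul hπt (hval _))
  have hπs : ∫ x in body (𝒯.elt t), π x * val (pdiv (v t)) x =
      ∑ r, ∫ x in body (𝒯.elt t), π x * val (MvPolynomial.pderiv r (v t r)) x := by
    simp only [pdiv, val_sum, Finset.mul_sum]
    exact integral_finset_sum _ fun r _ => integrable_fun_mul hπt (hval _)
  simp only [hrow, Pi.sub_apply, Pi.add_apply, hsplit, hθs, hπs, Finset.sum_add_distrib,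
    Finset.sum_sub_distrib]
  ring

/-- The second equation: momentum consistency. -/
theorem momentum_consistency (𝒯 : Triangulation Ω ι) {k : ℕ}
    {L : Fin d → Fin d → Pt d → ℝ} {p : Pt d → ℝ}
    (hL : ∀ r c, MemL2 Ω (L r c)) (hp : MemL2 Ω p)
    {v : ι → Fin d → Poly d} (hv : ∀ t r, v t r ∈ PolyLE d k)
    {vhat : Set (Pt d) → Fin d → Pt d → ℝ} (hvhat : 𝒯.MemVhat0 k vhat) :
    -𝒯.sumT (fun t x => ∑ r, val (pdiv (𝒯.projS (k - 1) L t r)) x * val (v t r) x)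
      + 𝒯.sumB (fun t i x => ∑ r, (∑ c, val (𝒯.projS (k - 1) L t r c) x * nrm (𝒯.elt t) i c) *
          vhat (face (𝒯.elt t) i) r x)
      - 𝒯.sumT (fun t x => val (𝒯.projQ (k - 1) p t) x * val (pdiv (v t)) x) =
    (∑ t, ((∑ r, ∑ c, ∫ x in body (𝒯.elt t), L r c x * val (MvPolynomial.pderiv c (v t r)) x) -
        ∫ x in body (𝒯.elt t), p x * val (pdiv (v t)) x)) +
      𝒯.sumB (fun t i x =>
        ∑ r, (∑ c, val (𝒯.projS (k - 1) L t r c) x * nrm (𝒯.elt t) i c) *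
          (vhat (face (𝒯.elt t) i) r x - val (v t r) x)) := by
  simp only [sumT, sumB]
  rw [← Finset.sum_neg_distrib, ← Finset.sum_add_distrib, ← Finset.sum_sub_distrib,
    ← Finset.sum_add_distrib]
  refine Finset.sum_congr rfl fun t _ => ?_
  set K := 𝒯.elt t with hK
  set Λ := 𝒯.projS (k - 1) L t with hΛ
  have hval := fun q => memLp_val_body K q
  have h1 : ∫ x in body K, val (𝒯.projQ (k - 1) p t) x * val (pdiv (v t)) x =
      ∫ x in body K, p x * val (pdiv (v t)) x :=
    (elemProj_spec (k - 1) K (𝒯.memL2_body hp t)).2 _ (pdiv_mem_polyLE (hv t))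
  have h2 : ∀ r c, ∫ x in body K, L r c x * val (MvPolynomial.pderiv c (v t r)) x =
      ∫ x in body K, val (Λ r c) x * val (MvPolynomial.pderiv c (v t r)) x := fun r c =>
    ((elemProj_spec (k - 1) K (𝒯.memL2_body (hL r c) t)).2 _ (pderiv_mem_polyLE (hv t r) c)).symm
  have h3 : ∀ r, (∫ x in body K, val (pdiv (Λ r)) x * val (v t r) x) +
      ∑ c, ∫ x in body K, val (Λ r c) x * val (MvPolynomial.pderiv c (v t r)) x =
      ∑ i, ∫ y, (∑ c, val (Λ r c) y * nrm K i c) * val (v t r) y ∂(surf (face K i)) := by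
    intro r
    have := rowPairing_smooth K (fun c => smooth_val (Λ r c)) (smooth_val (v t r))
    rw [sum_pd_val, rowPairing] at this
    simp only [pd_val] at this
    rwa [integral_add (integrable_fun_mul (hval _) (hval _))
      (integrable_finset_sum _ fun j _ => integrable_fun_mul (hval _) (hval _)),
      integral_finset_sum _ fun j _ => integrable_fun_mul (hval _) (hval _)] at this
  have h4 : ∀ i, ∫ x, ∑ r, (∑ c, val (Λ r c) x * nrm K i c) *
      (vhat (face K i) r x - val (v t r) x) ∂(surf (face K i)) =
      (∫ x, ∑ r, (∑ c, val (Λ r c) x * nrm K i c) * vhat (face K i) r x ∂(surf (face K i))) -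
      ∑ r, ∫ x, (∑ c, val (Λ r c) x * nrm K i c) * val (v t r) x ∂(surf (face K i)) := by
    intro i
    have hΛn : ∀ r, MemLp (fun x => ∑ c, val (Λ r c) x * nrm K i c) 2 (surf (face K i)) := fun r =>
      memLp_normal K i fun c => memLp_val_face K i _
    have hvh : ∀ r, MemLp (vhat (face K i) r) 2 (surf (face K i)) := by
      intro r
      obtain ⟨q, -, hqv⟩ := (hvhat _ ⟨t, i, rfl⟩).1 r
      refine (memLp_congr_ae ?_).1 (memLp_val_face K i q)
      filter_upwards [ae_surf_mem K i] with x hx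
      exact (hqv x hx).symm
    rw [← integral_finset_sum _ fun r _ => integrable_fun_mul (hΛn r) (memLp_val_face K i _),
      ← integral_sub (integrable_finset_sum _ fun r _ => integrable_fun_mul (hΛn r) (hvh r))
        (integrable_finset_sum _ fun r _ => integrable_fun_mul (hΛn r) (memLp_val_face K i _))]
    refine integral_congr_ae (Eventually.of_forall fun x => ?_)
    simp only [mul_sub, Finset.sum_sub_distrib]
  rw [h1, integral_finset_sum _ fun r _ => integrable_fun_mul (hval _) (hval _)]
  simp only [h2, h4, Finset.sum_sub_distrib]
  rw [Finset.sum_comm (s := Finset.univ (α := Fin (d + 1))), ← Finset.sum_congr rfl fun r _ => h3 r,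
    Finset.sum_add_distrib]
  ring

end Triangulation

end HDG

end

/-- Consistency of the BDM discontinuous-trace HDG scheme for the Stokes system. -/
theorem BDM_consistency {d : ℕ} [NeZero d] (hd : d = 2 ∨ d = 3)
    {Ω : Set (HDG.Pt d)} {ι : Type*} [Fintype ι] (𝒯 : HDG.Triangulation Ω ι)
    (k : ℕ) (hk : 1 ≤ k) (ν : ℝ) (hν : 0 < ν) (ε : ℝ) (hε0 : 0 < ε) (hε : ε < 1 / 2)
    (L : Fin d → Fin d → HDG.Pt d → ℝ) (u : Fin d → HDG.Pt d → ℝ) (p : HDG.Pt d → ℝ)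
    (f g : Fin d → HDG.Pt d → ℝ)
    (hL : ∀ r c, HDG.MemHs ε Ω (L r c)) (hu : ∀ r, HDG.MemH1 Ω (u r))
    (hp : HDG.MemHs ε Ω p) (hp0 : ∫ x in Ω, p x = 0)
    (hf : ∀ r, HDG.MemL2 Ω (f r))
    (hsol : 𝒯.IsStokesSolution ν L u p f g)
    (G : ι → Fin d → Fin d → HDG.Poly d) (hG : 𝒯.MemSigma k G)
    (v : ι → Fin d → HDG.Poly d) (hv : 𝒯.MemV0 k v)
    (vhat : Set (HDG.Pt d) → Fin d → HDG.Pt d → ℝ) (hvhat : 𝒯.MemVhat0 k vhat)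
    (q : ι → HDG.Poly d) (hq : 𝒯.MemQ k q) :
    𝒯.bform k ν (𝒯.projS (k - 1) L) (𝒯.projBDM k u) (𝒯.projTrace (k - 1) u)
        (𝒯.projQ (k - 1) p) G v vhat q =
      𝒯.sumT (fun t x => ∑ r, f r x * HDG.val (v t r) x) +
        𝒯.cerr ε k ν L u G v vhat := by
  have hd2 : 2 ≤ d := by omega
  obtain ⟨hgrad, hmom, hdiv, -⟩ := hsol
  have h1 := 𝒯.gradient_consistency (fun r c => (hL r c).1) hu hgrad hG (𝒯.projBDM k u)
  have h2 := 𝒯.momentum_consistency (fun r c => (hL r c).1) hp.1 hv.1 hvhat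
  have h3 := 𝒯.stabilization_consistency hu (𝒯.projBDM k u) v hvhat
  have h4 := 𝒯.divergence_consistency hk (D := fun r c x => ν⁻¹ * L r c x)
    (fun r c => (hL r c).1.const_mul _) hu hgrad hdiv hq.1
  have h5 := 𝒯.tensorPairing_eq hd2 hε0 (by linarith) hL hp hf hmom hv hvhat
  have h6 : 𝒯.sumT (fun t x => ∑ r, f r x * HDG.val (v t r) x) =
      ∑ t, ∑ r, ∫ x in HDG.body (𝒯.elt t), f r x * HDG.val (v t r) x :=
    Finset.sum_congr rfl fun t _ => integral_finset_sum _ fun r _ =>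
      HDG.integrable_fun_mul (𝒯.memL2_body (hf r) t) (HDG.memLp_val_body _ _)
  simp only [Finset.sum_add_distrib, Finset.sum_sub_distrib] at h2 h5
  rw [HDG.Triangulation.bform, HDG.Triangulation.cerr, h3, h4, h5, h6]
  linarith
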